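/- Let d ≥ 3 and p > p_c(d). Then there exist constants a = a(p,d) > 0 and b = b(p,d) > 0 such that π_p(E_M^c) ≤ a·exp(−b·M) for every M ∈ ℕ. -/

import Mathlib

open MeasureTheory

namespace VoterPerc



abbrev Site (d : ℕ) := Fin d → ℤ
abbrev Config (d : ℕ) := Site d → Bool

/-- ℓ∞ distance between two sites. -/
def dinf {d : ℕ} (x y : Site d) : ℕ := Finset.univ.sup fun i => (x i - y i).natAbs

/-- ℓ¹ distance between two sites. -/
def d1 {d : ℕ} (x y : Site d) : ℕ := ∑ i, (x i - y i).natAbs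

/-- The ℓ∞ ball of (integer) radius `r` centred at `c`. -/
def ball {d : ℕ} (c : Site d) (r : ℤ) : Set (Site d) := {y | (dinf y c : ℤ) ≤ r}

/-- Translation of configurations: `(translate z ξ) y = ξ (y - z)`. -/
def translate {d : ℕ} (z : Site d) (ξ : Config d) : Config d := fun y => ξ (y - z)

/-- The percolation event: there is an infinite nearest-neighbour path of distinct open sites. -/
def Perc (d : ℕ) : Set (Config d) :=
  {ξ | ∃ γ : ℕ → Site d, Function.Injective γ ∧
    (∀ n, d1 (γ n) (γ (n + 1)) = 1) ∧ (∀ n, ξ (γ n) = true)}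

/-- `StarCross ξ A B`: there is a finite `*`-connected path of `ξ`-open sites from a
`*`-neighbour of a point of `A` to a `*`-neighbour of a point of `B`. -/
def StarCross {d : ℕ} (ξ : Config d) (A B : Set (Site d)) : Prop :=
  ∃ (n : ℕ) (γ : ℕ → Site d),
    (∃ a ∈ A, dinf (γ 0) a = 1) ∧ (∃ b ∈ B, dinf (γ n) b = 1) ∧
    (∀ i < n, dinf (γ i) (γ (i + 1)) = 1) ∧ (∀ i ≤ n, ξ (γ i) = true)

/-- `ConnIn ξ S x y`: `x` and `y` are joined by a nearest-neighbour path of `ξ`-open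
sites staying in `S` (in particular `x` and `y` are open and lie in `S`). -/
def ConnIn {d : ℕ} (ξ : Config d) (S : Set (Site d)) (x y : Site d) : Prop :=
  ∃ (n : ℕ) (γ : ℕ → Site d), γ 0 = x ∧ γ n = y ∧
    (∀ i ≤ n, γ i ∈ S ∧ ξ (γ i) = true) ∧ (∀ i < n, d1 (γ i) (γ (i + 1)) = 1)

/-- The open cluster of `x` inside the box `B(M)`. -/
def ClusterOf (d M : ℕ) (ξ : Config d) (x : Site d) : Set (Site d) :=
  {y | ConnIn ξ (ball (0 : Site d) (M : ℤ)) x y}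

/-- The open cluster of `x` inside `B(M)` has ℓ∞-diameter at least `M`. -/
def BigCluster (d M : ℕ) (ξ : Config d) (x : Site d) : Prop :=
  ∃ u ∈ ClusterOf d M ξ x, ∃ v ∈ ClusterOf d M ξ x, M ≤ dinf u v

/-- The event `E_M`: inside `B(M)` there is a unique open cluster of diameter at least
`M`, and this cluster meets each of the `2d` faces of `B(M)`. -/
def EM (d M : ℕ) : Set (Config d) :=
  {ξ | (∃ x, BigCluster d M ξ x) ∧
    (∀ x y, BigCluster d M ξ x → BigCluster d M ξ y → y ∈ ClusterOf d M ξ x) ∧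
    (∀ x, BigCluster d M ξ x → ∀ i : Fin d,
      (∃ y ∈ ClusterOf d M ξ x, y i = (M : ℤ)) ∧
      (∃ y ∈ ClusterOf d M ξ x, y i = -(M : ℤ)))}

/-- `μ` is the Bernoulli(`p`) product measure on `{0,1}^{ℤ^d}`: a probability measure
whose cylinder probabilities are the i.i.d. Bernoulli(`p`) ones. -/
def IsBernoulliProduct (d : ℕ) (p : ℝ) (μ : Measure (Config d)) : Prop :=
  IsProbabilityMeasure μ ∧
    ∀ (S : Finset (Site d)) (η : Site d → Bool),
      μ {ξ : Config d | ∀ x ∈ S, ξ x = η x} =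
        ∏ x ∈ S, ENNReal.ofReal (if η x = true then p else 1 - p)


set_option linter.all false

/-! ### P1: Bernoulli product measures -/
section P1
variable {ι : Type*}

/-- clamp to the unit interval -/
noncomputable def cl (r : ℝ) : ℝ := max 0 (min r 1)

lemma cl_nonneg (r : ℝ) : 0 ≤ cl r := le_max_left _ _
lemma cl_le_one (r : ℝ) : cl r ≤ 1 := max_le zero_le_one (min_le_right _ _)
lemma cl_of_mem {r : ℝ} (h0 : 0 ≤ r) (h1 : r ≤ 1) : cl r = r := by
  simp [cl, h0, h1]

noncomputable def bern (r : ℝ) : Measure Bool :=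
  ENNReal.ofReal (cl r) • Measure.dirac true + ENNReal.ofReal (1 - cl r) • Measure.dirac false

instance (r : ℝ) : IsProbabilityMeasure (bern r) := by
  refine ⟨?_⟩
  simp only [bern, Measure.add_apply, Measure.smul_apply, measure_univ, smul_eq_mul, mul_one]
  rw [← ENNReal.ofReal_add (cl_nonneg r) (by linarith [cl_le_one r])]
  simp

lemma bern_true (r : ℝ) : bern r {true} = ENNReal.ofReal (cl r) := by
  simp [bern]
lemma bern_false (r : ℝ) : bern r {false} = ENNReal.ofReal (1 - cl r) := by
  simp [bern]

noncomputable def mu (r : ι → ℝ) : Measure (ι → Bool) := Measure.infinitePi (fun x => bern (r x))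

instance (r : ι → ℝ) : IsProbabilityMeasure (mu r) := by unfold mu; infer_instance

noncomputable def Pr (r : ι → ℝ) (E : Set (ι → Bool)) : ℝ := (mu r).real E

/-- E depends only on the coordinates in A -/
def Dep (E : Set (ι → Bool)) (A : Set ι) : Prop :=
  ∀ ω ω' : ι → Bool, (∀ x ∈ A, ω x = ω' x) → (ω ∈ E → ω' ∈ E)

lemma Dep.iff {E : Set (ι → Bool)} {A : Set ι} (h : Dep E A) {ω ω' : ι → Bool}
    (hw : ∀ x ∈ A, ω x = ω' x) : ω ∈ E ↔ ω' ∈ E :=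
  ⟨h _ _ hw, h _ _ fun x hx => (hw x hx).symm⟩

lemma Dep.mono {E : Set (ι → Bool)} {A B : Set ι} (h : Dep E A) (hAB : A ⊆ B) : Dep E B :=
  fun ω ω' hw => h ω ω' fun x hx => hw x (hAB hx)

lemma Dep.inter {E F : Set (ι → Bool)} {A : Set ι} (h : Dep E A) (h' : Dep F A) :
    Dep (E ∩ F) A := fun ω ω' hw hh => ⟨h ω ω' hw hh.1, h' ω ω' hw hh.2⟩

lemma Dep.union {E F : Set (ι → Bool)} {A : Set ι} (h : Dep E A) (h' : Dep F A) :
    Dep (E ∪ F) A := fun ω ω' hw hh => hh.imp (h ω ω' hw) (h' ω ω' hw)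

lemma Dep.compl {E : Set (ι → Bool)} {A : Set ι} (h : Dep E A) : Dep Eᶜ A :=
  fun ω ω' hw hh hh' => hh (h ω' ω (fun x hx => (hw x hx).symm) hh')

lemma Dep.diff {E F : Set (ι → Bool)} {A : Set ι} (h : Dep E A) (h' : Dep F A) :
    Dep (E \ F) A := h.inter h'.compl

lemma Dep.iInter {κ : Sort*} {E : κ → Set (ι → Bool)} {A : Set ι} (h : ∀ k, Dep (E k) A) :
    Dep (⋂ k, E k) A := fun ω ω' hw hh => by
  simp only [Set.mem_iInter] at *; exact fun k => h k ω ω' hw (hh k)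

lemma Dep.iUnion {κ : Sort*} {E : κ → Set (ι → Bool)} {A : Set ι} (h : ∀ k, Dep (E k) A) :
    Dep (⋃ k, E k) A := fun ω ω' hw hh => by
  simp only [Set.mem_iUnion] at *; exact hh.imp fun k => h k ω ω' hw

lemma Dep.univ {A : Set ι} : Dep (Set.univ : Set (ι → Bool)) A := fun _ _ _ _ => trivial

/-- the restriction of a Dep set -/
lemma Dep.eq_preimage {E : Set (ι → Bool)} {A : Finset ι} (h : Dep E A) :
    E = (fun ω (i : A) => ω i) ⁻¹' ((fun ω (i : A) => ω i) '' E) := by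
  ext ω
  constructor
  · exact fun hw => ⟨ω, hw, rfl⟩
  · rintro ⟨ω', hw', he⟩
    exact h ω' ω (fun x hx => congrFun he ⟨x, hx⟩) hw'

lemma Dep.measurable {E : Set (ι → Bool)} {A : Set ι} (h : Dep E A) (hA : A.Finite) :
    MeasurableSet E := by
  have h' : Dep E (hA.toFinset : Set ι) := by simpa using h
  rw [h'.eq_preimage]
  exact (measurable_pi_lambda _ fun i => measurable_pi_apply _) (Set.toFinite _).measurableSet

lemma Dep.indep {r : ι → ℝ} {E F : Set (ι → Bool)} {A B : Set ι} (hE : Dep E A) (hF : Dep F B)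
    (hA : A.Finite) (hB : B.Finite) (hAB : Disjoint A B) : Pr r (E ∩ F) = Pr r E * Pr r F := by
  have hE' : Dep E (hA.toFinset : Set ι) := by simpa using hE
  have hF' : Dep F (hB.toFinset : Set ι) := by simpa using hF
  have hd : Disjoint hA.toFinset hB.toFinset := by simpa using hAB
  have := ProbabilityTheory.iIndepFun.indepFun_finset (μ := mu r) (f := fun i (ω : ι → Bool) => ω i)
    hA.toFinset hB.toFinset hd
    (ProbabilityTheory.iIndepFun_infinitePi (X := fun _ b => b) (fun i => measurable_id))
    (fun i => measurable_pi_apply i)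
  rw [ProbabilityTheory.indepFun_iff_measure_inter_preimage_eq_mul] at this
  have h2 := this _ _ (Set.toFinite ((fun ω (i : hA.toFinset) => ω i) '' E)).measurableSet
     (Set.toFinite ((fun ω (i : hB.toFinset) => ω i) '' F)).measurableSet
  have e1 := hE'.eq_preimage
  have e2 := hF'.eq_preimage
  unfold Pr Measure.real
  rw [← ENNReal.toReal_mul]
  congr 1
  rw [← e1, ← e2] at h2
  exact h2

lemma Pr_nonneg (r : ι → ℝ) (E : Set (ι → Bool)) : 0 ≤ Pr r E := measureReal_nonneg
lemma Pr_le_one (r : ι → ℝ) (E : Set (ι → Bool)) : Pr r E ≤ 1 := measureReal_le_one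
@[simp] lemma Pr_univ (r : ι → ℝ) : Pr r Set.univ = 1 := by simp [Pr]
@[simp] lemma Pr_empty (r : ι → ℝ) : Pr r ∅ = 0 := by simp [Pr]
lemma Pr_mono (r : ι → ℝ) {E F : Set (ι → Bool)} (h : E ⊆ F) : Pr r E ≤ Pr r F :=
  measureReal_mono h
lemma Pr_union_le (r : ι → ℝ) (E F : Set (ι → Bool)) : Pr r (E ∪ F) ≤ Pr r E + Pr r F :=
  measureReal_union_le E F
lemma Pr_iUnion_le {κ : Type*} [Fintype κ] (r : ι → ℝ) (E : κ → Set (ι → Bool)) :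
    Pr r (⋃ k, E k) ≤ ∑ k, Pr r (E k) :=
  measureReal_iUnion_fintype_le E
lemma Pr_biUnion_le {κ : Type*} (s : Finset κ) (r : ι → ℝ) (E : κ → Set (ι → Bool)) :
    Pr r (⋃ k ∈ s, E k) ≤ ∑ k ∈ s, Pr r (E k) :=
  measureReal_biUnion_finset_le s E
lemma Pr_compl (r : ι → ℝ) {E : Set (ι → Bool)} {A : Set ι} (h : Dep E A) (hA : A.Finite) :
    Pr r Eᶜ = 1 - Pr r E := by
  unfold Pr; rw [measureReal_compl (h.measurable hA)]; simp
/-- splitting along a finite-dependence event -/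
lemma Pr_split (r : ι → ℝ) (E : Set (ι → Bool)) {F : Set (ι → Bool)} {A : Set ι} (h : Dep F A)
    (hA : A.Finite) : Pr r E = Pr r (E ∩ F) + Pr r (E ∩ Fᶜ) := by
  have := measureReal_inter_add_sdiff (μ := mu r) (s := E) (h.measurable hA)
  unfold Pr; rw [← this, Set.diff_eq]
/-- total probability over a finite-valued quantity -/
lemma Pr_sum_fiber {κ : Type*} (s : Finset κ) (r : ι → ℝ) (E : Set (ι → Bool)) {A : Set ι}
    (hA : A.Finite) (X : (ι → Bool) → κ) (hX : ∀ k ∈ s, Dep {ω | X ω = k} A)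
    (hs : ∀ ω, X ω ∈ s) : Pr r E = ∑ k ∈ s, Pr r (E ∩ {ω | X ω = k}) := by
  classical
  have key : ∀ t : Finset κ, t ⊆ s → Pr r (E ∩ {ω | X ω ∈ t}) = ∑ k ∈ t, Pr r (E ∩ {ω | X ω = k}) := by
    intro t
    induction t using Finset.induction_on with
    | empty => simp
    | insert a t ha ih =>
      intro ht
      rw [Finset.sum_insert ha, ← ih (fun x hx => ht (Finset.mem_insert_of_mem hx)),
        Pr_split r (E ∩ {ω | X ω ∈ insert a t}) (hX a (ht (Finset.mem_insert_self _ _))) hA]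
      congr 2
      · ext ω; simp; grind
      · ext ω; simp; grind
  rw [← key s subset_rfl]; congr 1; ext ω; simp [hs]

lemma Dep.coord (x : ι) (b : Bool) : Dep {ω : ι → Bool | ω x = b} {x} := fun ω ω' h hw => by
  simpa [h x rfl] using hw

lemma Pr_coord_true (r : ι → ℝ) (x : ι) : Pr r {ω | ω x = true} = cl (r x) := by
  unfold Pr Measure.real mu
  have h := Measure.infinitePi_map_eval (fun x => bern (r x)) x
  have h2 : (Measure.infinitePi (fun x => bern (r x))).map (fun ω => ω x) {true} = ENNReal.ofReal (cl (r x)) := by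
    have := congrArg (fun m => m {true}) h
    rw [← bern_true]; exact this
  rw [Measure.map_apply (measurable_pi_apply x) (by simp)] at h2
  have h3 : {ω : ι → Bool | ω x = true} = (fun ω => ω x) ⁻¹' {true} := by ext; simp
  rw [h3, h2, ENNReal.toReal_ofReal (cl_nonneg _)]

lemma Pr_coord_false (r : ι → ℝ) (x : ι) : Pr r {ω | ω x = false} = 1 - cl (r x) := by
  rw [← Pr_coord_true, ← Pr_compl r (Dep.coord x true) (Set.finite_singleton x)]
  congr 1; ext; simp

variable [DecidableEq ι]

/-- conditioned event -/
def cnd (E : Set (ι → Bool)) (x : ι) (b : Bool) : Set (ι → Bool) := {ω | Function.update ω x b ∈ E}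

lemma Dep.cnd {E : Set (ι → Bool)} {A : Set ι} (h : Dep E A) (x : ι) (b : Bool) :
    Dep (cnd E x b) (A \ {x}) := by
  intro ω ω' hw
  apply h
  intro y hy
  by_cases hyx : y = x
  · subst hyx; simp
  · simp [hyx, hw y ⟨hy, hyx⟩]

lemma Dep.cnd' {E : Set (ι → Bool)} {A : Finset ι} {x : ι} (h : Dep E ↑(insert x A)) (b : Bool) :
    Dep (VoterPerc.cnd E x b) A := (h.cnd x b).mono (by
      intro y; simp; tauto)

/-- one-site conditioning -/
lemma Pr_cond (r : ι → ℝ) {E : Set (ι → Bool)} {A : Set ι} (h : Dep E A) (hA : A.Finite) (x : ι) :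
    Pr r E = cl (r x) * Pr r (cnd E x true) + (1 - cl (r x)) * Pr r (cnd E x false) := by
  have hd : Disjoint (A \ {x}) {x} := Set.disjoint_sdiff_left
  rw [Pr_split r E (Dep.coord x true) (Set.finite_singleton x)]
  have e1 : E ∩ {ω | ω x = true} = cnd E x true ∩ {ω | ω x = true} := by
    ext ω; simp only [Set.mem_inter_iff, cnd, Set.mem_ofPred_eq]
    refine and_congr_left fun hh => ?_
    rw [← hh, Function.update_eq_self]
  have e2 : E ∩ {ω | ω x = true}ᶜ = cnd E x false ∩ {ω | ω x = false} := by
    ext ω; simp only [Set.mem_inter_iff, cnd, Set.mem_ofPred_eq, Set.mem_compl_iff, Bool.not_eq_true]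
    refine and_congr_left fun hh => ?_
    rw [← hh, Function.update_eq_self]
  rw [e1, e2, (h.cnd x true).indep (Dep.coord x true) (hA.sdiff) (Set.finite_singleton x) hd,
    (h.cnd x false).indep (Dep.coord x false) (hA.sdiff) (Set.finite_singleton x) hd,
    Pr_coord_true, Pr_coord_false]
  ring

lemma Dep.empty_cases {E : Set (ι → Bool)} (h : Dep E ∅) : E = ∅ ∨ E = Set.univ := by
  rcases E.eq_empty_or_nonempty with h' | ⟨ω, hω⟩
  · exact Or.inl h'
  · exact Or.inr (Set.eq_univ_of_forall fun ω' => h ω ω' (by simp) hω)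

lemma Pr_congr {r r' : ι → ℝ} {A : Set ι} (hA : A.Finite) {E : Set (ι → Bool)} (h : Dep E A)
    (hr : ∀ x ∈ A, r x = r' x) : Pr r E = Pr r' E := by
  induction A, hA using Set.Finite.induction_on generalizing E with
  | empty => rcases h.empty_cases with rfl | rfl <;> simp
  | @insert x A hx hA ih =>
    have hi : (insert x A).Finite := hA.insert x
    have hs : insert x A \ {x} ⊆ A := by intro y; simp; tauto
    rw [Pr_cond r h hi x, Pr_cond r' h hi x, hr x (Set.mem_insert _ _),
      ih ((h.cnd x true).mono hs) (fun y hy => hr y (Set.mem_insert_of_mem _ hy)),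
      ih ((h.cnd x false).mono hs) (fun y hy => hr y (Set.mem_insert_of_mem _ hy))]

/-- increasing event -/
def Inc (E : Set (ι → Bool)) : Prop := ∀ ω ω' : ι → Bool, (∀ x, ω x = true → ω' x = true) → ω ∈ E → ω' ∈ E

lemma Inc.cnd {E : Set (ι → Bool)} (h : Inc E) (x : ι) (b : Bool) : Inc (cnd E x b) := by
  intro ω ω' hw
  apply h
  intro y
  by_cases hyx : y = x
  · subst hyx; simp
  · simp [hyx]; exact hw y

lemma Inc.cnd_sub {E : Set (ι → Bool)} (h : Inc E) (x : ι) : VoterPerc.cnd E x false ⊆ VoterPerc.cnd E x true := by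
  intro ω
  apply h
  intro y
  by_cases hyx : y = x
  · subst hyx; simp
  · simp [hyx]

lemma cl_mono {a b : ℝ} (h : a ≤ b) : cl a ≤ cl b := by
  unfold cl; exact max_le_max le_rfl (min_le_min h le_rfl)

/-- L5 -/
lemma Pr_inc {r r' : ι → ℝ} {A : Set ι} (hA : A.Finite) {E : Set (ι → Bool)} (h : Dep E A)
    (hi : Inc E) (hr : ∀ x ∈ A, r x ≤ r' x) : Pr r E ≤ Pr r' E := by
  induction A, hA using Set.Finite.induction_on generalizing E with
  | empty => rcases h.empty_cases with rfl | rfl <;> simp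
  | @insert x A hx hA ih =>
    have hf : (insert x A).Finite := hA.insert x
    have hs : insert x A \ {x} ⊆ A := by intro y; simp; tauto
    rw [Pr_cond r h hf x, Pr_cond r' h hf x]
    have h1 := ih ((h.cnd x true).mono hs) (hi.cnd x true) (fun y hy => hr y (Set.mem_insert_of_mem _ hy))
    have h2 := ih ((h.cnd x false).mono hs) (hi.cnd x false) (fun y hy => hr y (Set.mem_insert_of_mem _ hy))
    have h3 := Pr_mono r (hi.cnd_sub x)
    have h4 := cl_mono (hr x (Set.mem_insert _ _))
    have := cl_le_one (r' x)
    have := cl_nonneg (r' x)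
    nlinarith [mul_le_mul_of_nonneg_left h1 this, mul_le_mul_of_nonneg_left h2 (sub_nonneg.2 ‹cl (r' x) ≤ 1›),
      mul_nonneg (sub_nonneg.2 h4) (sub_nonneg.2 h3)]

/-- L6 Harris -/
lemma Harris {r : ι → ℝ} {A : Set ι} (hA : A.Finite) {E F : Set (ι → Bool)} (h : Dep E A)
    (h' : Dep F A) (hi : Inc E) (hi' : Inc F) : Pr r E * Pr r F ≤ Pr r (E ∩ F) := by
  induction A, hA using Set.Finite.induction_on generalizing E F with
  | empty => rcases h.empty_cases with rfl | rfl <;> rcases h'.empty_cases with rfl | rfl <;> simp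
  | @insert x A hx hA ih =>
    have hf : (insert x A).Finite := hA.insert x
    have hs : insert x A \ {x} ⊆ A := by intro y; simp; tauto
    rw [Pr_cond r h hf x, Pr_cond r h' hf x, Pr_cond r (h.inter h') hf x]
    have h1 := ih ((h.cnd x true).mono hs) ((h'.cnd x true).mono hs) (hi.cnd x true) (hi'.cnd x true)
    have h2 := ih ((h.cnd x false).mono hs) ((h'.cnd x false).mono hs) (hi.cnd x false) (hi'.cnd x false)
    have e : ∀ b, cnd (E ∩ F) x b = cnd E x b ∩ cnd F x b := fun b => rfl
    rw [e, e]
    have h3 := Pr_mono r (hi.cnd_sub x)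
    have h4 := Pr_mono r (hi'.cnd_sub x)
    have h5 := cl_le_one (r x)
    have h6 := cl_nonneg (r x)
    set c := cl (r x)
    nlinarith [mul_le_mul_of_nonneg_left h1 h6, mul_le_mul_of_nonneg_left h2 (sub_nonneg.2 h5),
      mul_nonneg (mul_nonneg h6 (sub_nonneg.2 h5)) (mul_nonneg (sub_nonneg.2 h3) (sub_nonneg.2 h4))]

/-- Harris for decreasing events -/
lemma Harris_compl {r : ι → ℝ} {A : Set ι} (hA : A.Finite) {E F : Set (ι → Bool)} (h : Dep E A)
    (h' : Dep F A) (hi : Inc Eᶜ) (hi' : Inc Fᶜ) : Pr r E * Pr r F ≤ Pr r (E ∩ F) := by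
  have h1 := Harris (r := r) hA h.compl h'.compl hi hi'
  have h2 := Pr_split r Eᶜ h' hA
  have h3 := Pr_split r F h hA
  rw [Pr_compl r h hA, Pr_compl r h' hA] at h1
  rw [Pr_compl r h hA] at h2
  rw [Set.inter_comm F E, Set.inter_comm F Eᶜ] at h3
  nlinarith

/-- L4: OR-coupling -/
def orc (K : Set ι) [DecidablePred (· ∈ K)] (ω : ι ⊕ ι → Bool) : ι → Bool :=
  fun x => (if x ∈ K then false else ω (Sum.inl x)) || ω (Sum.inr x)

lemma Pr_orc (K : Set ι) [DecidablePred (· ∈ K)] {r u v : ι → ℝ} {A : Set ι} (hA : A.Finite)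
    {E : Set (ι → Bool)} (h : Dep E A)
    (hr : ∀ x ∈ A, 1 - cl (r x) = (1 - if x ∈ K then 0 else cl (u x)) * (1 - cl (v x))) :
    Pr r E = Pr (Sum.elim u v) {ω | orc K ω ∈ E} := by
  have dep : ∀ {E : Set (ι → Bool)} {A : Set ι}, Dep E A →
      Dep {ω | orc K ω ∈ E} (Sum.inl '' A ∪ Sum.inr '' A) := by
    intro E A h ω ω' hw
    apply h
    intro x hx
    simp only [orc, hw (Sum.inl x) (Or.inl ⟨x, hx, rfl⟩), hw (Sum.inr x) (Or.inr ⟨x, hx, rfl⟩)]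
  induction A, hA using Set.Finite.induction_on generalizing E with
  | empty => rcases h.empty_cases with rfl | rfl <;> simp
  | @insert x A hx hA ih =>
    have hf : (insert x A).Finite := hA.insert x
    have hs : insert x A \ {x} ⊆ A := by intro y; simp; tauto
    have hf2 := (hf.image Sum.inl).union (hf.image (Sum.inr : ι → ι ⊕ ι))
    have h1 := ih ((h.cnd x true).mono hs) (fun y hy => hr y (Set.mem_insert_of_mem _ hy))
    have h2 := ih ((h.cnd x false).mono hs) (fun y hy => hr y (Set.mem_insert_of_mem _ hy))
    have hx' := hr x (Set.mem_insert _ _)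
    have d := dep h
    rw [Pr_cond r h hf x, Pr_cond _ d hf2 (Sum.inl x),
      Pr_cond _ (d.cnd _ _) (hf2.sdiff) (Sum.inr x), Pr_cond _ (d.cnd _ _) (hf2.sdiff) (Sum.inr x), h1, h2]
    simp only [Sum.elim_inl, Sum.elim_inr]
    have e : ∀ b1 b2, cnd (cnd {ω | orc K ω ∈ E} (Sum.inl x) b1) (Sum.inr x) b2
        = {ω | orc K ω ∈ cnd E x ((if x ∈ K then false else b1) || b2)} := by
      intro b1 b2
      ext ω
      simp only [cnd, Set.mem_ofPred_eq]
      apply iff_of_eq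
      congr 1
      funext y
      by_cases hy : y = x
      · subst hy; simp [orc]
      · simp [orc, hy]
    simp only [e]
    by_cases hk : x ∈ K <;> simp only [hk, if_true, if_false, Bool.or_true, Bool.or_false, Bool.true_or, Bool.false_or] at hx' ⊢
    · rw [show cl (r x) = cl (v x) by linarith]; ring
    · rw [show cl (r x) = 1 - (1 - cl (u x)) * (1 - cl (v x)) by linarith]; ring

/-- L8: invariance under injections -/
lemma Pr_map {κ : Type*} (r : ι → ℝ) (f : κ → ι) (hf : Function.Injective f)
    {E : Set (κ → Bool)} {A : Set κ} (h : Dep E A) (hA : A.Finite) :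
    Pr r {ω | (fun k => ω (f k)) ∈ E} = Pr (fun k => r (f k)) E := by
  have := Measure.map_infinitePi_infinitePi_of_inj (P := fun x => bern (r x)) hf
  unfold Pr Measure.real mu
  rw [← this, Measure.map_apply (measurable_pi_lambda _ fun k => measurable_pi_apply _) (h.measurable hA)]
  rfl

/-- all open on a finite set -/
lemma Pr_all (r : ι → ℝ) (S : Finset ι) : Pr r {ω | ∀ x ∈ S, ω x = true} = ∏ x ∈ S, cl (r x) := by
  classical
  induction S using Finset.induction_on with
  | empty => simp
  | insert a S ha ih =>
    have e : {ω : ι → Bool | ∀ x ∈ insert a S, ω x = true} = {ω | ω a = true} ∩ {ω | ∀ x ∈ S, ω x = true} := by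
      ext; simp
    have hd : Dep {ω : ι → Bool | ∀ x ∈ S, ω x = true} (S : Set ι) := fun ω ω' h hw x hx => by
      rw [← h x hx]; exact hw x hx
    rw [e, (Dep.coord a true).indep hd (Set.finite_singleton a) S.finite_toSet (by simpa using ha), ih,
      Pr_coord_true, Finset.prod_insert ha]

lemma Dep.allFalse (S : Set ι) : Dep {ω : ι → Bool | ∀ x ∈ S, ω x = false} S := fun ω ω' h hw x hx => by
  rw [← h x hx]; exact hw x hx

lemma Dep.allTrue (S : Set ι) : Dep {ω : ι → Bool | ∀ x ∈ S, ω x = true} S := fun ω ω' h hw x hx => by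
  rw [← h x hx]; exact hw x hx

lemma Pr_none (r : ι → ℝ) (S : Finset ι) : Pr r {ω | ∀ x ∈ S, ω x = false} = ∏ x ∈ S, (1 - cl (r x)) := by
  classical
  induction S using Finset.induction_on with
  | empty => simp
  | insert a S ha ih =>
    have e : {ω : ι → Bool | ∀ x ∈ insert a S, ω x = false} = {ω | ω a = false} ∩ {ω | ∀ x ∈ S, ω x = false} := by
      ext; simp
    have hd : Dep {ω : ι → Bool | ∀ x ∈ S, ω x = false} (S : Set ι) := Dep.allFalse _
    rw [e, (Dep.coord a false).indep hd (Set.finite_singleton a) S.finite_toSet (by simpa using ha), ih,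
      Pr_coord_false, Finset.prod_insert ha]

/-- uniqueness -/
lemma eq_mu {d : ℕ} {p : ℝ} (hp : p ∈ Set.Icc (0:ℝ) 1) {ν : Measure (Config d)} (h : IsBernoulliProduct d p ν) :
    ν = mu (fun _ => p) := by
  classical
  obtain ⟨hpr, h⟩ := h
  refine Measure.eq_infinitePi _ fun S t ht => ?_
  have e1 : ∀ T ⊆ S, ∀ η : Site d → Bool, ν (Set.pi T t ∩ {ξ | ∀ x ∈ S \ T, ξ x = η x}) =
      (∏ x ∈ T, bern p (t x)) * ∏ x ∈ S \ T, ENNReal.ofReal (if η x = true then p else 1 - p) := by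
    intro T
    induction T using Finset.induction_on with
    | empty =>
      intro _ η
      simpa using h S η
    | insert a T ha ih =>
      intro hT η
      have haS : a ∈ S := hT (Finset.mem_insert_self _ _)
      have hTS : T ⊆ S := fun x hx => hT (Finset.mem_insert_of_mem hx)
      have hsd : S \ T = insert a (S \ insert a T) := by
        ext x; simp only [Finset.mem_sdiff, Finset.mem_insert]; grind
      have hna : a ∉ S \ insert a T := by simp
      have hb : ∀ b, ν (Set.pi T t ∩ {ξ | ∀ x ∈ S \ insert a T, ξ x = η x} ∩ {ξ | ξ a = b}) =
          (∏ x ∈ T, bern p (t x)) * ((∏ x ∈ S \ insert a T, ENNReal.ofReal (if η x = true then p else 1 - p)) * bern p {b}) := by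
        intro b
        have := ih hTS (Function.update η a b)
        rw [hsd, Finset.prod_insert hna] at this
        have e2 : ∏ x ∈ S \ insert a T, ENNReal.ofReal (if Function.update η a b x = true then p else 1 - p)
          = ∏ x ∈ S \ insert a T, ENNReal.ofReal (if η x = true then p else 1 - p) := by
          apply Finset.prod_congr rfl
          intro x hx
          rw [Function.update_of_ne]; rintro rfl; exact hna hx
        have e3 : ENNReal.ofReal (if Function.update η a b a = true then p else 1 - p) = bern p {b} := by
          cases b <;> simp [bern_true, bern_false, cl_of_mem hp.1 hp.2]
        rw [e2, e3] at this
        rw [mul_comm (bern p {b})] at this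
        rw [← this]
        congr 1
        ext ξ
        simp only [Set.mem_inter_iff, Set.mem_ofPred_eq, Finset.mem_insert, and_assoc]
        refine and_congr_right fun _ => ⟨fun ⟨h1, h2⟩ x hx => ?_, fun h1 => ⟨fun x hx => ?_, ?_⟩⟩
        · rcases hx with rfl | hx
          · simpa using h2
          · rw [Function.update_of_ne (by rintro rfl; exact hna hx)]; exact h1 x hx
        · have := h1 x (Or.inr hx)
          rwa [Function.update_of_ne (by rintro rfl; exact hna hx)] at this
        · simpa using h1 a (Or.inl rfl)
      have hms : ∀ b, MeasurableSet {ξ : Config d | ξ a = b} := fun b => (Dep.coord a b).measurable (Set.finite_singleton a)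
      have split : ∀ G : Set (Config d), ν G = ν (G ∩ {ξ | ξ a = true}) + ν (G ∩ {ξ | ξ a = false}) := by
        intro G
        rw [← measure_inter_add_sdiff G (hms true)]
        congr 2; ext ξ; simp
      have hbs : bern p (t a) = (if true ∈ t a then bern p {true} else 0) + (if false ∈ t a then bern p {false} else 0) := by
        by_cases h1 : true ∈ t a <;> by_cases h2 : false ∈ t a <;> simp only [h1, h2, if_true, if_false]
        · rw [← measure_union (by simp) (by simp)]
          congr 1; ext b; cases b <;> simp [h1, h2]
        · rw [add_zero]; congr 1; ext b; cases b <;> simp [h1, h2]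
        · rw [zero_add]; congr 1; ext b; cases b <;> simp [h1, h2]
        · rw [show t a = ∅ by ext b; cases b <;> simp [h1, h2]]; simp
      have term : ∀ b, ν (Set.pi (insert a T : Finset (Site d)) t ∩ {ξ | ∀ x ∈ S \ insert a T, ξ x = η x} ∩ {ξ | ξ a = b}) =
          (∏ x ∈ T, bern p (t x)) * ((∏ x ∈ S \ insert a T, ENNReal.ofReal (if η x = true then p else 1 - p)) * (if b ∈ t a then bern p {b} else 0)) := by
        intro b
        by_cases hbt : b ∈ t a
        · rw [if_pos hbt, ← hb b]
          congr 1; ext ξ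
          simp only [Set.mem_inter_iff, Set.mem_pi, Finset.coe_insert, Set.mem_insert_iff, Set.mem_ofPred_eq, forall_eq_or_imp]
          constructor
          · rintro ⟨⟨⟨-, h2⟩, h3⟩, h4⟩; exact ⟨⟨h2, h3⟩, h4⟩
          · rintro ⟨⟨h2, h3⟩, h4⟩; exact ⟨⟨⟨h4 ▸ hbt, h2⟩, h3⟩, h4⟩
        · rw [if_neg hbt, mul_zero, mul_zero]
          convert measure_empty (μ := ν)
          ext ξ
          simp only [Set.mem_inter_iff, Set.mem_pi, Finset.coe_insert, Set.mem_insert_iff, Set.mem_ofPred_eq, forall_eq_or_imp, Set.mem_empty_iff_false, iff_false]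
          rintro ⟨⟨⟨h2, -⟩, -⟩, h4⟩; exact hbt (h4 ▸ h2)
      rw [split, term, term, Finset.prod_insert ha, hbs]
      ring
  have := e1 S subset_rfl (fun _ => true)
  simpa using this
end P1

/-! ### P2: clusters -/
section P2
variable {V : Type*}

/-- sites reachable from C through O (C itself included) -/
def Clus (R : V → V → Prop) (O C : Set V) : Set V :=
  {y | ∃ x ∈ C, Relation.ReflTransGen (fun a b => R a b ∧ b ∈ O) x y}

variable {R : V → V → Prop} {O O' C C' : Set V}

lemma subset_Clus : C ⊆ Clus R O C := fun x hx => ⟨x, hx, .refl⟩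

lemma Clus_step {x y : V} (hx : x ∈ Clus R O C) (h : R x y) (hy : y ∈ O) : y ∈ Clus R O C := by
  obtain ⟨a, ha, hax⟩ := hx
  exact ⟨a, ha, hax.tail ⟨h, hy⟩⟩

lemma Clus_min {S : Set V} (hC : C ⊆ S) (hS : ∀ x ∈ S, ∀ y, R x y → y ∈ O → y ∈ S) :
    Clus R O C ⊆ S := by
  rintro y ⟨x, hx, hxy⟩
  induction hxy with
  | refl => exact hC hx
  | tail _ h ih => exact hS _ ih _ h.1 h.2

lemma Clus_mono (hO : O ⊆ O') (hC : C ⊆ C') : Clus R O C ⊆ Clus R O' C' :=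
  Clus_min (hC.trans subset_Clus) fun _ hx _ h hy => Clus_step hx h (hO hy)

lemma Clus_sub : Clus R O C ⊆ C ∪ O :=
  Clus_min Set.subset_union_left fun _ _ _ _ hy => Or.inr hy

lemma Clus_idem : Clus R O (Clus R O C) = Clus R O C :=
  (Clus_min subset_rfl fun _ hx _ h hy => Clus_step hx h hy).antisymm subset_Clus

/-- intermediate start sets do not matter -/
lemma Clus_between (h1 : C ⊆ C') (h2 : C' ⊆ Clus R O C) : Clus R O C' = Clus R O C :=
  ((Clus_mono subset_rfl h2).trans Clus_idem.subset).antisymm (Clus_mono subset_rfl h1)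

/-- outer vertex boundary -/
def bdy (R : V → V → Prop) (C : Set V) : Set V := {y | y ∉ C ∧ ∃ x ∈ C, R x y}

lemma mem_or_bdy {x y : V} (hx : x ∈ C) (h : R x y) : y ∈ C ∨ y ∈ bdy R C := by
  by_cases hy : y ∈ C
  · exact Or.inl hy
  · exact Or.inr ⟨hy, x, hx, h⟩

/-- the cluster only depends on O off C -/
lemma Clus_congr_off (h : ∀ x, x ∉ C → (x ∈ O ↔ x ∈ O')) : Clus R O C = Clus R O' C := by
  apply Set.Subset.antisymm
  · refine Clus_min subset_Clus fun x hx y hxy hy => ?_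
    by_cases hc : y ∈ C
    · exact subset_Clus hc
    · exact Clus_step hx hxy ((h y hc).1 hy)
  · refine Clus_min subset_Clus fun x hx y hxy hy => ?_
    by_cases hc : y ∈ C
    · exact subset_Clus hc
    · exact Clus_step hx hxy ((h y hc).2 hy)

/-- exploration: the event Clus = D is determined on D and its boundary -/
lemma Clus_eq_of_agree (hC : Clus R O C = C')
    (h : ∀ x ∈ C' ∪ bdy R C', x ∉ C → (x ∈ O ↔ x ∈ O')) : Clus R O' C = C' := by
  have hCC : C ⊆ C' := hC ▸ subset_Clus
  apply Set.Subset.antisymm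
  · refine Clus_min hCC fun x hx y hxy hy => ?_
    by_contra hyn
    have hb : y ∈ bdy R C' := ⟨hyn, x, hx, hxy⟩
    have hyO := (h y (Or.inr hb) (fun hh => hyn (hCC hh))).2 hy
    exact hyn (hC ▸ Clus_step (hC ▸ hx) hxy hyO)
  · have : Clus R O C ⊆ Clus R O' C ∩ C' := by
      refine Clus_min (Set.subset_inter subset_Clus hCC) fun x hx y hxy hy => ?_
      have hy' : y ∈ C' := hC ▸ Clus_step (hC ▸ hx.2) hxy hy
      refine ⟨?_, hy'⟩
      by_cases hc : y ∈ C
      · exact subset_Clus hc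
      · exact Clus_step hx.1 hxy ((h y (Or.inl hy') hc).1 hy)
    rw [hC] at this
    exact fun x hx => (this hx).1

lemma bdy_Clus_notMem {y : V} (h : y ∈ bdy R (Clus R O C)) : y ∉ O := by
  obtain ⟨hn, x, hx, hxy⟩ := h
  exact fun hy => hn (Clus_step hx hxy hy)

/-- last-exit decomposition: y reached from C through O; B a further set -/
lemma Clus_last_exit (B : Set V) {y : V} (hy : y ∈ Clus R O C) :
    y ∈ Clus R (O \ (C ∪ B)) C ∨ ∃ x ∈ B ∩ O, y ∈ Clus R (O \ (C ∪ B)) {x} := by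
  suffices h : Clus R O C ⊆ {y | y ∈ Clus R (O \ (C ∪ B)) C ∨ ∃ x ∈ B ∩ O, y ∈ Clus R (O \ (C ∪ B)) {x}} from h hy
  refine Clus_min (fun x hx => Or.inl (subset_Clus hx)) ?_
  rintro x hx z hxz hz
  by_cases hc : z ∈ C
  · exact Or.inl (subset_Clus hc)
  by_cases hb : z ∈ B
  · exact Or.inr ⟨z, ⟨hb, hz⟩, subset_Clus rfl⟩
  have hz' : z ∈ O \ (C ∪ B) := ⟨hz, by simp [hc, hb]⟩
  rcases hx with hx | ⟨w, hw, hx⟩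
  · exact Or.inl (Clus_step hx hxz hz')
  · exact Or.inr ⟨w, hw, Clus_step hx hxz hz'⟩

lemma Clus_symm (hR : ∀ a b, R a b → R b a) {x y : V} (hx : x ∈ O) (h : y ∈ Clus R O {x}) :
    x ∈ Clus R O {y} := by
  obtain ⟨x', hx', hxy⟩ := h
  obtain rfl : x' = x := hx'
  have : x' ∈ Clus R O {y} ∧ y ∈ O := by
    induction hxy with
    | refl => exact ⟨subset_Clus rfl, hx⟩
    | @tail b c hb h ih =>
      refine ⟨?_, h.2⟩
      have hbc : b ∈ Clus R O {c} := Clus_step (subset_Clus rfl) (hR _ _ h.1) ih.2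
      have : {b} ⊆ Clus R O {c} := by simpa using hbc
      exact (Clus_mono subset_rfl this).trans Clus_idem.subset ih.1
  exact this.1

lemma Clus_trans {x y : V} {C : Set V} (h : x ∈ Clus R O C) (h' : y ∈ Clus R O {x}) : y ∈ Clus R O C := by
  have : {x} ⊆ Clus R O C := by simpa using h
  exact (Clus_mono subset_rfl this).trans Clus_idem.subset h'

lemma Clus_exists {C : Set V} {y : V} (h : y ∈ Clus R O C) : ∃ x ∈ C, y ∈ Clus R O {x} := by
  obtain ⟨x, hx, hxy⟩ := h
  exact ⟨x, hx, x, rfl, hxy⟩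

/-- mapping clusters by a relation-preserving map -/
lemma Clus_map {W : Type*} {R' : W → W → Prop} (f : V → W) (hf : ∀ a b, R a b → R' (f a) (f b))
    {O' C' : Set W} (hO : ∀ x ∈ O, f x ∈ O') (hC : ∀ x ∈ C, f x ∈ C') {y : V} (hy : y ∈ Clus R O C) :
    f y ∈ Clus R' O' C' := by
  have : Clus R O C ⊆ f ⁻¹' (Clus R' O' C') :=
    Clus_min (fun x hx => subset_Clus (hC x hx)) fun x hx z hxz hz => Clus_step hx (hf _ _ hxz) (hO z hz)
  exact this hy

/-- first exit : if y is reached but not inside S, some point outside S adjacent to one in S reached within S -/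
lemma Clus_exit (S : Set V) (hC : C ⊆ S) {y : V} (hy : y ∈ Clus R O C) (hyS : y ∉ S) :
    ∃ a b, a ∈ Clus R (O ∩ S) C ∧ a ∈ S ∧ R a b ∧ b ∈ O ∧ b ∉ S := by
  by_contra hcon
  push Not at hcon
  have : Clus R O C ⊆ Clus R (O ∩ S) C ∩ S := by
    refine Clus_min (Set.subset_inter subset_Clus hC) ?_
    rintro x ⟨hx, hxS⟩ z hxz hz
    have := hcon x z hx hxS hxz hz
    exact ⟨Clus_step hx hxz ⟨hz, this⟩, this⟩
  exact hyS (this hy).2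

end P2

section sites
variable {d : ℕ}
def adj (x y : Site d) : Prop := d1 x y = 1
/-- open sites -/
def op {V : Type*} (ω : V → Bool) : Set V := {x | ω x = true}

lemma mem_op {V : Type*} {ω : V → Bool} {x : V} : x ∈ op ω ↔ ω x = true := Iff.rfl

lemma d1_comm (x y : Site d) : d1 x y = d1 y x := by
  unfold d1; exact Finset.sum_congr rfl fun i _ => by omega
lemma adj_symm {x y : Site d} (h : adj x y) : adj y x := by
  unfold adj at *; rw [d1_comm]; exact h

lemma adj_update (x : Site d) (i : Fin d) (s : ℤ) (hs : s.natAbs = 1) :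
    adj x (Function.update x i (x i + s)) := by
  unfold adj d1
  rw [Finset.sum_eq_single i]
  · simp; omega
  · intro j _ hj; simp [hj]
  · simp

/-- structure of neighbours -/
lemma adj_exists {x y : Site d} (h : adj x y) : ∃ i, (y i - x i).natAbs = 1 ∧ ∀ j, j ≠ i → y j = x j := by
  unfold adj d1 at h
  have hne : ∃ i, (x i - y i).natAbs ≠ 0 := by
    by_contra hc
    push Not at hc
    simp [hc] at h
  obtain ⟨i, hi⟩ := hne
  rw [← Finset.add_sum_erase _ _ (Finset.mem_univ i)] at h
  have hz : ∑ x_1 ∈ Finset.univ.erase i, (x x_1 - y x_1).natAbs = 0 := by omega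
  rw [Finset.sum_eq_zero_iff] at hz
  refine ⟨i, by omega, fun j hj => ?_⟩
  have := hz j (by simp [hj])
  omega

lemma adj_iff {x y : Site d} : adj x y ↔ ∃ i, (y i - x i).natAbs = 1 ∧ ∀ j, j ≠ i → y j = x j := by
  refine ⟨adj_exists, ?_⟩
  rintro ⟨i, hi, hj⟩
  have : y = Function.update x i (x i + (y i - x i)) := by
    funext j
    by_cases h : j = i
    · subst h; simp
    · simp [h, hj j h]
  rw [this]; exact adj_update x i _ hi

lemma adj_coord {x y : Site d} (h : adj x y) (i : Fin d) : -1 ≤ y i - x i ∧ y i - x i ≤ 1 := by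
  obtain ⟨j, hj, hk⟩ := adj_exists h
  by_cases hij : i = j
  · subst hij; omega
  · rw [hk i hij]; simp

lemma mem_ball {c y : Site d} {r : ℤ} (hr : 0 ≤ r) : y ∈ ball c r ↔ ∀ i, -r ≤ y i - c i ∧ y i - c i ≤ r := by
  lift r to ℕ using hr
  unfold ball dinf
  simp only [Set.mem_ofPred_eq, Nat.cast_le, Finset.sup_le_iff, Finset.mem_univ, true_imp_iff]
  exact forall_congr' fun i => by omega

lemma dinf_le {x y : Site d} {r : ℕ} : dinf x y ≤ r ↔ ∀ i, -(r:ℤ) ≤ x i - y i ∧ x i - y i ≤ r := by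
  unfold dinf
  simp only [Finset.sup_le_iff, Finset.mem_univ, true_imp_iff]
  exact forall_congr' fun i => by omega

def box (lo hi : Site d) : Set (Site d) := {x | ∀ i, lo i ≤ x i ∧ x i ≤ hi i}

lemma box_finite (lo hi : Site d) : (box lo hi).Finite := by
  have : box lo hi = Set.Icc lo hi := by
    ext x; simp only [box, Set.mem_ofPred_eq, Set.mem_Icc, Pi.le_def, forall_and]
  rw [this]; exact Set.finite_Icc lo hi

lemma ball_eq_box {c : Site d} {r : ℤ} (hr : 0 ≤ r) :
    ball c r = box (fun i => c i - r) (fun i => c i + r) := by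
  ext x; rw [mem_ball hr]
  exact forall_congr' fun i => by dsimp only; omega

lemma ball_finite (c : Site d) (r : ℤ) : (ball c r).Finite := by
  by_cases hr : 0 ≤ r
  · rw [ball_eq_box hr]; exact box_finite _ _
  · convert Set.finite_empty
    ext x; unfold ball; simp; omega

lemma box_conn {lo hi : Site d} {x y : Site d} (hx : x ∈ box lo hi) (hy : y ∈ box lo hi) :
    y ∈ Clus adj (box lo hi) {x} := by
  induction hn : d1 x y using Nat.strong_induction_on generalizing x with
  | _ n ih =>
    by_cases hxy : x = y
    · subst hxy; exact subset_Clus rfl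
    obtain ⟨i, hi'⟩ : ∃ i, x i ≠ y i := by
      by_contra hc; push Not at hc; exact hxy (funext hc)
    obtain ⟨s, hs, hlt⟩ : ∃ s : ℤ, s.natAbs = 1 ∧ (x i + s - y i).natAbs < (x i - y i).natAbs := by
      rcases lt_or_gt_of_ne hi' with h | h
      · exact ⟨1, by omega, by omega⟩
      · exact ⟨-1, by omega, by omega⟩
    set x' := Function.update x i (x i + s) with hx'
    have hx'b : x' ∈ box lo hi := by
      intro j
      by_cases hj : j = i
      · subst hj
        have h1 := hx j
        have h2 := hy j
        simp only [hx', Function.update_self]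
        omega
      · simp only [hx', Function.update_of_ne hj]; exact hx j
    have hd : d1 x' y < d1 x y := by
      unfold d1
      apply Finset.sum_lt_sum
      · intro j _
        by_cases hj : j = i
        · subst hj; simp only [hx', Function.update_self]; omega
        · simp only [hx', Function.update_of_ne hj]; exact le_rfl
      · exact ⟨i, Finset.mem_univ _, by simp only [hx', Function.update_self]; exact hlt⟩
    exact Clus_trans (Clus_step (subset_Clus rfl) (adj_update x i s hs) hx'b) (ih _ (hn ▸ hd) hx'b rfl)

lemma ball_conn {c : Site d} {r : ℤ} {x y : Site d} (hx : x ∈ ball c r) (hy : y ∈ ball c r) :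
    y ∈ Clus adj (ball c r) {x} := by
  have hr : 0 ≤ r := by
    have : (dinf x c : ℤ) ≤ r := hx
    omega
  rw [ball_eq_box hr] at *
  exact box_conn hx hy

lemma self_mem_ball {c : Site d} {r : ℤ} (hr : 0 ≤ r) : c ∈ ball c r := by
  rw [mem_ball hr]; simpa using fun _ => hr

/-- events about clusters in finite regions -/
lemma Dep_Clus {V : Type*} {R : V → V → Prop} {D C : Set V} (Q : Set V → Prop) :
    Dep {ω : V → Bool | Q (Clus R (op ω ∩ D) C)} D := by
  intro ω ω' h hw
  have : op ω ∩ D = op ω' ∩ D := by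
    ext x; constructor
    · rintro ⟨h1, h2⟩; exact ⟨by rw [mem_op, ← h x h2]; exact h1, h2⟩
    · rintro ⟨h1, h2⟩; exact ⟨by rw [mem_op, h x h2]; exact h1, h2⟩
  simp only [Set.mem_ofPred_eq] at *
  rwa [← this]

/-- a version where only sites off C matter -/
lemma Dep_Clus_off {V : Type*} {R : V → V → Prop} {D C : Set V} (Q : Set V → Prop) :
    Dep {ω : V → Bool | Q (Clus R (op ω ∩ D) C)} (D \ C) := by
  intro ω ω' h hw
  have : Clus R (op ω ∩ D) C = Clus R (op ω' ∩ D) C := by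
    apply Clus_congr_off
    intro x hx
    constructor
    · rintro ⟨h1, h2⟩; exact ⟨by rw [mem_op, ← h x ⟨h2, hx⟩]; exact h1, h2⟩
    · rintro ⟨h1, h2⟩; exact ⟨by rw [mem_op, h x ⟨h2, hx⟩]; exact h1, h2⟩
  simp only [Set.mem_ofPred_eq] at *
  rwa [← this]

lemma Dep_Clus_eq {V : Type*} {R : V → V → Prop} {D C C' : Set V} :
    Dep {ω : V → Bool | Clus R (op ω ∩ D) C = C'} (((C' ∪ bdy R C') ∩ D) \ C) := by
  intro ω ω' h hw
  refine Clus_eq_of_agree hw fun x hx hxC => ?_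
  constructor
  · rintro ⟨h1, h2⟩; exact ⟨by rw [mem_op, ← h x ⟨⟨hx, h2⟩, hxC⟩]; exact h1, h2⟩
  · rintro ⟨h1, h2⟩; exact ⟨by rw [mem_op, h x ⟨⟨hx, h2⟩, hxC⟩]; exact h1, h2⟩

lemma Inc_Clus {V : Type*} {R : V → V → Prop} {D C : Set V} {Q : Set V → Prop}
    (hQ : ∀ S T, S ⊆ T → Q S → Q T) : Inc {ω : V → Bool | Q (Clus R (op ω ∩ D) C)} := by
  intro ω ω' h hw
  exact hQ _ _ (Clus_mono (fun x hx => ⟨h x hx.1, hx.2⟩) subset_rfl) hw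

end sites

/-! ### P3: finite-size criterion -/
section P3a
variable {d : ℕ}

/-- sites of the sphere of radius n reached from the ball of radius m -/
def Un (m n : ℕ) (ω : Config d) : Set (Site d) :=
  {y | y ∈ Clus adj (op ω ∩ ball 0 (n:ℤ)) (ball 0 (m:ℤ)) ∧ dinf y 0 = n}

lemma mem_ball_nat {c y : Site d} {n : ℕ} : y ∈ ball c (n:ℤ) ↔ dinf y c ≤ n := by
  unfold ball; simp

lemma ball_mono {c : Site d} {a b : ℤ} (h : a ≤ b) : ball c a ⊆ ball c b := fun x hx => le_trans hx h

/-- neighbours change dinf by at most one -/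
lemma dinf_adj {x y c : Site d} (h : adj x y) : dinf y c ≤ dinf x c + 1 := by
  rw [dinf_le]
  intro i
  have h1 := (dinf_le (x := x) (y := c) (r := dinf x c)).1 le_rfl i
  have h2 := adj_coord h i
  push_cast
  omega

/-- reaching outside implies hitting the sphere -/
lemma Un_of_reach {m n : ℕ} (hmn : m < n) {ω : Config d} {O : Set (Site d)} (hO : O ⊆ op ω) {y : Site d}
    (hy : y ∈ Clus adj O (ball 0 (m:ℤ))) (hyn : n ≤ dinf y 0) : (Un m n ω).Nonempty := by
  obtain ⟨a, b, ha, haS, hab, hb, hbS⟩ := Clus_exit (ball 0 ((n-1:ℕ):ℤ)) (ball_mono (by omega)) hy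
    (by rw [mem_ball_nat]; omega)
  rw [mem_ball_nat] at haS hbS
  have := dinf_adj (c := 0) hab
  refine ⟨b, ?_, by omega⟩
  refine Clus_step (Clus_mono ?_ subset_rfl ha) hab ⟨hO hb, by rw [mem_ball_nat]; omega⟩
  exact fun x hx => ⟨hO hx.1, ball_mono (by omega) hx.2⟩

lemma Un_anti {m n n' : ℕ} (hmn : m < n) (hnn : n ≤ n') {ω : Config d} (h : (Un m n' ω).Nonempty) :
    (Un m n ω).Nonempty := by
  obtain ⟨y, hy, hyn⟩ := h
  exact Un_of_reach hmn Set.inter_subset_left hy (by omega)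

lemma Un_mono {m m' n : ℕ} (hmm : m ≤ m') {ω : Config d} (h : (Un m n ω).Nonempty) :
    (Un m' n ω).Nonempty := by
  obtain ⟨y, hy, hyn⟩ := h
  exact ⟨y, Clus_mono subset_rfl (ball_mono (by omega)) hy, hyn⟩

/-- percolation from the ball of radius m -/
def Pm (d m : ℕ) : Set (Config d) := {ω | ∀ n, m < n → (Un m n ω).Nonempty}

lemma Pm_mono {m m' : ℕ} (h : m ≤ m') : Pm d m ⊆ Pm d m' := fun ω hω n hn =>
  Un_mono h (hω n (by omega))

lemma Perc_sub : Perc d ⊆ ⋃ m, Pm d m := by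
  rintro ω ⟨γ, hinj, hadj, hop⟩
  rw [Set.mem_iUnion]
  refine ⟨dinf (γ 0) 0, fun n hn => ?_⟩
  have hk : ∃ k, γ k ∉ ball 0 (n:ℤ) := by
    by_contra hc
    push Not at hc
    exact Set.infinite_range_of_injective hinj ((ball_finite 0 (n:ℤ)).subset (by rintro _ ⟨k, rfl⟩; exact hc k))
  obtain ⟨k, hk⟩ := hk
  have hr : ∀ j, γ j ∈ Clus adj (op ω) (ball 0 ((dinf (γ 0) 0 : ℕ):ℤ)) := by
    intro j
    induction j with
    | zero => exact subset_Clus (by rw [mem_ball_nat])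
    | succ j ih => exact Clus_step ih (hadj j) (hop _)
  refine Un_of_reach hn subset_rfl (hr k) ?_
  rw [mem_ball_nat] at hk; omega

lemma Un_dep (m n : ℕ) (Q : Set (Site d) → Prop) :
    Dep {ω : Config d | Q (Un m n ω)} (ball 0 (n:ℤ) \ ball 0 (m:ℤ)) :=
  Dep_Clus_off (fun S => Q {y | y ∈ S ∧ dinf y 0 = n})

abbrev sx (x : Site d) : MeasurableSpace (Config d) := MeasurableSpace.comap (fun ω => ω x) ⊤

lemma Dep.measurable_tail {E : Set (Config d)} {A t : Set (Site d)} (h : Dep E A) (hA : A.Finite)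
    (hAt : A ⊆ t) : MeasurableSet[⨆ x ∈ t, sx x] E := by
  have h' : Dep E (hA.toFinset : Set (Site d)) := by simpa using h
  rw [h'.eq_preimage]
  have hm : @Measurable _ _ (⨆ x ∈ t, sx x) _ (fun (ω : Config d) (i : hA.toFinset) => ω i) := by
    refine @measurable_pi_lambda _ _ _ (⨆ x ∈ t, sx x) _ _ fun i => ?_
    have hi : (i : Site d) ∈ t := hAt (hA.mem_toFinset.1 i.2)
    have h1 : @Measurable _ _ (sx (i : Site d)) _ (fun (ω : Config d) => ω i) := comap_measurable _
    exact h1.mono (le_iSup₂_of_le (i : Site d) hi le_rfl) le_rfl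
  exact hm (Set.toFinite _).measurableSet

lemma Pm_tail (m : ℕ) (t : Set (Site d)) (ht : (ball 0 (m:ℤ))ᶜ ⊆ t) : MeasurableSet[⨆ x ∈ t, sx x] (Pm d m) := by
  have : Pm d m = ⋂ n : ℕ, {ω | m < n → (Un m n ω).Nonempty} := by
    ext ω; simp [Pm]
  rw [this]
  refine MeasurableSet.iInter fun n => ?_
  refine (Un_dep m n (fun S => m < n → S.Nonempty)).measurable_tail ((ball_finite _ _).sdiff) ?_
  exact fun x hx => ht hx.2

lemma Perc_zero_one (p : ℝ) (h : mu (fun _ : Site d => p) (Perc d) ≠ 0) :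
    mu (fun _ : Site d => p) (⋃ m, Pm d m) = 1 := by
  have hz : mu (fun _ : Site d => p) (⋃ m, Pm d m) ≠ 0 := fun hc =>
    h (measure_mono_null Perc_sub hc)
  have hind : ProbabilityTheory.iIndep (sx (d := d)) (mu (fun _ : Site d => p)) :=
    ProbabilityTheory.iIndepFun_infinitePi (P := fun _ : Site d => bern p) (X := fun _ b => b) (fun i => measurable_id)
  have hle : ∀ x : Site d, sx x ≤ MeasurableSpace.pi := fun x => (measurable_pi_apply x).comap_le
  refine (ProbabilityTheory.measure_zero_or_one_of_measurableSet_limsup (s := sx (d := d)) (p := fun t => t.Finite)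
    (f := Filter.cofinite) (ns := fun s : Finset (Site d) => (s : Set (Site d))) hle hind ?_ ?_ ?_ ?_ ?_).resolve_left hz
  · intro t ht; exact ht.compl_mem_cofinite
  · intro s t
    classical
    exact ⟨s ∪ t, by simp, by simp⟩
  · intro a; exact a.finite_toSet
  · intro n; exact ⟨{n}, by simp⟩
  · rw [Filter.limsup_eq_iInf_iSup]
    rw [MeasurableSpace.measurableSet_iInf]
    intro t
    rw [MeasurableSpace.measurableSet_iInf]
    intro ht
    have hfin : tᶜ.Finite := ht
    -- find k with tᶜ ⊆ ball 0 k
    obtain ⟨k, hk⟩ : ∃ k : ℕ, tᶜ ⊆ ball 0 (k:ℤ) := by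
      obtain ⟨k, hk⟩ := (hfin.image (fun x => dinf x 0)).bddAbove
      exact ⟨k, fun x hx => by rw [mem_ball_nat]; exact hk ⟨x, hx, rfl⟩⟩
    have e : (⋃ m, Pm d m) = ⋃ m, Pm d (m + k) := by
      apply Set.Subset.antisymm
      · exact Set.iUnion_subset fun m => (Pm_mono (by omega)).trans (Set.subset_iUnion (fun m => Pm d (m+k)) m)
      · exact Set.iUnion_subset fun m => Set.subset_iUnion (fun m => Pm d m) (m+k)
    rw [e]
    refine MeasurableSet.iUnion fun m => Pm_tail _ _ ?_
    intro x hx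
    by_contra hxt
    exact hx (ball_mono (by omega) (hk hxt))

lemma exists_m (p : ℝ) (h : mu (fun _ : Site d => p) (Perc d) ≠ 0) {η : ℝ} (hη : 0 < η) :
    ∃ m0 : ℕ, ∀ m n, m0 ≤ m → m < n → 1 - η ≤ Pr (fun _ : Site d => p) {ω | (Un m n ω).Nonempty} := by
  have h1 := Perc_zero_one p h
  have hmono : Monotone (fun m => Pm d m) := fun a b hab => Pm_mono hab
  have ht := tendsto_measure_iUnion_atTop (μ := mu (fun _ : Site d => p)) hmono
  rw [h1] at ht
  have ht' : Filter.Tendsto (fun m => Pr (fun _ : Site d => p) (Pm d m)) Filter.atTop (nhds 1) := by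
    have := (ENNReal.tendsto_toReal (by simp : (1:ENNReal) ≠ ⊤)).comp ht
    rw [ENNReal.toReal_one] at this; exact this
  obtain ⟨m0, hm0⟩ := ((ht'.eventually (lt_mem_nhds (by linarith : 1 - η < 1))).exists)
  refine ⟨m0, fun m n hm hn => hm0.le.trans (Pr_mono _ fun ω hω => ?_)⟩
  exact Pm_mono hm hω n hn

end P3a

section P3b
variable {ι : Type*} [DecidableEq ι]

/-- explore a quantity, then use independence -/
lemma explore_eq {κ : Type*} (s : Finset κ) (r : ι → ℝ) {A0 : Set ι} (hA0 : A0.Finite)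
    (X : (ι → Bool) → κ) (A : κ → Set ι) (hX : ∀ k ∈ s, Dep {ω | X ω = k} (A k))
    (hA : ∀ k ∈ s, A k ⊆ A0) (hs : ∀ ω, X ω ∈ s) (G : κ → Prop) (F : κ → Set (ι → Bool)) (B : κ → Set ι)
    (hF : ∀ k ∈ s, G k → Dep (F k) (B k)) (hB : ∀ k ∈ s, G k → (B k).Finite)
    (hAB : ∀ k ∈ s, G k → Disjoint (A k) (B k)) [DecidablePred G] :
    Pr r {ω | G (X ω) ∧ ω ∈ F (X ω)} = ∑ k ∈ s with G k, Pr r {ω | X ω = k} * Pr r (F k) := by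
  rw [Pr_sum_fiber s r _ hA0 X (fun k hk => (hX k hk).mono (hA k hk)) hs, Finset.sum_filter]
  refine Finset.sum_congr rfl fun k hk => ?_
  split_ifs with hg
  · rw [← (hX k hk).indep (hF k hk hg) (hA0.subset (hA k hk)) (hB k hk hg) (hAB k hk hg)]
    congr 1; ext ω; simp only [Set.mem_inter_iff, Set.mem_ofPred_eq]
    constructor
    · rintro ⟨⟨h1, h2⟩, rfl⟩; exact ⟨rfl, h2⟩
    · rintro ⟨rfl, h2⟩; exact ⟨⟨hg, h2⟩, rfl⟩
  · convert Pr_empty r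
    ext ω; simp only [Set.mem_inter_iff, Set.mem_ofPred_eq, Set.mem_empty_iff_false, iff_false]
    rintro ⟨⟨h1, h2⟩, rfl⟩; exact hg h1

lemma explore_sum {κ : Type*} (s : Finset κ) (r : ι → ℝ) {A0 : Set ι} (hA0 : A0.Finite)
    (X : (ι → Bool) → κ) (A : κ → Set ι) (hX : ∀ k ∈ s, Dep {ω | X ω = k} (A k))
    (hA : ∀ k ∈ s, A k ⊆ A0) (hs : ∀ ω, X ω ∈ s) (G : κ → Prop) [DecidablePred G] :
    Pr r {ω | G (X ω)} = ∑ k ∈ s with G k, Pr r {ω | X ω = k} := by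
  have := explore_eq s r hA0 X A hX hA hs G (fun _ => Set.univ) (fun _ => ∅) (fun _ _ _ => Dep.univ) (by simp) (by simp)
  simpa using this

lemma explore_ge {κ : Type*} (s : Finset κ) (r : ι → ℝ) {A0 : Set ι} (hA0 : A0.Finite)
    (X : (ι → Bool) → κ) (A : κ → Set ι) (hX : ∀ k ∈ s, Dep {ω | X ω = k} (A k))
    (hA : ∀ k ∈ s, A k ⊆ A0) (hs : ∀ ω, X ω ∈ s) (G : κ → Prop) (F : κ → Set (ι → Bool)) (B : κ → Set ι)
    (hF : ∀ k ∈ s, G k → Dep (F k) (B k)) (hB : ∀ k ∈ s, G k → (B k).Finite)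
    (hAB : ∀ k ∈ s, G k → Disjoint (A k) (B k)) {c : ℝ} (hc : ∀ k ∈ s, G k → c ≤ Pr r (F k)) :
    Pr r {ω | G (X ω)} * c ≤ Pr r {ω | G (X ω) ∧ ω ∈ F (X ω)} := by
  classical
  rw [explore_eq s r hA0 X A hX hA hs G F B hF hB hAB, explore_sum s r hA0 X A hX hA hs G, Finset.sum_mul]
  refine Finset.sum_le_sum fun k hk => ?_
  rw [Finset.mem_filter] at hk
  exact mul_le_mul_of_nonneg_left (hc k hk.1 hk.2) (Pr_nonneg _ _)

lemma explore_le {κ : Type*} (s : Finset κ) (r : ι → ℝ) {A0 : Set ι} (hA0 : A0.Finite)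
    (X : (ι → Bool) → κ) (A : κ → Set ι) (hX : ∀ k ∈ s, Dep {ω | X ω = k} (A k))
    (hA : ∀ k ∈ s, A k ⊆ A0) (hs : ∀ ω, X ω ∈ s) (G : κ → Prop) (F : κ → Set (ι → Bool)) (B : κ → Set ι)
    (hF : ∀ k ∈ s, G k → Dep (F k) (B k)) (hB : ∀ k ∈ s, G k → (B k).Finite)
    (hAB : ∀ k ∈ s, G k → Disjoint (A k) (B k)) {c : ℝ} (hc : ∀ k ∈ s, G k → Pr r (F k) ≤ c) :
    Pr r {ω | G (X ω) ∧ ω ∈ F (X ω)} ≤ Pr r {ω | G (X ω)} * c := by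
  classical
  rw [explore_eq s r hA0 X A hX hA hs G F B hF hB hAB, explore_sum s r hA0 X A hX hA hs G, Finset.sum_mul]
  refine Finset.sum_le_sum fun k hk => ?_
  rw [Finset.mem_filter] at hk
  exact mul_le_mul_of_nonneg_left (hc k hk.1 hk.2) (Pr_nonneg _ _)

/-- finset of subsets of a finite set -/
noncomputable def subs {V : Type*} {A : Set V} (h : A.Finite) : Finset (Set V) := h.finite_subsets.toFinset
lemma mem_subs {V : Type*} {A : Set V} (h : A.Finite) {S : Set V} : S ∈ subs h ↔ S ⊆ A := by
  simp [subs]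

variable {d : ℕ}

/-- neighbours of S outside the ball -/
def nbo (n : ℕ) (S : Set (Site d)) : Set (Site d) := {x | x ∉ ball 0 (n:ℤ) ∧ ∃ y ∈ S, adj y x}

lemma nbo_card (n : ℕ) {S : Set (Site d)} (hS : S.Finite) : (nbo n S).Finite ∧ (nbo n S).ncard ≤ 2 * d * S.ncard := by
  classical
  let f : Site d × (Fin d × Bool) → Site d := fun q =>
    Function.update q.1 q.2.1 (q.1 q.2.1 + if q.2.2 then 1 else -1)
  let T : Finset (Site d) := (hS.toFinset ×ˢ Finset.univ).image f
  have hsub : nbo n S ⊆ T := by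
    rintro x ⟨-, y, hy, hyx⟩
    obtain ⟨i, hi, hj⟩ := adj_exists hyx
    simp only [T, Finset.coe_image, Set.mem_image]
    have hx : ∀ s : ℤ, x i = y i + s → Function.update y i (y i + s) = x := by
      intro s hs
      funext j
      by_cases h : j = i
      · subst h; simp [hs]
      · simp [h, hj j h]
    rcases (show x i = y i + 1 ∨ x i = y i + -1 by omega) with h | h
    · exact ⟨(y, (i, true)), by simpa using hy, by simpa [f] using hx 1 h⟩
    · exact ⟨(y, (i, false)), by simpa using hy, by simpa [f] using hx (-1) h⟩
  refine ⟨T.finite_toSet.subset hsub, (Set.ncard_le_ncard hsub T.finite_toSet).trans ?_⟩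
  rw [Set.ncard_coe_finset]
  refine Finset.card_image_le.trans ?_
  rw [Finset.card_product, ← Set.ncard_eq_toFinset_card S hS]
  simp; linarith

lemma Un_sub {m n : ℕ} (ω : Config d) : Un m n ω ⊆ ball 0 (n:ℤ) := fun y hy => by
  rw [mem_ball_nat]; exact hy.2.le

lemma Un_kill {m n : ℕ} (hmn : m < n) {ω : Config d} (h : ∀ x ∈ nbo n (Un m n ω), ω x = false) :
    ¬ (Un m (n+1) ω).Nonempty := by
  rintro ⟨y, hy, hyn⟩
  obtain ⟨a, b, ha, haS, hab, hb, hbS⟩ := Clus_exit (ball 0 (n:ℤ)) (ball_mono (by omega)) hy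
    (by rw [mem_ball_nat]; omega)
  have hd := dinf_adj (c := 0) hab
  have haS' := haS
  have hbS' := hbS
  rw [mem_ball_nat] at haS' hbS'
  have haU : a ∈ Un m n ω := by
    refine ⟨Clus_mono ?_ subset_rfl ha, by omega⟩
    exact fun x hx => ⟨hx.1.1, hx.2⟩
  have := h b ⟨hbS, a, haU, hab⟩
  have hb' : ω b = true := hb.1
  simp [this] at hb'

lemma few_step {p : ℝ} (hp0 : 0 ≤ p) (hp1 : p ≤ 1) {m n : ℕ} (hmn : m < n) (k : ℕ) :
    Pr (fun _ : Site d => p) {ω | (Un m n ω).Nonempty ∧ (Un m n ω).ncard ≤ k} * (1 - p)^(2*d*k) ≤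
      Pr (fun _ : Site d => p) {ω | (Un m n ω).Nonempty} - Pr (fun _ : Site d => p) {ω | (Un m (n+1) ω).Nonempty} := by
  have key := explore_ge (subs (ball_finite (0:Site d) (n:ℤ))) (fun _ : Site d => p) (ball_finite 0 (n:ℤ)) (Un m n)
    (fun _ => ball 0 (n:ℤ)) (fun S _ => (Un_dep m n (fun T => T = S)).mono Set.sdiff_subset)
    (fun _ _ => subset_rfl) (fun ω => (mem_subs _).2 (Un_sub ω)) (fun S => S.Nonempty ∧ S.ncard ≤ k)
    (fun S => {ω | ∀ x ∈ nbo n S, ω x = false}) (nbo n) (fun S _ _ => Dep.allFalse _)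
    (fun S hS _ => (nbo_card n ((ball_finite _ _).subset ((mem_subs _).1 hS))).1)
    (fun S _ _ => Set.disjoint_left.2 fun x hx hx' => hx'.1 hx) (c := (1-p)^(2*d*k)) ?_
  · refine key.trans ?_
    have hsub : {ω : Config d | (Un m (n+1) ω).Nonempty} ⊆ {ω | (Un m n ω).Nonempty} := fun ω h => Un_anti hmn (by omega) h
    rw [Pr_split _ {ω : Config d | (Un m n ω).Nonempty} ((Un_dep m (n+1) (fun S => S.Nonempty))) ((ball_finite _ _).sdiff)]
    rw [Set.inter_eq_right.2 hsub, add_sub_cancel_left]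
    apply Pr_mono
    rintro ω ⟨h1, h2⟩
    exact ⟨h1.1, Un_kill hmn h2⟩
  · intro S hS hk
    have hf := nbo_card n ((ball_finite _ _).subset ((mem_subs _).1 hS))
    have := Pr_none (fun _ : Site d => p) hf.1.toFinset
    simp only [Set.Finite.mem_toFinset] at this
    rw [this, Finset.prod_const, ← Set.ncard_eq_toFinset_card _ hf.1, cl_of_mem hp0 hp1]
    apply pow_le_pow_of_le_one (by linarith) (by linarith)
    exact hf.2.trans (Nat.mul_le_mul_left _ hk.2)

lemma few_small {p : ℝ} (hp0 : 0 ≤ p) (hp1 : p < 1) (m k : ℕ) {η : ℝ} (hη : 0 < η) :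
    ∃ n0, ∀ n ≥ n0, Pr (fun _ : Site d => p) {ω | (Un m n ω).Nonempty ∧ (Un m n ω).ncard ≤ k} ≤ η := by
  let a : ℕ → ℝ := fun n => Pr (fun _ : Site d => p) {ω | (Un m (n + (m+1)) ω).Nonempty}
  have ha : Antitone a := antitone_nat_of_succ_le fun n => Pr_mono _ fun ω h => Un_anti (by omega) (by omega) h
  have hb : BddBelow (Set.range a) := ⟨0, by rintro _ ⟨n, rfl⟩; exact Pr_nonneg _ _⟩
  have ht := tendsto_atTop_ciInf ha hb
  have ht2 := ht.sub (ht.comp (Filter.tendsto_add_atTop_nat 1))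
  rw [sub_self] at ht2
  have hpos : 0 < η * (1-p)^(2*d*k) := by
    have : 0 < 1 - p := by linarith
    positivity
  obtain ⟨n0, hn0⟩ := Filter.eventually_atTop.1 (ht2.eventually (gt_mem_nhds hpos))
  refine ⟨n0 + (m+1), fun n hn => ?_⟩
  obtain ⟨l, rfl⟩ : ∃ l, n = l + (m+1) := ⟨n - (m+1), by omega⟩
  have h1 := hn0 l (by omega)
  have h2 := few_step (d := d) hp0 hp1.le (show m < l + (m+1) by omega) k
  have h3 : 0 < (1-p)^(2*d*k) := by
    have : 0 < 1 - p := by linarith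
    positivity
  simp only [a, Function.comp] at h1
  have h4 : l + 1 + (m+1) = l + (m+1) + 1 := by omega
  rw [h4] at h1
  exact le_of_mul_le_mul_right (h2.trans h1.le) h3

end P3b

section P3c
variable {d : ℕ}

lemma unit_cases (u : ℤˣ) : (u : ℤ) = 1 ∨ (u : ℤ) = -1 := by
  rcases Int.units_eq_one_or u with h | h <;> simp [h]

/-- pieces of the sphere -/
def Tp (n : ℕ) (i : Fin d) (τ : Fin d → ℤˣ) : Set (Site d) :=
  {y | (τ i : ℤ) * y i = n ∧ ∀ j, 0 ≤ (τ j : ℤ) * y j ∧ (τ j : ℤ) * y j ≤ n}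

/-- signed permutation -/
def sperm (π : Equiv.Perm (Fin d)) (s : Fin d → ℤˣ) (x : Site d) : Site d := fun j => (s j : ℤ) * x (π j)

lemma sperm_inv (π : Equiv.Perm (Fin d)) (s : Fin d → ℤˣ) (x : Site d) :
    sperm π s (sperm π.symm (fun j => s (π.symm j)) x) = x := by
  funext j
  simp only [sperm, Equiv.symm_apply_apply, Equiv.apply_symm_apply]
  rcases unit_cases (s j) with h | h <;> simp [h]

lemma sperm_inv' (π : Equiv.Perm (Fin d)) (s : Fin d → ℤˣ) (x : Site d) :
    sperm π.symm (fun j => s (π.symm j)) (sperm π s x) = x := by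
  funext j
  simp only [sperm, Equiv.symm_apply_apply, Equiv.apply_symm_apply]
  rcases unit_cases (s (π.symm j)) with h | h <;> simp [h]

lemma sperm_adj (π : Equiv.Perm (Fin d)) (s : Fin d → ℤˣ) {x y : Site d} (h : adj x y) :
    adj (sperm π s x) (sperm π s y) := by
  obtain ⟨i, hi, hj⟩ := adj_iff.1 h
  refine adj_iff.2 ⟨π.symm i, ?_, fun j hji => ?_⟩
  · simp only [sperm, Equiv.apply_symm_apply]
    rcases unit_cases (s (π.symm i)) with h | h <;> simp only [h] <;> omega
  · simp only [sperm]
    rw [hj (π j)]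
    rintro rfl; simp at hji

lemma sperm_dinf (π : Equiv.Perm (Fin d)) (s : Fin d → ℤˣ) (x : Site d) : dinf (sperm π s x) 0 = dinf x 0 := by
  apply le_antisymm
  · rw [dinf_le]
    intro i
    have h1 := (dinf_le (x := x) (y := 0) (r := dinf x 0)).1 le_rfl (π i)
    simp only [Pi.zero_apply, sperm] at *
    rcases unit_cases (s i) with h | h <;> simp only [h] <;> omega
  · rw [dinf_le]
    intro i
    have h1 := (dinf_le (x := sperm π s x) (y := 0) (r := dinf (sperm π s x) 0)).1 le_rfl (π.symm i)
    simp only [Pi.zero_apply] at *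
    have h2 : sperm π s x (π.symm i) = (s (π.symm i) : ℤ) * x i := by simp [sperm]
    rw [h2] at h1
    rcases unit_cases (s (π.symm i)) with h | h <;> simp only [h] at h1 <;> omega

lemma piece_sym (p : ℝ) (m n k : ℕ) (i i' : Fin d) (τ τ' : Fin d → ℤˣ) :
    Pr (fun _ : Site d => p) {ω | (Un m n ω ∩ Tp n i τ).ncard < k} ≤
    Pr (fun _ : Site d => p) {ω | (Un m n ω ∩ Tp n i' τ').ncard < k} := by
  let π : Equiv.Perm (Fin d) := Equiv.swap i i'
  let s : Fin d → ℤˣ := fun j => τ j * τ' (π j)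
  let g := sperm π.symm (fun j => s (π.symm j))
  have hg : Function.Injective g := fun x y hxy => by
    rw [← sperm_inv π s x, ← sperm_inv π s y]; exact congrArg _ hxy
  have hh : Function.Injective (sperm π s) := fun x y hxy => by
    rw [← sperm_inv' π s x, ← sperm_inv' π s y]; exact congrArg _ hxy
  have := Pr_map (fun _ : Site d => p) g hg ((Un_dep m n (fun S => (S ∩ Tp n i τ).ncard < k))) ((ball_finite _ _).sdiff)
  rw [← this]
  apply Pr_mono
  intro ω hω
  have hω' : (Un m n (fun k => ω (g k)) ∩ Tp n i τ).ncard < k := hω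
  refine lt_of_le_of_lt ?_ hω'
  refine Set.ncard_le_ncard_of_injOn (sperm π s) ?_ hh.injOn ((ball_finite _ _).subset (Set.inter_subset_left.trans (Un_sub _)))
  rintro y ⟨⟨hy, hyn⟩, hyT⟩
  refine ⟨⟨?_, by rw [sperm_dinf]; exact hyn⟩, ?_⟩
  · refine Clus_map (sperm π s) (fun a b => sperm_adj π s) ?_ ?_ hy
    · rintro x ⟨hx, hxb⟩
      refine ⟨?_, ?_⟩
      · show ω (g (sperm π s x)) = true
        rw [show g (sperm π s x) = x from sperm_inv' π s x]; exact hx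
      · rw [mem_ball_nat, sperm_dinf]; exact mem_ball_nat.1 hxb
    · intro x hxb
      rw [mem_ball_nat, sperm_dinf]; exact mem_ball_nat.1 hxb
  · have hcalc : ∀ j, (τ j : ℤ) * sperm π s y j = (τ' (π j) : ℤ) * y (π j) := by
      intro j
      simp only [sperm, s, Units.val_mul]
      rcases unit_cases (τ j) with h | h <;> simp [h]
    refine ⟨?_, fun j => ?_⟩
    · rw [hcalc]; simp only [π, Equiv.swap_apply_left]; exact hyT.1
    · rw [hcalc]; exact hyT.2 _

lemma Harris_prod {κ ι : Type*} [DecidableEq ι] (s : Finset κ) {r : ι → ℝ} {A : Set ι} (hA : A.Finite)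
    (E : κ → Set (ι → Bool)) (h : ∀ k, Dep (E k) A) (hi : ∀ k, Inc (E k)ᶜ) {q : ℝ} (hq0 : 0 ≤ q)
    (hq : ∀ k, q ≤ Pr r (E k)) : q ^ s.card ≤ Pr r (⋂ k ∈ s, E k) := by
  classical
  induction s using Finset.induction_on with
  | empty => simp
  | insert a s ha ih =>
    rw [Finset.card_insert_of_notMem ha, pow_succ, Finset.set_biInter_insert, mul_comm]
    have hd : Dep (⋂ k ∈ s, E k) A := Dep.iInter fun k => Dep.iInter fun _ => h k
    have hinc : Inc (⋂ k ∈ s, E k)ᶜ := by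
      intro ω ω' hw hω
      simp only [Set.mem_compl_iff, Set.mem_iInter, not_forall] at *
      obtain ⟨k, hk, hn⟩ := hω
      exact ⟨k, hk, hi k ω ω' hw hn⟩
    refine le_trans ?_ (Harris_compl hA (h a) hd (hi a) hinc)
    exact mul_le_mul (hq a) ih (by positivity) (Pr_nonneg _ _)

lemma Un_inc {m n : ℕ} {ω ω' : Config d} (h : ∀ x, ω x = true → ω' x = true) : Un m n ω ⊆ Un m n ω' := by
  rintro y ⟨hy, hyn⟩
  refine ⟨Clus_mono ?_ subset_rfl hy, hyn⟩
  exact fun x hx => ⟨h x hx.1, hx.2⟩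

lemma sphere_cover (hd : 0 < d) {n : ℕ} {y : Site d} (hy : dinf y 0 = n) :
    ∃ q : Fin d × (Fin d → ℤˣ), y ∈ Tp n q.1 q.2 := by
  haveI : Nonempty (Fin d) := ⟨⟨0, hd⟩⟩
  obtain ⟨i, -, hi⟩ := Finset.exists_mem_eq_sup (Finset.univ : Finset (Fin d)) Finset.univ_nonempty
    (fun i => (y i - (0 : Site d) i).natAbs)
  have hi' : (y i).natAbs = n := by
    rw [← hy]; unfold dinf; rw [hi]; simp
  have hle := (dinf_le (x := y) (y := 0) (r := n)).1 hy.le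
  simp only [Pi.zero_apply] at hle
  refine ⟨(i, fun j => if 0 ≤ y j then 1 else -1), ?_, fun j => ?_⟩
  · dsimp only; split_ifs <;> simp <;> omega
  · have := hle j
    dsimp only; split_ifs <;> simp <;> omega

lemma piece_many (hd : 0 < d) {p : ℝ} (hp0 : 0 ≤ p) (hp1 : p < 1) (h : mu (fun _ : Site d => p) (Perc d) ≠ 0)
    {η : ℝ} (hη : 0 < η) : ∃ m0 : ℕ, ∀ m ≥ m0, ∀ k : ℕ, ∃ n0, ∀ n ≥ n0, ∀ (i : Fin d) (τ : Fin d → ℤˣ),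
      Pr (fun _ : Site d => p) {ω | (Un m n ω ∩ Tp n i τ).ncard < k} ≤ η := by
  classical
  set N := Fintype.card (Fin d × (Fin d → ℤˣ)) with hN
  have hN0 : N ≠ 0 := by
    haveI : Nonempty (Fin d) := ⟨⟨0, hd⟩⟩
    exact Fintype.card_ne_zero
  have hη1 : 0 < η^N/2 := by positivity
  obtain ⟨m0, hm0⟩ := exists_m p h hη1
  refine ⟨m0, fun m hm k => ?_⟩
  obtain ⟨n0, hn0⟩ := few_small (d := d) hp0 hp1 m (N*k) hη1
  refine ⟨n0 + m + 1, fun n hn i τ => ?_⟩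
  let E : Fin d × (Fin d → ℤˣ) → Set (Config d) := fun q => {ω | (Un m n ω ∩ Tp n q.1 q.2).ncard < k}
  have hq : ∀ q, Pr (fun _ : Site d => p) (E (i, τ)) ≤ Pr (fun _ : Site d => p) (E q) := fun q => piece_sym p m n k _ _ _ _
  have hE : ∀ q, Dep (E q) (ball 0 (n:ℤ) \ ball 0 (m:ℤ)) := fun q => Un_dep m n (fun S => (S ∩ Tp n q.1 q.2).ncard < k)
  have hprod := Harris_prod Finset.univ ((ball_finite _ _).sdiff) E hE (fun q => by
    intro ω ω' hw hω
    simp only [E, Set.mem_compl_iff, Set.mem_ofPred_eq, not_lt] at *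
    exact hω.trans (Set.ncard_le_ncard (Set.inter_subset_inter_left _ (Un_inc hw))
      ((ball_finite _ _).subset (Set.inter_subset_left.trans (Un_sub _))))) (Pr_nonneg _ _) hq
  have hsub : (⋂ q ∈ (Finset.univ : Finset (Fin d × (Fin d → ℤˣ))), E q) ⊆
      {ω | (Un m n ω).Nonempty}ᶜ ∪ {ω | (Un m n ω).Nonempty ∧ (Un m n ω).ncard ≤ N * k} := by
    intro ω hω
    simp only [Finset.mem_univ, Set.iInter_true, Set.mem_iInter] at hω
    by_cases hne : (Un m n ω).Nonempty
    · refine Or.inr ⟨hne, ?_⟩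
      have hcov : Un m n ω ⊆ ⋃ q ∈ (Finset.univ : Finset (Fin d × (Fin d → ℤˣ))), (Un m n ω ∩ Tp n q.1 q.2) := by
        intro y hy
        obtain ⟨q, hq⟩ := sphere_cover hd hy.2
        simp only [Finset.mem_univ, Set.iUnion_true, Set.mem_iUnion]
        exact ⟨q, hy, hq⟩
      have hfin : (⋃ q ∈ (Finset.univ : Finset (Fin d × (Fin d → ℤˣ))), (Un m n ω ∩ Tp n q.1 q.2)).Finite := by
        refine (ball_finite 0 (n:ℤ)).subset ?_
        simp only [Finset.mem_univ, Set.iUnion_true]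
        exact Set.iUnion_subset fun q => Set.inter_subset_left.trans (Un_sub _)
      refine (Set.ncard_le_ncard hcov hfin).trans ((Finset.set_ncard_biUnion_le _ _).trans ?_)
      refine (Finset.sum_le_card_nsmul _ _ k fun q _ => (hω q).le).trans ?_
      simp [hN]
    · exact Or.inl hne
  have h1 := hm0 m n hm (by omega)
  have h2 := hn0 n (by omega)
  have h3 := (Pr_mono (fun _ : Site d => p) hsub).trans (Pr_union_le _ _ _)
  rw [Pr_compl _ (Un_dep m n (fun S => S.Nonempty)) ((ball_finite _ _).sdiff)] at h3
  have h4 : Pr (fun _ : Site d => p) (E (i, τ)) ^ N ≤ η ^ N := by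
    have : (Finset.univ : Finset (Fin d × (Fin d → ℤˣ))).card = N := rfl
    rw [this] at hprod
    linarith
  exact (pow_le_pow_iff_left₀ (Pr_nonneg _ _) hη.le hN0).1 h4

end P3c

section P3d
variable {d : ℕ}

/-- the target zone of a step -/
def zone (m n : ℕ) (z : Site d) (i : Fin d) (τ : Fin d → ℤˣ) : Set (Site d) :=
  {x | ((n:ℤ) + 1 ≤ (τ i : ℤ) * (x i - z i) ∧ (τ i : ℤ) * (x i - z i) ≤ n + 2 * m + 1) ∧
    ∀ j, j ≠ i → 0 ≤ (τ j : ℤ) * (x j - z j) ∧ (τ j : ℤ) * (x j - z j) ≤ n}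

/-- the region explored in a step -/
def DD (m n : ℕ) (z : Site d) (i : Fin d) (τ : Fin d → ℤˣ) : Set (Site d) := ball z (n:ℤ) ∪ zone m n z i τ

/-- a seed centre of the zone -/
def IsSeed (m n : ℕ) (z : Site d) (i : Fin d) (τ : Fin d → ℤˣ) (z' : Site d) : Prop :=
  ball z' (m:ℤ) ⊆ zone m n z i τ

/-- the good event -/
def GE (m n : ℕ) (z : Site d) (i : Fin d) (τ : Fin d → ℤˣ) : Set (Config d) :=
  {ω | ∃ z', IsSeed m n z i τ z' ∧ ball z' (m:ℤ) ⊆ Clus adj (op ω ∩ DD m n z i τ) (ball z (m:ℤ))}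

lemma zone_finite (m n : ℕ) (z : Site d) (i : Fin d) (τ : Fin d → ℤˣ) : (zone m n z i τ).Finite := by
  refine (ball_finite z ((n + 2*m+1 : ℕ):ℤ)).subset fun x hx => ?_
  rw [mem_ball (by omega)]
  intro j
  push_cast
  by_cases hj : j = i
  · subst hj
    have := hx.1
    rcases unit_cases (τ j) with h | h <;> simp only [h] at this <;> omega
  · have := hx.2 j hj
    rcases unit_cases (τ j) with h | h <;> simp only [h] at this <;> omega

lemma DD_finite (m n : ℕ) (z : Site d) (i : Fin d) (τ : Fin d → ℤˣ) : (DD m n z i τ).Finite :=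
  (ball_finite _ _).union (zone_finite _ _ _ _ _)

lemma GE_dep (m n : ℕ) (z : Site d) (i : Fin d) (τ : Fin d → ℤˣ) : Dep (GE m n z i τ) (DD m n z i τ) :=
  Dep_Clus (fun S => ∃ z', IsSeed m n z i τ z' ∧ ball z' (m:ℤ) ⊆ S)

def sc (m n : ℕ) (i : Fin d) (τ : Fin d → ℤˣ) (y : Site d) : Site d := fun j =>
  if j = i then (τ i : ℤ) * (n + m + 1) else (τ j : ℤ) * max (m:ℤ) (min ((τ j : ℤ) * y j) ((n:ℤ) - m))

lemma sc_seed {m n : ℕ} (hmn : 2 * m ≤ n) (i : Fin d) (τ : Fin d → ℤˣ) (y : Site d) :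
    IsSeed m n 0 i τ (sc m n i τ y) := by
  intro x hx
  rw [mem_ball (by omega)] at hx
  refine ⟨?_, fun j hj => ?_⟩
  · have := hx i
    simp only [sc, if_true] at this
    simp only [Pi.zero_apply]
    rcases unit_cases (τ i) with h | h <;> simp only [h] at this ⊢ <;> omega
  · have := hx j
    simp only [sc, if_neg hj] at this
    simp only [Pi.zero_apply]
    rcases unit_cases (τ j) with h | h <;> simp only [h] at this ⊢ <;> omega

lemma sc_near {m n : ℕ} (hmn : 2 * m ≤ n) {i : Fin d} {τ : Fin d → ℤˣ} {y : Site d} (hy : y ∈ Tp n i τ) (j : Fin d)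
    (hj : j ≠ i) : -(m:ℤ) ≤ y j - sc m n i τ y j ∧ y j - sc m n i τ y j ≤ m := by
  have := hy.2 j
  simp only [sc, if_neg hj]
  rcases unit_cases (τ j) with h | h <;> simp only [h] at this ⊢ <;> omega

lemma sc_attach {m n : ℕ} (hmn : 2 * m ≤ n) {i : Fin d} {τ : Fin d → ℤˣ} {y : Site d} (hy : y ∈ Tp n i τ) :
    ∃ b, adj y b ∧ b ∈ ball (sc m n i τ y) (m:ℤ) := by
  refine ⟨Function.update y i (y i + τ i), adj_update y i _ (by rcases unit_cases (τ i) with h | h <;> simp [h]), ?_⟩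
  rw [mem_ball (by omega)]
  intro j
  by_cases hj : j = i
  · subst hj
    have := hy.1
    simp only [Function.update_self, sc, if_true]
    rcases unit_cases (τ j) with h | h <;> simp only [h] at this ⊢ <;> omega
  · rw [Function.update_of_ne hj]; exact sc_near hmn hy j hj

lemma sc_disj {m n : ℕ} (hmn : 2 * m ≤ n) {i : Fin d} {τ : Fin d → ℤˣ} {y y' : Site d} (hy : y ∈ Tp n i τ)
    (hy' : y' ∈ Tp n i τ) (hc : ∀ j, ((y j : ℤ) : ZMod (4*m+1)) = (y' j : ℤ)) (hne : y ≠ y') :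
    Disjoint (ball (sc m n i τ y) (m:ℤ)) (ball (sc m n i τ y') (m:ℤ)) := by
  rw [Set.disjoint_left]
  intro x hx hx'
  rw [mem_ball (by omega)] at hx hx'
  apply hne
  funext j
  by_cases hj : j = i
  · subst hj
    have h1 := hy.1
    have h2 := hy'.1
    rcases unit_cases (τ j) with h | h <;> simp only [h] at h1 h2 <;> omega
  · have h1 := hx j
    have h2 := hx' j
    have h3 := sc_near hmn hy j hj
    have h4 := sc_near hmn hy' j hj
    have h5 := (ZMod.intCast_eq_intCast_iff_dvd_sub _ _ _).1 (hc j)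
    obtain ⟨c, hc⟩ := h5
    push_cast at hc
    have hc0 : c = 0 := by
      by_contra hcn
      rcases lt_or_gt_of_ne hcn with h | h
      · nlinarith
      · nlinarith
    rw [hc0] at hc
    omega

lemma ball_ncard (c : Site d) (m : ℕ) : (ball c (m:ℤ)).ncard = (ball (0:Site d) (m:ℤ)).ncard := by
  have : ball c (m:ℤ) = (fun x => x + c) '' ball (0:Site d) (m:ℤ) := by
    ext x
    rw [mem_ball (by omega)]
    constructor
    · intro h
      refine ⟨x - c, ?_, by simp⟩
      rw [mem_ball (by omega)]; simpa using h
    · rintro ⟨y, hy, rfl⟩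
      rw [mem_ball (by omega)] at hy
      simpa using hy
  rw [this, Set.ncard_image_of_injective _ (add_left_injective c)]

lemma no_seed {p : ℝ} (hp0 : 0 ≤ p) (hp1 : p ≤ 1) (m : ℕ) (S : Finset (Site d)) (f : Site d → Site d)
    (hS : ∀ y ∈ S, ∀ y' ∈ S, y ≠ y' → Disjoint (ball (f y) (m:ℤ)) (ball (f y') (m:ℤ))) :
    Pr (fun _ : Site d => p) {ω | ∀ y ∈ S, ¬ ∀ x ∈ ball (f y) (m:ℤ), ω x = true} =
      (1 - p ^ (ball (0:Site d) (m:ℤ)).ncard) ^ S.card := by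
  classical
  induction S using Finset.induction_on with
  | empty => simp
  | insert a S ha ih =>
    have e : {ω : Config d | ∀ y ∈ insert a S, ¬ ∀ x ∈ ball (f y) (m:ℤ), ω x = true} =
      {ω | ∀ x ∈ ball (f a) (m:ℤ), ω x = true}ᶜ ∩ {ω | ∀ y ∈ S, ¬ ∀ x ∈ ball (f y) (m:ℤ), ω x = true} := by
      ext ω; simp
    have hd : Dep {ω : Config d | ∀ y ∈ S, ¬ ∀ x ∈ ball (f y) (m:ℤ), ω x = true} (⋃ y ∈ S, ball (f y) (m:ℤ)) := by
      intro ω ω' h hw y hy hc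
      refine hw y hy fun x hx => ?_
      rw [h x (Set.mem_iUnion₂.2 ⟨y, hy, hx⟩)]; exact hc x hx
    rw [e, (Dep.allTrue (ball (f a) (m:ℤ))).compl.indep hd (ball_finite _ _)
      (Set.Finite.biUnion S.finite_toSet fun y _ => ball_finite _ _) ?_, ih ?_, Finset.card_insert_of_notMem ha,
      Pr_compl _ (Dep.allTrue _) (ball_finite _ _)]
    · have := Pr_all (fun _ : Site d => p) (ball_finite (f a) (m:ℤ)).toFinset
      simp only [Set.Finite.mem_toFinset] at this
      rw [this, Finset.prod_const, ← Set.ncard_eq_toFinset_card _ (ball_finite (f a) (m:ℤ)), cl_of_mem hp0 hp1, ball_ncard]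
      ring
    · intro y hy y' hy' hne
      exact hS y (Finset.mem_insert_of_mem hy) y' (Finset.mem_insert_of_mem hy') hne
    · rw [Set.disjoint_iUnion₂_right]
      intro y hy
      exact hS a (Finset.mem_insert_self _ _) y (Finset.mem_insert_of_mem hy) (by rintro rfl; exact ha hy)

/-- choose many boundary points with disjoint seeds -/
lemma choose_sep {m n : ℕ} (hmn : 2 * m ≤ n) {i : Fin d} {τ : Fin d → ℤˣ} {S : Set (Site d)} (hS : S.Finite)
    (hST : S ⊆ Tp n i τ) (L : ℕ) (hL : (4*m+1)^d * L ≤ S.ncard) :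
    ∃ S' : Finset (Site d), (∀ y ∈ S', y ∈ S) ∧ L ≤ S'.card ∧
      ∀ y ∈ S', ∀ y' ∈ S', y ≠ y' → Disjoint (ball (sc m n i τ y) (m:ℤ)) (ball (sc m n i τ y') (m:ℤ)) := by
  classical
  haveI : NeZero (4*m+1) := ⟨by omega⟩
  obtain ⟨c, -, hc⟩ := Finset.exists_le_card_fiber_of_mul_le_card_of_maps_to (s := hS.toFinset)
    (t := (Finset.univ : Finset (Fin d → ZMod (4*m+1)))) (f := fun y j => ((y j : ℤ) : ZMod (4*m+1))) (n := L)
    (fun _ _ => Finset.mem_univ _) ⟨0, Finset.mem_univ _⟩ (by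
      rw [← Set.ncard_eq_toFinset_card S hS]
      simpa [Finset.card_univ, ZMod.card] using hL)
  refine ⟨_, fun y hy => ?_, hc, fun y hy y' hy' hne => ?_⟩
  · simp only [Finset.mem_filter, Set.Finite.mem_toFinset] at hy; exact hy.1
  · simp only [Finset.mem_filter, Set.Finite.mem_toFinset] at hy hy'
    exact sc_disj hmn (hST hy.1) (hST hy'.1) (fun j => congrFun (hy.2.trans hy'.2.symm) j) hne

lemma GE_zero {p : ℝ} (hd : 0 < d) (hp0 : 0 < p) (hp1 : p < 1) (h : mu (fun _ : Site d => p) (Perc d) ≠ 0)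
    {η : ℝ} (hη : 0 < η) : ∃ m n : ℕ, 1 ≤ m ∧ 2 * m ≤ n ∧ ∀ (i : Fin d) (τ : Fin d → ℤˣ),
      1 - η ≤ Pr (fun _ : Site d => p) (GE m n 0 i τ) := by
  classical
  obtain ⟨m0, hm0⟩ := piece_many hd hp0.le hp1 h (half_pos hη)
  set m := m0 + 1 with hm
  set q := p ^ (ball (0:Site d) (m:ℤ)).ncard with hq
  have hq0 : 0 < q := by positivity
  have hq1 : q ≤ 1 := pow_le_one₀ hp0.le hp1.le
  obtain ⟨L, hL⟩ := exists_pow_lt_of_lt_one (half_pos hη) (by linarith : 1 - q < 1)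
  obtain ⟨n0, hn0⟩ := hm0 m (by omega) ((4*m+1)^d * L)
  set n := n0 + 2 * m with hn
  have hmn : 2 * m ≤ n := by omega
  refine ⟨m, n, by omega, hmn, fun i τ => ?_⟩
  have hpm := hn0 n (by omega) i τ
  -- for every S choose separated points
  have hch : ∀ S : Set (Site d), ∃ S' : Finset (Site d), (S.Finite → (4*m+1)^d * L ≤ (S ∩ Tp n i τ).ncard →
    (∀ y ∈ S', y ∈ S ∩ Tp n i τ) ∧ L ≤ S'.card ∧
      ∀ y ∈ S', ∀ y' ∈ S', y ≠ y' → Disjoint (ball (sc m n i τ y) (m:ℤ)) (ball (sc m n i τ y') (m:ℤ))) := by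
    intro S
    by_cases hS : S.Finite ∧ (4*m+1)^d * L ≤ (S ∩ Tp n i τ).ncard
    · obtain ⟨S', h'⟩ := choose_sep hmn (hS.1.subset Set.inter_subset_left) Set.inter_subset_right L hS.2
      exact ⟨S', fun _ _ => h'⟩
    · exact ⟨∅, fun h1 h2 => absurd ⟨h1, h2⟩ hS⟩
  choose sep hsep using hch
  have key := explore_le (subs (ball_finite (0:Site d) (n:ℤ))) (fun _ : Site d => p) (ball_finite 0 (n:ℤ)) (Un m n)
    (fun _ => ball 0 (n:ℤ)) (fun S _ => (Un_dep m n (fun T => T = S)).mono Set.sdiff_subset)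
    (fun _ _ => subset_rfl) (fun ω => (mem_subs _).2 (Un_sub ω)) (fun S => (4*m+1)^d * L ≤ (S ∩ Tp n i τ).ncard)
    (fun S => {ω | ∀ y ∈ sep S, ¬ ∀ x ∈ ball (sc m n i τ y) (m:ℤ), ω x = true})
    (fun S => ⋃ y ∈ sep S, ball (sc m n i τ y) (m:ℤ)) (fun S _ _ => by
      intro ω ω' h hw y hy hc
      refine hw y hy fun x hx => ?_
      rw [h x (Set.mem_iUnion₂.2 ⟨y, hy, hx⟩)]; exact hc x hx)
    (fun S _ _ => Set.Finite.biUnion (sep S).finite_toSet fun y _ => ball_finite _ _)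
    (fun S _ _ => by
      rw [Set.disjoint_iUnion₂_right]
      intro y hy
      rw [Set.disjoint_left]
      intro x hx hx'
      have h1 := (sc_seed hmn i τ y hx').1
      rw [mem_ball (by omega)] at hx
      have h2 := hx i
      simp only [Pi.zero_apply] at h1 h2
      rcases unit_cases (τ i) with h | h <;> simp only [h] at h1 <;> omega) (c := η/2) ?_
  · have hsub : (GE m n 0 i τ)ᶜ ⊆ {ω | (Un m n ω ∩ Tp n i τ).ncard < (4*m+1)^d * L} ∪
      {ω | (4*m+1)^d * L ≤ (Un m n ω ∩ Tp n i τ).ncard ∧ ω ∈ {ω : Config d | ∀ y ∈ sep (Un m n ω), ¬ ∀ x ∈ ball (sc m n i τ y) (m:ℤ), ω x = true}} := by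
      intro ω hω
      by_cases hlt : (Un m n ω ∩ Tp n i τ).ncard < (4*m+1)^d * L
      · exact Or.inl hlt
      · refine Or.inr ⟨not_lt.1 hlt, fun y hy hop => hω ?_⟩
        have h1 := (hsep (Un m n ω) ((ball_finite _ _).subset (Un_sub ω)) (not_lt.1 hlt)).1 y hy
        refine ⟨sc m n i τ y, sc_seed hmn i τ y, ?_⟩
        obtain ⟨b, hyb, hb⟩ := sc_attach hmn h1.2
        have hy' : y ∈ Clus adj (op ω ∩ DD m n 0 i τ) (ball 0 (m:ℤ)) :=
          Clus_mono (Set.inter_subset_inter_right _ Set.subset_union_left) subset_rfl h1.1.1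
        have hbD : ball (sc m n i τ y) (m:ℤ) ⊆ op ω ∩ DD m n 0 i τ := fun x hx =>
          ⟨hop x hx, Or.inr (sc_seed hmn i τ y hx)⟩
        have hb' := Clus_step hy' hyb (hbD hb)
        intro x hx
        exact Clus_trans hb' (Clus_mono hbD subset_rfl (ball_conn hb hx))
    have h1 := (Pr_mono (fun _ : Site d => p) hsub).trans (Pr_union_le _ _ _)
    rw [Pr_compl _ (GE_dep m n 0 i τ) (DD_finite _ _ _ _ _)] at h1
    have h2 : Pr (fun _ : Site d => p) {ω | (4*m+1)^d * L ≤ (Un m n ω ∩ Tp n i τ).ncard ∧ ω ∈ {ω : Config d | ∀ y ∈ sep (Un m n ω), ¬ ∀ x ∈ ball (sc m n i τ y) (m:ℤ), ω x = true}} ≤ η/2 := by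
      refine le_trans ?_ (key.trans ?_)
      · exact Pr_mono _ fun ω hω => hω
      · have := Pr_le_one (fun _ : Site d => p) {ω | (4*m+1)^d * L ≤ (Un m n ω ∩ Tp n i τ).ncard}
        nlinarith
    linarith
  · intro S hS hg
    have h1 := hsep S ((ball_finite _ _).subset ((mem_subs _).1 hS)) hg
    rw [no_seed hp0.le hp1.le m (sep S) (sc m n i τ) h1.2.2]
    exact (pow_le_pow_of_le_one (by linarith) (by linarith) h1.2.1).trans hL.le

lemma zone_trans {m n : ℕ} {z : Site d} {i : Fin d} {τ : Fin d → ℤˣ} {x : Site d} :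
    x + z ∈ zone m n z i τ ↔ x ∈ zone m n 0 i τ := by
  simp [zone]

lemma ball_trans {z c x : Site d} {r : ℕ} : x + z ∈ ball (c + z) (r:ℤ) ↔ x ∈ ball c (r:ℤ) := by
  rw [mem_ball (Int.natCast_nonneg r), mem_ball (Int.natCast_nonneg r)]
  simp only [Pi.add_apply, add_sub_add_right_eq_sub]

lemma adj_add {x y : Site d} (z : Site d) (h : adj x y) : adj (x + z) (y + z) := by
  unfold adj d1 at *
  simpa only [Pi.add_apply, add_sub_add_right_eq_sub] using h

theorem GM_base {p : ℝ} (hd : 0 < d) (hp0 : 0 < p) (hp1 : p < 1) (h : mu (fun _ : Site d => p) (Perc d) ≠ 0)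
    {η : ℝ} (hη : 0 < η) : ∃ m n : ℕ, 1 ≤ m ∧ 2 * m ≤ n ∧ ∀ (z : Site d) (i : Fin d) (τ : Fin d → ℤˣ),
      1 - η ≤ Pr (fun _ : Site d => p) (GE m n z i τ) := by
  obtain ⟨m, n, hm, hn, hGE⟩ := GE_zero hd hp0 hp1 h hη
  refine ⟨m, n, hm, hn, fun z i τ => (hGE i τ).trans ?_⟩
  rw [← Pr_map (fun _ : Site d => p) (fun x => x + z) (add_left_injective z) (GE_dep m n 0 i τ) (DD_finite _ _ _ _ _)]
  apply Pr_mono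
  rintro ω ⟨z', hz', hsub⟩
  have hb : ∀ {c x : Site d} {r : ℕ}, x ∈ ball (c + z) (r:ℤ) ↔ x - z ∈ ball c (r:ℤ) := by
    intro c x r; rw [← ball_trans (z := z) (x := x - z), sub_add_cancel]
  refine ⟨z' + z, fun x hx => ?_, fun x hx => ?_⟩
  · have := hz' (hb.1 hx)
    rw [← zone_trans (z := z)] at this; simpa using this
  · have h1 := hsub (hb.1 hx)
    have := Clus_map (fun x => x + z) (fun a b => adj_add z) (O' := op ω ∩ DD m n z i τ) (C' := ball z (m:ℤ)) ?_ ?_ h1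
    · simpa using this
    · rintro y ⟨hy, hyD⟩
      refine ⟨hy, ?_⟩
      rcases hyD with hyD | hyD
      · left
        have := (ball_trans (z := z)).2 hyD
        simpa using this
      · right; exact zone_trans.2 hyD
    · intro y hy
      have := (ball_trans (z := z)).2 hy
      simpa using this
end P3d

section P4
variable {V : Type*} [DecidableEq V]

/-- marginals of a state -/
noncomputable def rS (R : V → V → Prop) (p0 δ : ℝ) (J : ℕ) (C E : Set V) (k : V → ℕ) : V → ℝ := by
  classical
  exact fun x => if x ∈ bdy R C ∧ x ∈ E then 1 - (1 - δ)^(J - k x) else 1 - (1 - p0) * (1 - δ)^J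

/-- the hitting event -/
def hit (R : V → V → Prop) (Λ Y C : Set V) : Set (V → Bool) := {ω | (Clus R (op ω ∩ Λ) C ∩ Y).Nonempty}

/-- value of a state -/
noncomputable def Sv (R : V → V → Prop) (p0 δ : ℝ) (J : ℕ) (Λ Y C E : Set V) (k : V → ℕ) : ℝ :=
  Pr (rS R p0 δ J C E k) (hit R Λ Y C)

/-- fresh randomness of a step -/
noncomputable def uS (R : V → V → Prop) (p0 δ : ℝ) (D C E : Set V) : V → ℝ := by
  classical
  exact fun x => if x ∈ D then (if x ∈ bdy R C ∧ x ∈ E then δ else p0) else 0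

/-- update of the use counter -/
noncomputable def kS (D : Set V) (k : V → ℕ) : V → ℕ := by
  classical
  exact fun x => if x ∈ D then k x + 1 else k x

lemma hit_dep {R : V → V → Prop} {Λ Y C : Set V} : Dep (hit R Λ Y C) (Λ \ C) :=
  Dep_Clus_off (fun S => (S ∩ Y).Nonempty)

lemma hit_inc {R : V → V → Prop} {Λ Y C : Set V} : Inc (hit R Λ Y C) :=
  Inc_Clus (Q := fun S => (S ∩ Y).Nonempty) (fun S T h hS => Set.Nonempty.mono (Set.inter_subset_inter_left _ h) hS)

lemma step_F {R : V → V → Prop} {p0 δ : ℝ} {J : ℕ} {Λ Y C E D C' : Set V} {k : V → ℕ} (hp0 : 0 ≤ p0) (hp1 : p0 ≤ 1)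
    (hd0 : 0 ≤ δ) (hd1 : δ ≤ 1) (hΛ : Λ.Finite) (hk : ∀ x ∈ D, k x + 1 ≤ J) (hC : C ⊆ C')
    (v : V → ℝ) (hv1 : ∀ x, x ∈ D → x ∈ bdy R C ∧ x ∈ E → v x = 1 - (1 - δ)^(J - k x - 1))
    (hv2 : ∀ x, x ∈ D → ¬ (x ∈ bdy R C ∧ x ∈ E) → v x = 1 - (1 - δ)^J)
    (hv3 : ∀ x, x ∉ D → v x = rS R p0 δ J C E k x) (rev : Set V)
    (hrev : rev = ((C' ∪ bdy R C') ∩ D) \ C) [DecidablePred (· ∈ rev)] :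
    Sv R p0 δ J Λ Y C' (E ∪ D) (kS D k) ≤
      Pr (Sum.elim (uS R p0 δ D C E) v) {ω | orc rev ω ∈ hit R Λ Y C'} := by
  have q0 : 0 ≤ 1 - δ := by linarith
  have q1 : 1 - δ ≤ 1 := by linarith
  have pw0 : ∀ j, 0 ≤ (1-δ)^j := fun j => pow_nonneg q0 j
  have pw1 : ∀ j, (1-δ)^j ≤ 1 := fun j => pow_le_one₀ q0 q1
  have pwm : ∀ i j, i ≤ j → (1-δ)^j ≤ (1-δ)^i := fun i j h => pow_le_pow_of_le_one q0 q1 h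
  have rc : ∀ x, cl (rS R p0 δ J C E k x) = rS R p0 δ J C E k x := by
    intro x
    unfold rS
    split_ifs
    · exact cl_of_mem (by linarith [pw1 (J - k x)]) (by linarith [pw0 (J - k x)])
    · exact cl_of_mem (by nlinarith [pw1 J, pw0 J]) (by nlinarith [pw1 J, pw0 J])
  have vc : ∀ x, cl (v x) = v x := by
    intro x
    by_cases hD : x ∈ D
    · by_cases hB : x ∈ bdy R C ∧ x ∈ E
      · rw [hv1 x hD hB]; exact cl_of_mem (by linarith [pw1 (J - k x - 1)]) (by linarith [pw0 (J - k x - 1)])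
      · rw [hv2 x hD hB]; exact cl_of_mem (by linarith [pw1 J]) (by linarith [pw0 J])
    · rw [hv3 x hD]; exact rc x
  have hfin : (Λ \ C').Finite := hΛ.sdiff
  rw [← Pr_orc rev (r := fun x => if x ∈ rev then v x else rS R p0 δ J C E k x) hfin hit_dep]
  · refine Pr_inc hfin hit_dep hit_inc fun x hx => ?_
    have hxC : x ∉ C := fun h => hx.2 (hC h)
    by_cases hb' : x ∈ bdy R C'
    · by_cases hD : x ∈ D
      · have hr : x ∈ rev := hrev ▸ ⟨⟨Or.inr hb', hD⟩, hxC⟩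
        have hs : x ∈ bdy R C' ∧ x ∈ E ∪ D := ⟨hb', Or.inr hD⟩
        simp only [hr, if_true]
        simp only [rS, kS, if_pos hs, if_pos hD]
        by_cases hB : x ∈ bdy R C ∧ x ∈ E
        · rw [hv1 x hD hB, Nat.sub_sub]
        · rw [hv2 x hD hB]
          have := pwm (J - (k x + 1)) J (by omega)
          linarith
      · have hr : x ∉ rev := fun h => by rw [hrev] at h; exact hD h.1.2
        simp only [hr, if_false]
        by_cases hE : x ∈ E
        · have hs : x ∈ bdy R C' ∧ x ∈ E ∪ D := ⟨hb', Or.inl hE⟩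
          simp only [rS, kS, if_pos hs, if_neg hD]
          split_ifs
          · exact le_rfl
          · have := pwm (J - k x) J (by omega)
            have := mul_le_mul_of_nonneg_right (show 1 - p0 ≤ 1 by linarith) (pw0 J)
            linarith
        · have hs : ¬ (x ∈ bdy R C' ∧ x ∈ E ∪ D) := by rintro ⟨-, h | h⟩; exacts [hE h, hD h]
          have hs' : ¬ (x ∈ bdy R C ∧ x ∈ E) := fun h => hE h.2
          simp only [rS, if_neg hs, if_neg hs', le_refl]
    · have hr : x ∉ rev := by
        rw [hrev]; rintro ⟨⟨h | h, -⟩, -⟩; exacts [hx.2 h, hb' h]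
      have hs : ¬ (x ∈ bdy R C' ∧ x ∈ E ∪ D) := fun h => hb' h.1
      have hs' : ¬ (x ∈ bdy R C ∧ x ∈ E) := by
        rintro ⟨⟨-, y, hy, hyx⟩, -⟩; exact hb' ⟨hx.2, y, hC hy, hyx⟩
      simp only [hr, if_false]
      simp only [rS, if_neg hs, if_neg hs', le_refl]
  · intro x hx
    by_cases hr : x ∈ rev
    · simp only [hr, if_true]; ring
    · simp only [hr, if_false, rc, vc]
      by_cases hD : x ∈ D
      · by_cases hB : x ∈ bdy R C ∧ x ∈ E
        · rw [hv1 x hD hB]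
          simp only [uS, rS, if_pos hD, if_pos hB, cl_of_mem hd0 hd1]
          have : J - k x = (J - k x - 1) + 1 := by have := hk x hD; omega
          rw [sub_sub_cancel, sub_sub_cancel]; nth_rewrite 1 [this]; rw [pow_succ]; ring
        · rw [hv2 x hD hB]
          simp only [uS, rS, if_pos hD, if_neg hB, cl_of_mem hp0 hp1]
          ring
      · rw [hv3 x hD]
        simp only [uS, if_neg hD, cl_of_mem le_rfl zero_le_one]; ring

/-- the exploration step -/
lemma step_sum {R : V → V → Prop} {p0 δ : ℝ} {J : ℕ} {Λ Y C E D : Set V} {k : V → ℕ} (hp0 : 0 ≤ p0) (hp1 : p0 ≤ 1)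
    (hd0 : 0 ≤ δ) (hd1 : δ ≤ 1) (hΛ : Λ.Finite) (hDΛ : D ⊆ Λ) (hCf : C.Finite) (hk : ∀ x ∈ D, k x + 1 ≤ J)
    (G : Set V → Prop) {a b : ℝ}
    (ha : ∀ C', C ⊆ C' → C' ⊆ C ∪ D → G C' → a ≤ Sv R p0 δ J Λ Y C' (E ∪ D) (kS D k))
    (hb : ∀ C', C ⊆ C' → C' ⊆ C ∪ D → b ≤ Sv R p0 δ J Λ Y C' (E ∪ D) (kS D k)) :
    Pr (uS R p0 δ D C E) {ω | G (Clus R (op ω ∩ D) C)} * a + (1 - Pr (uS R p0 δ D C E) {ω | G (Clus R (op ω ∩ D) C)}) * b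
      ≤ Sv R p0 δ J Λ Y C E k := by
  classical
  obtain ⟨v, hv1, hv2, hv3⟩ : ∃ v : V → ℝ, (∀ x, x ∈ D → x ∈ bdy R C ∧ x ∈ E → v x = 1 - (1 - δ)^(J - k x - 1)) ∧
    (∀ x, x ∈ D → ¬ (x ∈ bdy R C ∧ x ∈ E) → v x = 1 - (1 - δ)^J) ∧
    (∀ x, x ∉ D → v x = rS R p0 δ J C E k x) :=
    ⟨fun x => if x ∈ D then (if x ∈ bdy R C ∧ x ∈ E then 1 - (1 - δ)^(J - k x - 1) else 1 - (1 - δ)^J) else rS R p0 δ J C E k x,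
      fun x h1 h2 => by simp only [if_pos h1, if_pos h2], fun x h1 h2 => by simp only [if_pos h1, if_neg h2],
      fun x h1 => by simp only [if_neg h1]⟩
  have hDf : D.Finite := hΛ.subset hDΛ
  set u := uS R p0 δ D C E with hu
  have q0 : 0 ≤ 1 - δ := by linarith
  have q1 : 1 - δ ≤ 1 := by linarith
  have pw0 : ∀ j, 0 ≤ (1-δ)^j := fun j => pow_nonneg q0 j
  have pw1 : ∀ j, (1-δ)^j ≤ 1 := fun j => pow_le_one₀ q0 q1
  have rc : ∀ x, cl (rS R p0 δ J C E k x) = rS R p0 δ J C E k x := by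
    intro x
    unfold rS
    split_ifs
    · exact cl_of_mem (by linarith [pw1 (J - k x)]) (by linarith [pw0 (J - k x)])
    · exact cl_of_mem (by nlinarith [pw1 J, pw0 J]) (by nlinarith [pw1 J, pw0 J])
  have h1 : Sv R p0 δ J Λ Y C E k = Pr (Sum.elim u v) {ω | orc ∅ ω ∈ hit R Λ Y C} := by
    unfold Sv
    rw [← Pr_orc ∅ (r := rS R p0 δ J C E k) (hΛ.sdiff : (Λ \ C).Finite) hit_dep]
    intro x hx
    rw [rc]
    simp only [Set.mem_empty_iff_false, if_false]
    by_cases hD : x ∈ D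
    · by_cases hB : x ∈ bdy R C ∧ x ∈ E
      · rw [hv1 x hD hB]
        simp only [hu, uS, rS, if_pos hD, if_pos hB, cl_of_mem hd0 hd1]
        have : J - k x = (J - k x - 1) + 1 := by have := hk x hD; omega
        rw [cl_of_mem (by linarith [pw1 (J - k x - 1)]) (by linarith [pw0 (J - k x - 1)])]
        rw [sub_sub_cancel, sub_sub_cancel]; nth_rewrite 1 [this]; rw [pow_succ]; ring
      · rw [hv2 x hD hB]
        simp only [hu, uS, rS, if_pos hD, if_neg hB, cl_of_mem hp0 hp1]
        rw [cl_of_mem (by linarith [pw1 J]) (by linarith [pw0 J])]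
        ring
    · rw [hv3 x hD, rc]
      simp only [hu, uS, if_neg hD, cl_of_mem le_rfl zero_le_one]; ring
  set X : (V ⊕ V → Bool) → Set V := fun ω => Clus R (op (fun x => ω (Sum.inl x)) ∩ D) C with hX
  have hGX : ∀ G' : Set V → Prop, Pr (Sum.elim u v) {ω | G' (X ω)} = Pr u {ω | G' (Clus R (op ω ∩ D) C)} := by
    intro G'
    have := Pr_map (Sum.elim u v) (Sum.inl : V → V ⊕ V) Sum.inl_injective (Dep_Clus (R := R) (D := D) (C := C) G') hDf
    exact this
  have hfin0 : ((Sum.inl : V → V ⊕ V) '' D).Finite := hDf.image _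
  have key : ∀ (G' : Set V → Prop) (c : ℝ), (∀ C', C ⊆ C' → C' ⊆ C ∪ D → G' C' → c ≤ Sv R p0 δ J Λ Y C' (E ∪ D) (kS D k)) →
      Pr u {ω | G' (Clus R (op ω ∩ D) C)} * c ≤ Pr (Sum.elim u v) ({ω | orc ∅ ω ∈ hit R Λ Y C} ∩ {ω | G' (X ω)}) := by
    intro G' c hc
    have hXC : ∀ ω, C ⊆ X ω := fun ω => subset_Clus
    have hXs : ∀ ω, X ω ⊆ C ∪ D := fun ω => Clus_sub.trans (Set.union_subset_union_right _ Set.inter_subset_right)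
    have := explore_ge (subs (hCf.union hDf)) (Sum.elim u v) hfin0 X (fun C' => Sum.inl '' (((C' ∪ bdy R C') ∩ D) \ C))
      (fun C' _ => by
        intro ω ω' h hw
        exact Dep_Clus_eq (R := R) (D := D) (C := C) (C' := C') _ _ (fun x hx => h _ ⟨x, hx, rfl⟩) hw)
      (fun C' _ => Set.image_mono (fun x hx => hx.1.2)) (fun ω => (mem_subs _).2 (hXs ω))
      (fun C' => C ⊆ C' ∧ G' C') (fun C' => {ω | orc (((C' ∪ bdy R C') ∩ D) \ C) ω ∈ hit R Λ Y C'})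
      (fun C' => Sum.inl '' (Λ \ (((C' ∪ bdy R C') ∩ D) \ C)) ∪ Sum.inr '' Λ)
      (fun C' _ _ => by
        intro ω ω' h hw
        refine hit_dep (orc _ ω) (orc _ ω') (fun x hx => ?_) hw
        by_cases hr : x ∈ ((C' ∪ bdy R C') ∩ D) \ C
        · simp only [orc, if_pos hr, h (Sum.inr x) (Or.inr ⟨x, hx.1, rfl⟩)]
        · simp only [orc, if_neg hr, h (Sum.inr x) (Or.inr ⟨x, hx.1, rfl⟩), h (Sum.inl x) (Or.inl ⟨x, ⟨hx.1, hr⟩, rfl⟩)])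
      (fun C' _ _ => ((hΛ.sdiff).image _).union (hΛ.image _))
      (fun C' _ _ => by
        rw [Set.disjoint_left]
        rintro _ ⟨x, hx, rfl⟩ (⟨y, hy, he⟩ | ⟨y, hy, he⟩)
        · rw [Sum.inl_injective he] at hy; exact hy.2 hx
        · exact absurd he (by simp)) (c := c)
      (fun C' hs hg => (hc C' hg.1 ((mem_subs _).1 hs) hg.2).trans
        (step_F hp0 hp1 hd0 hd1 hΛ hk hg.1 v hv1 hv2 hv3 _ rfl))
    have e : Pr (Sum.elim u v) {ω | C ⊆ X ω ∧ G' (X ω)} = Pr u {ω | G' (Clus R (op ω ∩ D) C)} := by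
      rw [← hGX]; congr 1; ext ω; exact ⟨fun h => h.2, fun h => ⟨hXC ω, h⟩⟩
    rw [e] at this
    refine this.trans (Pr_mono _ ?_)
    rintro ω ⟨⟨_, hg⟩, hh⟩
    refine ⟨?_, hg⟩
    have hh' : orc (((X ω ∪ bdy R (X ω)) ∩ D) \ C) ω ∈ hit R Λ Y (X ω) := hh
    have h2 : orc ∅ ω ∈ hit R Λ Y (X ω) := by
      refine hit_inc _ _ ?_ hh'
      intro x
      simp only [orc, Set.mem_empty_iff_false, if_false, Bool.or_eq_true]
      rintro (h | h)
      · split_ifs at h; exact Or.inl h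
      · exact Or.inr h
    have h3 : Clus R (op (orc ∅ ω) ∩ Λ) (X ω) = Clus R (op (orc ∅ ω) ∩ Λ) C := by
      refine Clus_between (hXC ω) (Clus_mono ?_ subset_rfl)
      rintro x ⟨hx, hxD⟩
      refine ⟨?_, hDΛ hxD⟩
      have hx' : ω (Sum.inl x) = true := hx
      simp [op, orc, hx']
    show (Clus R (op (orc ∅ ω) ∩ Λ) C ∩ Y).Nonempty
    rw [← h3]; exact h2
  rw [h1]
  have hdX : Dep {ω | G (X ω)} ((Sum.inl : V → V ⊕ V) '' D) := by
    intro ω ω' h hw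
    exact Dep_Clus (R := R) (D := D) (C := C) G _ _ (fun x hx => h _ ⟨x, hx, rfl⟩) hw
  rw [Pr_split _ _ hdX hfin0]
  have k1 := key G a ha
  have k2 := key (fun S => ¬ G S) b (fun C' h1 h2 _ => hb C' h1 h2)
  have e2 : Pr u {ω | ¬ G (Clus R (op ω ∩ D) C)} = 1 - Pr u {ω | G (Clus R (op ω ∩ D) C)} :=
    Pr_compl u (Dep_Clus (R := R) (D := D) (C := C) G) hDf
  rw [e2] at k2
  exact add_le_add k1 k2

end P4

section P4b

lemma Dep_op {V : Type*} {T : Set V} (Q : Set V → Prop) : Dep {ω : V → Bool | Q (op ω ∩ T)} T := by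
  intro ω ω' h hw
  have : op ω ∩ T = op ω' ∩ T := by
    ext x; constructor
    · rintro ⟨h1, h2⟩; exact ⟨by rw [mem_op, ← h x h2]; exact h1, h2⟩
    · rintro ⟨h1, h2⟩; exact ⟨by rw [mem_op, h x h2]; exact h1, h2⟩
  simp only [Set.mem_ofPred_eq] at *
  rwa [← this]

/-- comparison of two sums -/
lemma two_sums {κ : Type*} (s : Finset κ) (w : κ → ℝ) (hw : ∀ k ∈ s, 0 ≤ w k) (hw1 : ∑ k ∈ s, w k ≤ 1) (c : κ → ℕ)
    {p0 δ ε : ℝ} (hp1 : p0 < 1) (hp0 : 0 ≤ p0) (hd0 : 0 ≤ δ) (hd1 : δ ≤ 1) (hε : 0 ≤ ε) (k0 : ℕ) (hk0 : (1-δ)^k0 ≤ ε/2)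
    (h : ∑ k ∈ s, w k * (1-p0)^(c k) ≤ ε/2 * (1-p0)^k0) : ∑ k ∈ s, w k * (1-δ)^(c k) ≤ ε := by
  have hq : 0 < (1-p0)^k0 := pow_pos (by linarith) _
  have h1 : ∀ k ∈ s, w k * (1-δ)^(c k) ≤ w k * (ε/2) + w k * (1-p0)^(c k) / (1-p0)^k0 := by
    intro k hk
    rw [mul_div_assoc, ← mul_add]
    refine mul_le_mul_of_nonneg_left ?_ (hw k hk)
    by_cases hc : k0 ≤ c k
    · have := pow_le_pow_of_le_one (by linarith : 0 ≤ 1 - δ) (by linarith) hc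
      have h2 : 0 ≤ (1-p0)^(c k) / (1-p0)^k0 := div_nonneg (pow_nonneg (by linarith) _) hq.le
      linarith
    · have := pow_le_pow_of_le_one (by linarith : 0 ≤ 1 - p0) (by linarith) (not_le.1 hc).le
      have h2 : 1 ≤ (1-p0)^(c k) / (1-p0)^k0 := by rw [le_div_iff₀ hq]; linarith
      have h3 : (1-δ)^(c k) ≤ 1 := pow_le_one₀ (by linarith) (by linarith)
      linarith
  refine (Finset.sum_le_sum h1).trans ?_
  rw [Finset.sum_add_distrib, ← Finset.sum_mul, ← Finset.sum_div]
  have h2 : (∑ k ∈ s, w k * (1-p0)^(c k)) / (1-p0)^k0 ≤ ε/2 := by rw [div_le_iff₀ hq]; exact h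
  have h3 : (∑ k ∈ s, w k) * (ε/2) ≤ 1 * (ε/2) := mul_le_mul_of_nonneg_right hw1 (by linarith)
  linarith

variable {d : ℕ}

lemma good_prob {p0 δ ε : ℝ} (hp0 : 0 ≤ p0) (hp1 : p0 < 1) (hd0 : 0 ≤ δ) (hd1 : δ ≤ 1) (hε : 0 ≤ ε) (k0 : ℕ)
    (hk0 : (1-δ)^k0 ≤ ε/2) {m n : ℕ} {z : Site d} {i : Fin d} {τ : Fin d → ℤˣ}
    (hGE : 1 - ε/2*(1-p0)^k0 ≤ Pr (fun _ : Site d => p0) (GE m n z i τ)) {C E : Set (Site d)}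
    (hzC : ball z (m:ℤ) ⊆ C) (hzone : Disjoint (zone m n z i τ) (E ∪ C)) :
    1 - ε ≤ Pr (uS adj p0 δ (DD m n z i τ) C E)
      {ω | ∃ z', IsSeed m n z i τ z' ∧ ball z' (m:ℤ) ⊆ Clus adj (op ω ∩ DD m n z i τ) C} := by
  classical
  set D := DD m n z i τ with hD
  have hDf : D.Finite := DD_finite _ _ _ _ _
  set B := bdy adj C ∩ E with hB
  set H : Set (Site d) → Prop := fun S => ∃ z', IsSeed m n z i τ z' ∧ ball z' (m:ℤ) ⊆ S with hH
  set T := D \ (C ∪ B) with hT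
  have hTf : T.Finite := hDf.sdiff
  set X : Config d → Prop × Set (Site d) := fun ω =>
    (H (Clus adj (op ω ∩ T) C), {x | x ∈ B ∩ D ∧ H (Clus adj (op ω ∩ T) {x})}) with hX
  have hXd : ∀ k, Dep {ω | X ω = k} T := fun k => by
    have := Dep_op (T := T) (fun O => ((H (Clus adj O C), {x | x ∈ B ∩ D ∧ H (Clus adj O {x})}) : Prop × Set (Site d)) = k)
    exact this
  have hBD : (B ∩ D).Finite := hDf.subset Set.inter_subset_right
  set s : Finset (Prop × Set (Site d)) := Finset.univ ×ˢ subs hBD with hs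
  have hXs : ∀ ω, X ω ∈ s := fun ω => by
    simp only [hs, Finset.mem_product, Finset.mem_univ, true_and, mem_subs]
    exact fun x hx => hx.1
  set F : Prop × Set (Site d) → Set (Config d) := fun k => {ω | ∀ x ∈ k.2, ω x = false} with hF
  have hmain : ∀ r : Site d → ℝ, Pr r {ω | ¬ (X ω).1 ∧ ω ∈ F (X ω)} =
      ∑ k ∈ s with ¬ k.1, Pr r {ω | X ω = k} * Pr r (F k) := fun r =>
    explore_eq s r hTf X (fun _ => T) (fun k _ => hXd k) (fun _ _ => subset_rfl) hXs (fun k => ¬ k.1) F (fun k => k.2)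
      (fun k _ _ => Dep.allFalse _) (fun k hk _ => hBD.subset ((mem_subs hBD).1 (Finset.mem_product.1 hk).2))
      (fun k hk _ => by
        rw [Set.disjoint_left]
        intro x hx hx'
        exact hx.2 (Or.inr ((mem_subs hBD).1 (Finset.mem_product.1 hk).2 hx').1))
  have hFP : ∀ (r : Site d → ℝ) (c : ℝ), 0 ≤ c → c ≤ 1 → (∀ x ∈ B ∩ D, r x = c) → ∀ k ∈ s, Pr r (F k) = (1 - c)^(k.2.ncard) := by
    intro r c hc0 hc1 hr k hk
    have hsub := (mem_subs hBD).1 (Finset.mem_product.1 hk).2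
    have hfin := hBD.subset hsub
    have := Pr_none r hfin.toFinset
    simp only [Set.Finite.mem_toFinset] at this
    rw [hF]
    show Pr r {ω | ∀ x ∈ k.2, ω x = false} = _
    rw [this, Finset.prod_congr rfl (g := fun _ => 1 - c), Finset.prod_const, ← Set.ncard_eq_toFinset_card _ hfin]
    intro x hx
    rw [hr x (hsub (hfin.mem_toFinset.1 hx)), cl_of_mem hc0 hc1]
  -- GE under p0
  have hzD : zone m n z i τ ⊆ D := Set.subset_union_right
  have hzT : zone m n z i τ ⊆ T := fun x hx => ⟨hzD hx, by
    rintro (h | h)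
    · exact Set.disjoint_left.1 hzone hx (Or.inr h)
    · exact Set.disjoint_left.1 hzone hx (Or.inl h.2)⟩
  have hsub : {ω | ¬ (X ω).1 ∧ ω ∈ F (X ω)} ⊆ (GE m n z i τ)ᶜ := by
    rintro ω ⟨h1, h2⟩ ⟨z', hz', hsub⟩
    have hbT : ball z' (m:ℤ) ⊆ op ω ∩ T := by
      intro x hx
      refine ⟨?_, hzT (hz' hx)⟩
      rcases Clus_sub (hsub hx) with h | h
      · exact absurd (Or.inr (hzC h)) (Set.disjoint_left.1 hzone (hz' hx))
      · exact h.1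
    have hOT : (op ω ∩ D) \ (C ∪ B) = op ω ∩ T := by ext x; simp [hT]; tauto
    have hz0 : z' ∈ ball z' (m:ℤ) := self_mem_ball (by omega)
    have := Clus_last_exit B (Clus_mono subset_rfl hzC (hsub hz0))
    rw [hOT] at this
    rcases this with h | ⟨x, ⟨hxB, hxO⟩, h⟩
    · apply h1
      exact ⟨z', hz', fun y hy => Clus_trans h (Clus_mono hbT subset_rfl (ball_conn hz0 hy))⟩
    · have hxN : x ∈ (X ω).2 := ⟨⟨hxB, hxO.2⟩, z', hz', fun y hy => Clus_trans h (Clus_mono hbT subset_rfl (ball_conn hz0 hy))⟩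
      have := h2 x hxN
      have h3 : ω x = true := hxO.1
      rw [h3] at this; exact absurd this (by simp)
  have hA := Pr_mono (fun _ : Site d => p0) hsub
  rw [Pr_compl _ (GE_dep m n z i τ) (DD_finite _ _ _ _ _), hmain] at hA
  -- under u
  set u := uS adj p0 δ D C E with hu
  have hsub2 : {ω | ∃ z', IsSeed m n z i τ z' ∧ ball z' (m:ℤ) ⊆ Clus adj (op ω ∩ D) C}ᶜ ⊆ {ω | ¬ (X ω).1 ∧ ω ∈ F (X ω)} := by
    intro ω hω
    have hTD : op ω ∩ T ⊆ op ω ∩ D := fun x hx => ⟨hx.1, hx.2.1⟩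
    refine ⟨?_, ?_⟩
    · rintro ⟨z', hz', h⟩
      exact hω ⟨z', hz', h.trans (Clus_mono hTD subset_rfl)⟩
    · rintro x ⟨⟨hxB, hxD⟩, z', hz', h⟩
      by_contra hx
      rw [Bool.not_eq_false] at hx
      obtain ⟨⟨_, y, hy, hyx⟩, _⟩ := hxB
      have hxc : x ∈ Clus adj (op ω ∩ D) C := Clus_step (subset_Clus hy) hyx ⟨hx, hxD⟩
      exact hω ⟨z', hz', fun w hw => Clus_trans hxc (Clus_mono hTD subset_rfl (h hw))⟩
  have hGd : Dep {ω | ∃ z', IsSeed m n z i τ z' ∧ ball z' (m:ℤ) ⊆ Clus adj (op ω ∩ D) C} D := Dep_Clus (R := adj) (D := D) (C := C) H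
  have hU := Pr_mono u hsub2
  rw [Pr_compl _ hGd hDf, hmain] at hU
  have hw : ∀ k, Pr u {ω | X ω = k} = Pr (fun _ : Site d => p0) {ω | X ω = k} := fun k =>
    Pr_congr hTf (hXd k) fun x hx => by
      have : ¬ (x ∈ bdy adj C ∧ x ∈ E) := fun h => hx.2 (Or.inr h)
      simp only [hu, uS, if_pos hx.1, if_neg this]
  have hA' : ∑ k ∈ s with ¬ k.1, Pr (fun _ : Site d => p0) {ω | X ω = k} * (1-p0)^(k.2.ncard) ≤ ε/2*(1-p0)^k0 := by
    refine le_trans (le_of_eq ?_) (hA.trans (by linarith))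
    refine Finset.sum_congr rfl fun k hk => ?_
    rw [hFP (fun _ => p0) p0 hp0 hp1.le (fun _ _ => rfl) k (Finset.mem_filter.1 hk).1]
  have hU' := two_sums _ _ (fun k _ => Pr_nonneg _ _) ?_ _ hp1 hp0 hd0 hd1 hε k0 hk0 hA'
  · have : ∑ k ∈ s with ¬ k.1, Pr u {ω | X ω = k} * Pr u (F k) =
      ∑ k ∈ s with ¬ k.1, Pr (fun _ : Site d => p0) {ω | X ω = k} * (1-δ)^(k.2.ncard) := by
      refine Finset.sum_congr rfl fun k hk => ?_
      rw [hw, hFP u δ hd0 hd1 ?_ k (Finset.mem_filter.1 hk).1]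
      rintro x ⟨hxB, hxD⟩
      have hxB' : x ∈ bdy adj C ∧ x ∈ E := hxB
      simp only [hu, uS, if_pos hxD, if_pos hxB']
    rw [this] at hU
    linarith
  · have := explore_sum s (fun _ : Site d => p0) hTf X (fun _ => T) (fun k _ => hXd k) (fun _ _ => subset_rfl) hXs (fun k => ¬ k.1)
    rw [← this]; exact Pr_le_one _ _

/-- Grimmett–Marstrand step constants -/
structure GMc (d : ℕ) (p0 δ ε : ℝ) (m n : ℕ) : Prop where
  p0n : 0 ≤ p0
  p01 : p0 < 1
  d0 : 0 < δ
  d1 : δ ≤ 1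
  e0 : 0 ≤ ε
  m1 : 1 ≤ m
  mn : 2 * m ≤ n
  ge : ∃ k0, (1-δ)^k0 ≤ ε/2 ∧ ∀ (z : Site d) i τ, 1 - ε/2*(1-p0)^k0 ≤ Pr (fun _ : Site d => p0) (GE m n z i τ)

lemma GMc_exists {p0 : ℝ} (hd : 0 < d) (hp0 : 0 < p0) (hp1 : p0 < 1) (h : mu (fun _ : Site d => p0) (Perc d) ≠ 0)
    {ε δ : ℝ} (hε : 0 < ε) (hd0 : 0 < δ) (hd1 : δ ≤ 1) : ∃ m n, GMc d p0 δ ε m n := by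
  obtain ⟨k0, hk0⟩ := exists_pow_lt_of_lt_one (half_pos hε) (by linarith : 1 - δ < 1)
  obtain ⟨m, n, hm, hn, hh⟩ := GM_base hd hp0 hp1 h (η := ε/2*(1-p0)^k0)
    (mul_pos (half_pos hε) (pow_pos (by linarith) _))
  exact ⟨m, n, hp0.le, hp1, hd0, hd1, hε.le, hm, hn, k0, hk0.le, hh⟩

/-- the step lemma -/
theorem step {p0 δ ε : ℝ} {m n : ℕ} (hc : GMc d p0 δ ε m n) {J : ℕ} {Λ Y C E : Set (Site d)} {k : Site d → ℕ}
    {z : Site d} {i : Fin d} {τ : Fin d → ℤˣ} (hΛ : Λ.Finite) (hDΛ : DD m n z i τ ⊆ Λ) (hCf : C.Finite)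
    (hk : ∀ x ∈ DD m n z i τ, k x + 1 ≤ J) (hzC : ball z (m:ℤ) ⊆ C) (hzone : Disjoint (zone m n z i τ) (E ∪ C))
    {a b : ℝ} (hba : b ≤ a)
    (ha : ∀ C' z', C ⊆ C' → C' ⊆ C ∪ DD m n z i τ → IsSeed m n z i τ z' → ball z' (m:ℤ) ⊆ C' →
      a ≤ Sv adj p0 δ J Λ Y C' (E ∪ DD m n z i τ) (kS (DD m n z i τ) k))
    (hb : ∀ C', C ⊆ C' → C' ⊆ C ∪ DD m n z i τ →
      b ≤ Sv adj p0 δ J Λ Y C' (E ∪ DD m n z i τ) (kS (DD m n z i τ) k)) :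
    a - ε * (a - b) ≤ Sv adj p0 δ J Λ Y C E k := by
  obtain ⟨k0, hk0, hg⟩ := hc.ge
  have h1 := step_sum (R := adj) hc.p0n hc.p01.le hc.d0.le hc.d1 hΛ hDΛ hCf hk
    (fun S => ∃ z', IsSeed m n z i τ z' ∧ ball z' (m:ℤ) ⊆ S) (fun C' h1 h2 ⟨z', h3, h4⟩ => ha C' z' h1 h2 h3 h4) hb
  have h2 := good_prob hc.p0n hc.p01 hc.d0.le hc.d1 hc.e0 k0 hk0 (hg z i τ) hzC hzone
  refine le_trans ?_ h1
  nlinarith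

end P4b

section P5

/-- nearest neighbours in the plane -/
def nb (u v : ℤ × ℤ) : Prop :=
  (u.1 = v.1 ∧ (v.2 = u.2 + 1 ∨ u.2 = v.2 + 1)) ∨ (u.2 = v.2 ∧ (v.1 = u.1 + 1 ∨ u.1 = v.1 + 1))

lemma nb_symm {u v : ℤ × ℤ} (h : nb u v) : nb v u := by unfold nb at *; omega

abbrev S9 := Fin 3 × Fin 3

def sub9 (I : ℤ × ℤ) (s : S9) : ℤ × ℤ := (3 * I.1 + (s.1.val : ℤ), 3 * I.2 + (s.2.val : ℤ))

lemma sub9_inj {I I' : ℤ × ℤ} {s s' : S9} (h : sub9 I s = sub9 I' s') : I = I' ∧ s = s' := by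
  simp only [sub9, Prod.mk.injEq] at h
  obtain ⟨⟨a, ha⟩, ⟨b, hb⟩⟩ := s
  obtain ⟨⟨a', ha'⟩, ⟨b', hb'⟩⟩ := s'
  obtain ⟨x, y⟩ := I
  obtain ⟨x', y'⟩ := I'
  simp only [Prod.mk.injEq, Fin.mk.injEq] at *
  omega

def Gd : ℕ → (ℤ × ℤ → Bool) → ℤ × ℤ → Prop
  | 0, ω, I => ω I = true
  | k+1, ω, I => ∀ s s' : S9, s ≠ s' → Gd k ω (sub9 I s) ∨ Gd k ω (sub9 I s')

def Mn : ℕ → (ℤ × ℤ → Bool) → ℤ × ℤ → Set (ℤ × ℤ)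
  | 0, ω, I => {x | x = I ∧ ω I = true}
  | k+1, ω, I => {x | Gd (k+1) ω I ∧ ∃ s, x ∈ Mn k ω (sub9 I s)}

def Blk : ℕ → ℤ × ℤ → Set (ℤ × ℤ)
  | 0, I => {I}
  | k+1, I => ⋃ s : S9, Blk k (sub9 I s)

lemma Blk_finite (k : ℕ) : ∀ I, (Blk k I).Finite := by
  induction k with
  | zero => intro I; exact Set.finite_singleton I
  | succ k ih => intro I; exact Set.finite_iUnion fun s => ih _

lemma Mn_good {k : ℕ} {ω : ℤ × ℤ → Bool} {I x : ℤ × ℤ} (h : x ∈ Mn k ω I) : Gd k ω I := by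
  cases k with
  | zero => exact h.2
  | succ k => exact h.1

lemma Mn_nonempty (k : ℕ) : ∀ {ω : ℤ × ℤ → Bool} {I}, Gd k ω I → (Mn k ω I).Nonempty := by
  induction k with
  | zero => intro ω I h; exact ⟨I, rfl, h⟩
  | succ k ih =>
    intro ω I h
    rcases h (0,0) (0,1) (by decide) with h' | h'
    · obtain ⟨x, hx⟩ := ih h'; exact ⟨x, h, _, hx⟩
    · obtain ⟨x, hx⟩ := ih h'; exact ⟨x, h, _, hx⟩

lemma Blk_mem {k : ℕ} : ∀ {I x : ℤ × ℤ}, x ∈ Blk k I ↔ ((3:ℤ)^k * I.1 ≤ x.1 ∧ x.1 < 3^k * (I.1 + 1) ∧ 3^k * I.2 ≤ x.2 ∧ x.2 < 3^k * (I.2+1)) := by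
  induction k with
  | zero =>
    intro I x
    simp only [Blk, Set.mem_singleton_iff, pow_zero, one_mul, Prod.ext_iff]; omega
  | succ k ih =>
    intro I x
    simp only [Blk, Set.mem_iUnion, ih, sub9, pow_succ]
    constructor
    · rintro ⟨⟨⟨a, ha⟩, ⟨b, hb⟩⟩, h1, h2, h3, h4⟩
      simp only at h1 h2 h3 h4
      have ha' : (a:ℤ) ≤ 2 := by omega
      have hb' : (b:ℤ) ≤ 2 := by omega
      have p : (0:ℤ) < 3^k := by positivity
      refine ⟨by nlinarith, by nlinarith, by nlinarith, by nlinarith⟩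
    · rintro ⟨h1, h2, h3, h4⟩
      have p : (0:ℤ) < 3^k := by positivity
      generalize (3:ℤ)^k = t at *
      have key : ∀ (X y : ℤ), t*3*X ≤ y → y < t*3*(X+1) → ∃ a : Fin 3, t * (3*X+(a.val:ℤ)) ≤ y ∧ y < t*(3*X+(a.val:ℤ)+1) := by
        intro X y hy1 hy2
        by_cases c1 : y < t*(3*X+1)
        · exact ⟨0, by simp; linarith, by simpa using c1⟩
        by_cases c2 : y < t*(3*X+2)
        · exact ⟨1, by simp; linarith, by simp; linarith⟩
        · exact ⟨2, by simp; linarith, by simp; linarith⟩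
      obtain ⟨a, ha1, ha2⟩ := key I.1 x.1 h1 h2
      obtain ⟨b, hb1, hb2⟩ := key I.2 x.2 h3 h4
      exact ⟨(a,b), ha1, ha2, hb1, hb2⟩

lemma Blk_sub {k : ℕ} {I : ℤ × ℤ} (s : S9) : Blk k (sub9 I s) ⊆ Blk (k+1) I := Set.subset_iUnion (fun s => Blk k (sub9 I s)) s

lemma Blk_disj {k : ℕ} : ∀ {I I' : ℤ × ℤ}, I ≠ I' → Disjoint (Blk k I) (Blk k I') := by
  induction k with
  | zero => intro I I' h; simpa [Blk] using h
  | succ k ih =>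
    intro I I' h
    simp only [Blk, Set.disjoint_iUnion_left, Set.disjoint_iUnion_right]
    intro s s'
    exact ih fun he => h (sub9_inj he).1

/-- lazy adjacency on the board with nine sites -/
def la (s s' : S9) : Prop := s = s' ∨ (s.1 = s'.1 ∧ (s.2.val + 1 = s'.2.val ∨ s'.2.val + 1 = s.2.val)) ∨
  (s.2 = s'.2 ∧ (s.1.val + 1 = s'.1.val ∨ s'.1.val + 1 = s.1.val))
instance (s s' : S9) : Decidable (la s s') := by unfold la; infer_instance

lemma la_symm {s s' : S9} (h : la s s') : la s' s := by
  unfold la at *; rcases h with h | ⟨h, h'⟩ | ⟨h, h'⟩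
  · exact Or.inl h.symm
  · exact Or.inr (Or.inl ⟨h.symm, h'.symm⟩)
  · exact Or.inr (Or.inr ⟨h.symm, h'.symm⟩)

lemma la_nb {I : ℤ × ℤ} {s s' : S9} (h : la s s') : sub9 I s = sub9 I s' ∨ nb (sub9 I s) (sub9 I s') := by
  obtain ⟨⟨a, ha⟩, ⟨b, hb⟩⟩ := s
  obtain ⟨⟨a', ha'⟩, ⟨b', hb'⟩⟩ := s'
  simp only [la, nb, sub9, Prod.mk.injEq, Fin.mk.injEq] at *
  omega

lemma board1 : ∀ t : S9, t ≠ (1,1) → ∀ s : S9, s ≠ t → ∃ m : S9, m ≠ t ∧ la s m ∧ la m (1,1) := by decide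
lemma board2 : ∀ s : S9, s ≠ (1,1) → ∃ m : S9, m ≠ (1,1) ∧ la s m ∧ ∃ m' : S9, m' ≠ (1,1) ∧ la m m' ∧
  ∃ m'' : S9, m'' ≠ (1,1) ∧ la m' m'' ∧ la m'' (0,0) := by decide

lemma board (Q : S9 → S9 → Prop) (g : S9 → Prop) (hg : ∀ s s', s ≠ s' → g s ∨ g s')
    (h1 : ∀ s s', g s → g s' → la s s' → Q s s') (h2 : ∀ s s' s'', g s' → Q s s' → Q s' s'' → Q s s'')
    (s s' : S9) (hs : g s) (hs' : g s') : Q s s' := by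
  classical
  obtain ⟨t, ht⟩ : ∃ t, ∀ s, s ≠ t → g s := by
    by_cases hh : ∃ t, ¬ g t
    · obtain ⟨t, ht⟩ := hh
      exact ⟨t, fun s hst => (hg s t hst).resolve_right ht⟩
    · push Not at hh; exact ⟨(0,0), fun s _ => hh s⟩
  by_cases htg : g t
  · -- all good
    have hall : ∀ s, g s := fun s => by
      by_cases h : s = t
      · exact h ▸ htg
      · exact ht s h
    obtain ⟨r, hr⟩ : ∃ r : S9, ∀ s, ∃ m, la s m ∧ la m r := ⟨(1,1), by decide⟩
    obtain ⟨m, hm1, hm2⟩ := hr s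
    obtain ⟨m', hm1', hm2'⟩ := hr s'
    refine h2 _ m _ (hall _) (h1 _ _ hs (hall _) hm1) ?_
    refine h2 _ r _ (hall _) (h1 _ _ (hall _) (hall _) hm2) ?_
    exact h2 _ m' _ (hall _) (h1 _ _ (hall _) (hall _) (la_symm hm2')) (h1 _ _ (hall _) hs' (la_symm hm1'))
  have hst : s ≠ t := fun h => htg (h ▸ hs)
  have hst' : s' ≠ t := fun h => htg (h ▸ hs')
  by_cases hc : t = (1,1)
  · subst hc
    have g0 : g (0,0) := ht _ (by decide)
    obtain ⟨m, a1, a2, m', a3, a4, m'', a5, a6, a7⟩ := board2 s hst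
    obtain ⟨n, b1, b2, n', b3, b4, n'', b5, b6, b7⟩ := board2 s' hst'
    have gm := ht _ a1; have gm' := ht _ a3; have gm'' := ht _ a5
    have gn := ht _ b1; have gn' := ht _ b3; have gn'' := ht _ b5
    refine h2 _ _ _ gm (h1 _ _ hs gm a2) (h2 _ _ _ gm' (h1 _ _ gm gm' a4) (h2 _ _ _ gm'' (h1 _ _ gm' gm'' a6)
      (h2 _ _ _ g0 (h1 _ _ gm'' g0 a7) (h2 _ _ _ gn'' (h1 _ _ g0 gn'' (la_symm b7)) (h2 _ _ _ gn' (h1 _ _ gn'' gn' (la_symm b6))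
      (h2 _ _ _ gn (h1 _ _ gn' gn (la_symm b4)) (h1 _ _ gn hs' (la_symm b2))))))))
  · obtain ⟨m, a1, a2, a3⟩ := board1 t hc s hst
    obtain ⟨m', b1, b2, b3⟩ := board1 t hc s' hst'
    have gc : g (1,1) := ht _ (Ne.symm hc)
    have gm := ht _ a1; have gm' := ht _ b1
    exact h2 _ _ _ gm (h1 _ _ hs gm a2) (h2 _ _ _ gc (h1 _ _ gm gc a3) (h2 _ _ _ gm' (h1 _ _ gc gm' (la_symm b3)) (h1 _ _ gm' hs' (la_symm b2))))

lemma face {I I' : ℤ × ℤ} (h : nb I I') (g g' : S9 → Prop) (hg : ∀ s s', s ≠ s' → g s ∨ g s') (hg' : ∀ s s', s ≠ s' → g' s ∨ g' s') :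
    ∃ s s', g s ∧ g' s' ∧ nb (sub9 I s) (sub9 I' s') := by
  have key : ∀ f f' : Fin 3 → S9, Function.Injective f → Function.Injective f' →
      (∀ j, nb (sub9 I (f j)) (sub9 I' (f' j))) → ∃ s s', g s ∧ g' s' ∧ nb (sub9 I s) (sub9 I' s') := by
    intro f f' hf hf' hn
    by_contra hcon
    push Not at hcon
    have h0 : ∀ j, ¬ (g (f j) ∧ g' (f' j)) := fun j hj => hcon _ _ hj.1 hj.2 (hn j)
    have e1 := hg (f 0) (f 1) (fun h => absurd (hf h) (by decide))
    have e2 := hg (f 0) (f 2) (fun h => absurd (hf h) (by decide))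
    have e3 := hg (f 1) (f 2) (fun h => absurd (hf h) (by decide))
    have e1' := hg' (f' 0) (f' 1) (fun h => absurd (hf' h) (by decide))
    have e2' := hg' (f' 0) (f' 2) (fun h => absurd (hf' h) (by decide))
    have e3' := hg' (f' 1) (f' 2) (fun h => absurd (hf' h) (by decide))
    have n0 := h0 0; have n1 := h0 1; have n2 := h0 2
    tauto
  obtain ⟨x, y⟩ := I
  obtain ⟨x', y'⟩ := I'
  rcases h with ⟨h1, h2 | h2⟩ | ⟨h1, h2 | h2⟩ <;> simp only at h1 h2 <;> subst h1 <;> subst h2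
  · exact key (fun j => (j, 2)) (fun j => (j, 0)) (fun a b h => by simpa using h) (fun a b h => by simpa using h)
      (fun j => by simp [nb, sub9]; omega)
  · exact key (fun j => (j, 0)) (fun j => (j, 2)) (fun a b h => by simpa using h) (fun a b h => by simpa using h)
      (fun j => by simp [nb, sub9]; omega)
  · exact key (fun j => (2, j)) (fun j => (0, j)) (fun a b h => by simpa using h) (fun a b h => by simpa using h)
      (fun j => by simp [nb, sub9]; omega)
  · exact key (fun j => (0, j)) (fun j => (2, j)) (fun a b h => by simpa using h) (fun a b h => by simpa using h)
      (fun j => by simp [nb, sub9]; omega)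

lemma Mn_conn (k : ℕ) : ∀ {ω : ℤ × ℤ → Bool} {I I' : ℤ × ℤ}, (I = I' ∨ nb I I') → ∀ x ∈ Mn k ω I, ∀ y ∈ Mn k ω I',
    y ∈ Clus nb (op ω ∩ (Blk k I ∪ Blk k I')) {x} := by
  induction k with
  | zero =>
    rintro ω I I' h x ⟨rfl, hx⟩ y ⟨rfl, hy⟩
    rcases h with rfl | h
    · exact subset_Clus rfl
    · exact Clus_step (subset_Clus rfl) h ⟨hy, Or.inr rfl⟩
  | succ k ih =>
    intro ω I I' h x hx y hy
    have inner : ∀ J : ℤ × ℤ, Gd (k+1) ω J → ∀ x ∈ Mn (k+1) ω J, ∀ y ∈ Mn (k+1) ω J, y ∈ Clus nb (op ω ∩ Blk (k+1) J) {x} := by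
      rintro J hJ x ⟨_, s, hs⟩ y ⟨_, s', hs'⟩
      refine board (fun s s' => ∀ x ∈ Mn k ω (sub9 J s), ∀ y ∈ Mn k ω (sub9 J s'), y ∈ Clus nb (op ω ∩ Blk (k+1) J) {x})
        (fun s => Gd k ω (sub9 J s)) hJ ?_ ?_ s s' (Mn_good hs) (Mn_good hs') x hs y hs'
      · intro s s' _ _ hl x hx y hy
        refine Clus_mono (Set.inter_subset_inter_right _ (Set.union_subset (Blk_sub s) (Blk_sub s'))) subset_rfl (ih (la_nb hl) x hx y hy)
      · intro s s' s'' hg h1 h2 x hx y hy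
        obtain ⟨w, hw⟩ := Mn_nonempty k hg
        exact Clus_trans (h1 x hx w hw) (h2 w hw y hy)
    rcases h with rfl | h
    · rw [Set.union_self]; exact inner I hx.1 x hx y hy
    · obtain ⟨s, s', hs, hs', hn⟩ := face h (fun s => Gd k ω (sub9 I s)) (fun s => Gd k ω (sub9 I' s)) hx.1 hy.1
      obtain ⟨w, hw⟩ := Mn_nonempty k hs
      obtain ⟨w', hw'⟩ := Mn_nonempty k hs'
      have a1 := Clus_mono (Set.inter_subset_inter_right (op ω) (Set.subset_union_left (t := Blk (k+1) I'))) subset_rfl (inner I hx.1 x hx w ⟨hx.1, s, hw⟩)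
      have a2 := Clus_mono (Set.inter_subset_inter_right (op ω) (Set.union_subset_union (Blk_sub s) (Blk_sub s'))) subset_rfl (ih (Or.inr hn) w hw w' hw')
      have a3 := Clus_mono (Set.inter_subset_inter_right (op ω) (Set.subset_union_right (s := Blk (k+1) I))) subset_rfl (inner I' hy.1 w' ⟨hy.1, s', hw'⟩ y hy)
      exact Clus_trans a1 (Clus_trans a2 a3)

lemma Gd_dep (k : ℕ) : ∀ I, Dep {ω | Gd k ω I} (Blk k I) := by
  induction k with
  | zero => intro I; exact Dep.coord I true
  | succ k ih =>
    intro I ω ω' h hw s s' hs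
    rcases hw s s' hs with h' | h'
    · exact Or.inl (ih _ _ _ (fun x hx => h x (Blk_sub s hx)) h')
    · exact Or.inr (ih _ _ _ (fun x hx => h x (Blk_sub s' hx)) h')

def prs : Finset (S9 × S9) := Finset.univ.filter (fun q => 3 * q.1.1.val + q.1.2.val < 3 * q.2.1.val + q.2.2.val)
lemma prs_ne {q : S9 × S9} (h : q ∈ prs) : q.1 ≠ q.2 := by
  intro he
  have := (Finset.mem_filter.1 h).2
  rw [he] at this; omega
lemma prs_card : prs.card = 36 := by decide
lemma prs_tot {s s' : S9} (h : s ≠ s') : (s, s') ∈ prs ∨ (s', s) ∈ prs := by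
  obtain ⟨⟨a, ha⟩, ⟨b, hb⟩⟩ := s
  obtain ⟨⟨a', ha'⟩, ⟨b', hb'⟩⟩ := s'
  simp only [prs, Finset.mem_filter, Finset.mem_univ, true_and, ne_eq, Prod.mk.injEq, Fin.mk.injEq] at *
  omega

lemma Gd_prob {ε : ℝ} (h0 : 0 ≤ ε) (h1 : ε ≤ 1/100) (k : ℕ) : ∀ I, Pr (fun _ : ℤ × ℤ => 1 - ε) {ω | ¬ Gd k ω I} ≤ (1/2)^k/100 := by
  induction k with
  | zero =>
    intro I
    have : {ω : ℤ × ℤ → Bool | ¬ Gd 0 ω I} = {ω | ω I = false} := by ext ω; simp [Gd]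
    rw [this, Pr_coord_false, cl_of_mem (by linarith) (by linarith)]; norm_num; linarith
  | succ k ih =>
    intro I
    have hsub : {ω : ℤ × ℤ → Bool | ¬ Gd (k+1) ω I} ⊆ ⋃ q ∈ prs,
        ({ω | ¬ Gd k ω (sub9 I q.1)} ∩ {ω | ¬ Gd k ω (sub9 I q.2)}) := by
      intro ω hω
      have hω' : ¬ ∀ s s' : S9, s ≠ s' → Gd k ω (sub9 I s) ∨ Gd k ω (sub9 I s') := hω
      push Not at hω'
      obtain ⟨s, s', hne, h1, h2⟩ := hω'
      simp only [Set.mem_iUnion]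
      rcases prs_tot hne with h | h
      · exact ⟨(s, s'), h, h1, h2⟩
      · exact ⟨(s', s), h, h2, h1⟩
    refine (Pr_mono _ hsub).trans ((Pr_biUnion_le _ _ _).trans ?_)
    have hb : ∀ q ∈ prs,
        Pr (fun _ : ℤ × ℤ => 1 - ε) ({ω | ¬ Gd k ω (sub9 I q.1)} ∩ {ω | ¬ Gd k ω (sub9 I q.2)}) ≤ ((1/2)^k/100) * ((1/2)^k/100) := by
      intro q hq
      have hne : q.1 ≠ q.2 := prs_ne hq
      have e := (Gd_dep k (sub9 I q.1)).compl.indep (r := fun _ => 1-ε) (Gd_dep k (sub9 I q.2)).compl (Blk_finite _ _) (Blk_finite _ _)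
        (Blk_disj fun h => hne (sub9_inj h).2)
      refine (le_of_eq e).trans (mul_le_mul (ih _) (ih _) (Pr_nonneg _ _) (by positivity))
    refine (Finset.sum_le_card_nsmul _ _ _ hb).trans ?_
    rw [nsmul_eq_mul]
    have p1 : (0:ℝ) < (1/2)^k := by positivity
    have p2 : ((1:ℝ)/2)^k ≤ 1 := pow_le_one₀ (by norm_num) (by norm_num)
    have hc' : (prs.card : ℝ) ≤ 36 := by rw [prs_card]; norm_num
    refine (mul_le_mul_of_nonneg_right hc' (by positivity)).trans ?_
    rw [pow_succ]
    nlinarith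

lemma Mn_prob {ε : ℝ} (h0 : 0 ≤ ε) (h1 : ε ≤ 1/100) (k : ℕ) : ∀ I, ∀ x ∈ Blk k I,
    Pr (fun _ : ℤ × ℤ => 1 - ε) {ω | x ∉ Mn k ω I} ≤ (2 - (1/2)^k)/100 := by
  induction k with
  | zero =>
    intro I x hx
    have := Gd_prob h0 h1 0 I
    refine (Pr_mono _ ?_).trans (this.trans (by norm_num))
    intro ω hω hg
    exact hω ⟨hx, hg⟩
  | succ k ih =>
    intro I x hx
    obtain ⟨s, hs⟩ := Set.mem_iUnion.1 hx
    have hsub : {ω : ℤ × ℤ → Bool | x ∉ Mn (k+1) ω I} ⊆ {ω | ¬ Gd (k+1) ω I} ∪ {ω | x ∉ Mn k ω (sub9 I s)} := by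
      intro ω hω
      by_cases hg : Gd (k+1) ω I
      · right; intro hx; exact hω ⟨hg, s, hx⟩
      · exact Or.inl hg
    refine (Pr_mono _ hsub).trans ((Pr_union_le _ _ _).trans ?_)
    have a1 := ih _ x hs
    have a2 := Gd_prob h0 h1 (k+1) I
    rw [pow_succ] at *
    linarith

/-- value of the planar comparison process -/
noncomputable def Vp (ε : ℝ) (Gr : Set (ℤ × ℤ)) (u : ℤ × ℤ) (A B : Set (ℤ × ℤ)) : ℝ :=
  Pr (fun _ : ℤ × ℤ => 1 - ε) {ω | u ∈ Clus nb (op ω ∩ (Gr \ B)) A}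

theorem planar {ε : ℝ} (h0 : 0 ≤ ε) (h1 : ε ≤ 1/100) (k : ℕ) {u : ℤ × ℤ} (hu : u ∈ Blk k 0) :
    1/2 ≤ Vp ε (Blk k 0) u {0} ∅ := by
  have h00 : (0 : ℤ × ℤ) ∈ Blk k 0 := by rw [Blk_mem]; simp
  have hsub : {ω | u ∈ Clus nb (op ω ∩ (Blk k 0 \ ∅)) {0}}ᶜ ⊆ {ω | (0 : ℤ × ℤ) ∉ Mn k ω 0} ∪ {ω | u ∉ Mn k ω 0} := by
    intro ω hω
    by_contra hcon
    have hcon' : ¬ ((0 : ℤ × ℤ) ∉ Mn k ω 0 ∨ u ∉ Mn k ω 0) := hcon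
    push Not at hcon'
    apply hω
    have := Mn_conn k (Or.inl rfl) _ hcon'.1 _ hcon'.2
    rw [Set.union_self] at this
    simpa using this
  have h2 := (Pr_mono (fun _ : ℤ × ℤ => 1 - ε) hsub).trans (Pr_union_le _ _ _)
  have hd : Dep {ω | u ∈ Clus nb (op ω ∩ (Blk k 0 \ ∅)) {0}} (Blk k 0 \ ∅) := Dep_Clus (fun S => u ∈ S)
  rw [Pr_compl _ hd ((Blk_finite _ _).sdiff)] at h2
  have a1 := Mn_prob h0 h1 k 0 0 h00
  have a2 := Mn_prob h0 h1 k 0 u hu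
  have p1 : (0:ℝ) < (1/2)^k := by positivity
  unfold Vp
  linarith

lemma Vp_rec {ε : ℝ} (h0 : 0 ≤ ε) (h1 : ε ≤ 1) {Gr : Set (ℤ × ℤ)} (hG : Gr.Finite) (u : ℤ × ℤ) {A B : Set (ℤ × ℤ)}
    {w v : ℤ × ℤ} (hw : w ∈ Gr) (hwA : w ∉ A) (hwB : w ∉ B) (hv : v ∈ A) (hvw : nb v w) :
    Vp ε Gr u A B = Vp ε Gr u (insert w A) B - ε * (Vp ε Gr u (insert w A) B - Vp ε Gr u A (insert w B)) := by
  have hd : Dep {ω | u ∈ Clus nb (op ω ∩ (Gr \ B)) A} (Gr \ B) := Dep_Clus (fun S => u ∈ S)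
  have e : Vp ε Gr u A B = _ := Pr_cond (fun _ : ℤ × ℤ => 1 - ε) hd hG.sdiff w
  rw [cl_of_mem (by linarith) (by linarith)] at e
  have e1 : cnd {ω | u ∈ Clus nb (op ω ∩ (Gr \ B)) A} w true = {ω | u ∈ Clus nb (op ω ∩ (Gr \ B)) (insert w A)} := by
    ext ω
    simp only [cnd, Set.mem_ofPred_eq]
    have h1 : w ∈ Clus nb (op (Function.update ω w true) ∩ (Gr \ B)) A :=
      Clus_step (subset_Clus hv) hvw ⟨by simp [op], hw, hwB⟩
    have h2 : Clus nb (op (Function.update ω w true) ∩ (Gr \ B)) (insert w A) = Clus nb (op (Function.update ω w true) ∩ (Gr \ B)) A :=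
      Clus_between (Set.subset_insert _ _) (Set.insert_subset h1 subset_Clus)
    rw [← h2]
    rw [Clus_congr_off (O' := op ω ∩ (Gr \ B))]
    intro x hx
    have : x ≠ w := fun h => hx (Or.inl h)
    simp [op, this]
  have e2 : cnd {ω | u ∈ Clus nb (op ω ∩ (Gr \ B)) A} w false = {ω | u ∈ Clus nb (op ω ∩ (Gr \ insert w B)) A} := by
    ext ω
    simp only [cnd, Set.mem_ofPred_eq]
    have : op (Function.update ω w false) ∩ (Gr \ B) = op ω ∩ (Gr \ insert w B) := by
      ext x
      by_cases hx : x = w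
      · subst hx; simp [op]
      · simp [op, hx]
    rw [this]
  rw [e1, e2] at e
  rw [e]; unfold Vp; ring

lemma Vp_mono {ε : ℝ} {Gr : Set (ℤ × ℤ)} {u w : ℤ × ℤ} {A B : Set (ℤ × ℤ)} :
    Vp ε Gr u A (insert w B) ≤ Vp ε Gr u (insert w A) B :=
  Pr_mono _ fun ω hω => Clus_mono (Set.inter_subset_inter_right _ (Set.sdiff_subset_sdiff_right (Set.subset_insert _ _))) (Set.subset_insert _ _) hω

lemma Vp_zero {ε : ℝ} {Gr : Set (ℤ × ℤ)} {u : ℤ × ℤ} {A B : Set (ℤ × ℤ)} (hu : u ∉ A)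
    (h : ∀ v ∈ A, ∀ w ∈ Gr, w ∉ A → w ∉ B → ¬ nb v w) : Vp ε Gr u A B = 0 := by
  unfold Vp
  convert Pr_empty (fun _ : ℤ × ℤ => 1 - ε)
  ext ω
  simp only [Set.mem_ofPred_eq, Set.mem_empty_iff_false, iff_false]
  intro hc
  have : Clus nb (op ω ∩ (Gr \ B)) A ⊆ A := Clus_min subset_rfl fun x hx y hxy hy => by
    by_contra hyA
    exact h x hx y hy.2.1 hyA hy.2.2 hxy
  exact hu (this hc)

lemma Vp_le_one {ε : ℝ} {Gr : Set (ℤ × ℤ)} {u : ℤ × ℤ} {A B : Set (ℤ × ℤ)} : Vp ε Gr u A B ≤ 1 := Pr_le_one _ _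

end P5

section P6a

/-- planar directions: (axis, sign) -/
abbrev Dr := Bool × Bool

def fd : Dr → ℤ × ℤ → ℤ
  | (false, true), X => X.1
  | (false, false), X => - X.1
  | (true, true), X => X.2
  | (true, false), X => - X.2
def lt : Dr → ℤ × ℤ → ℤ
  | (false, _), X => X.2
  | (true, _), X => X.1
def tgt : ℤ × ℤ → Dr → ℤ × ℤ
  | v, (false, true) => (v.1 + 1, v.2)
  | v, (false, false) => (v.1 - 1, v.2)
  | v, (true, true) => (v.1, v.2 + 1)
  | v, (true, false) => (v.1, v.2 - 1)

lemma nb_tgt (v : ℤ × ℤ) (f : Dr) : nb v (tgt v f) := by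
  rcases f with ⟨_|_, _|_⟩ <;> simp [nb, tgt]
lemma exists_tgt {v w : ℤ × ℤ} (h : nb v w) : ∃ f, w = tgt v f := by
  obtain ⟨a, b⟩ := v
  obtain ⟨c, e⟩ := w
  simp only [nb] at h
  rcases h with ⟨h1, h2 | h2⟩ | ⟨h1, h2 | h2⟩
  · exact ⟨(true, true), by simp only [tgt, Prod.mk.injEq]; omega⟩
  · exact ⟨(true, false), by simp only [tgt, Prod.mk.injEq]; omega⟩
  · exact ⟨(false, true), by simp only [tgt, Prod.mk.injEq]; omega⟩
  · exact ⟨(false, false), by simp only [tgt, Prod.mk.injEq]; omega⟩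
def opp : Dr → Dr | (a, s) => (a, !s)
lemma tgt_opp (v : ℤ × ℤ) (f : Dr) : tgt (tgt v f) (opp f) = v := by
  rcases f with ⟨_|_, _|_⟩ <;> simp [tgt, opp]

def cc (h : ℤ) (v : ℤ × ℤ) : ℤ × ℤ := (20 * h * v.1, 20 * h * v.2)
lemma cc_tgt (h : ℤ) (v : ℤ × ℤ) (f : Dr) :
    fd f (cc h (tgt v f)) = fd f (cc h v) + 20 * h ∧ lt f (cc h (tgt v f)) = lt f (cc h v) := by
  rcases f with ⟨_|_, _|_⟩ <;> simp only [fd, lt, tgt, cc, and_true] <;> ring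

/-- neighbourhood of an edge -/
def Bx (h : ℤ) (v w : ℤ × ℤ) (X : ℤ × ℤ) : Prop :=
  (20 * h * min v.1 w.1 - 6 * h ≤ X.1 ∧ X.1 ≤ 20 * h * max v.1 w.1 + 6 * h) ∧
  (20 * h * min v.2 w.2 - 6 * h ≤ X.2 ∧ X.2 ≤ 20 * h * max v.2 w.2 + 6 * h)

lemma lat_cmp {h a b : ℤ} (hh : 0 < h) (H : 20 * h * a - 6 * h ≤ 20 * h * b + 6 * h) : a ≤ b := by
  by_contra hc
  have : b + 1 ≤ a := by omega
  nlinarith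

def Ed (v w : ℤ × ℤ) : Prop := v = w ∨ nb v w

lemma Bx_disj {h : ℤ} (hh : 0 < h) {v w v' w' : ℤ × ℤ} (e : Ed v w) (e' : Ed v' w') (h1 : v ≠ v') (h2 : v ≠ w')
    (h3 : w ≠ v') (h4 : w ≠ w') {X : ℤ × ℤ} (hX : Bx h v w X) (hX' : Bx h v' w' X) : False := by
  obtain ⟨⟨a1, a2⟩, a3, a4⟩ := hX
  obtain ⟨⟨b1, b2⟩, b3, b4⟩ := hX'
  have c1 := lat_cmp hh (a1.trans b2)
  have c2 := lat_cmp hh (b1.trans a2)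
  have c3 := lat_cmp hh (a3.trans b4)
  have c4 := lat_cmp hh (b3.trans a4)
  clear a1 a2 a3 a4 b1 b2 b3 b4
  obtain ⟨v1, v2⟩ := v
  obtain ⟨w1, w2⟩ := w
  obtain ⟨x1, x2⟩ := v'
  obtain ⟨y1, y2⟩ := w'
  simp only [Ed, nb, ne_eq, Prod.mk.injEq] at *
  rcases e with ⟨rfl, rfl⟩ | ⟨rfl, rfl | rfl⟩ | ⟨rfl, rfl | rfl⟩ <;>
  rcases e' with ⟨rfl, rfl⟩ | ⟨rfl, rfl | rfl⟩ | ⟨rfl, rfl | rfl⟩ <;>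
  simp only [min_self, max_self] at c1 c2 c3 c4 <;> omega

lemma Bx_of {h : ℤ} (hh : 0 < h) {v : ℤ × ℤ} {f : Dr} {X : ℤ × ℤ} (h1 : fd f (cc h v) - 6 * h ≤ fd f X)
    (h2 : fd f X ≤ fd f (cc h v) + 26 * h) (h3 : lt f (cc h v) - 6 * h ≤ lt f X) (h4 : lt f X ≤ lt f (cc h v) + 6 * h) :
    Bx h v (tgt v f) X := by
  have e1 : 20 * h * (v.1 + 1) = 20 * h * v.1 + 20 * h := by ring
  have e2 : 20 * h * (v.2 + 1) = 20 * h * v.2 + 20 * h := by ring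
  have e3 : 20 * h * (v.1 - 1) = 20 * h * v.1 - 20 * h := by ring
  have e4 : 20 * h * (v.2 - 1) = 20 * h * v.2 - 20 * h := by ring
  rcases f with ⟨_|_, _|_⟩ <;> simp only [fd, lt, tgt, cc, Bx] at *
  · rw [min_self, max_self, min_eq_right (by omega), max_eq_left (by omega), e3]; omega
  · rw [min_self, max_self, min_eq_left (by omega), max_eq_right (by omega), e1]; omega
  · rw [min_self, max_self, min_eq_right (by omega), max_eq_left (by omega), e4]; omega
  · rw [min_self, max_self, min_eq_left (by omega), max_eq_right (by omega), e2]; omega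

lemma Bx_self {h : ℤ} {v : ℤ × ℤ} {f : Dr} {X : ℤ × ℤ} (h1 : fd f (cc h v) - 6 * h ≤ fd f X)
    (h2 : fd f X ≤ fd f (cc h v) + 6 * h) (h3 : lt f (cc h v) - 6 * h ≤ lt f X) (h4 : lt f X ≤ lt f (cc h v) + 6 * h) :
    Bx h v v X := by
  rcases f with ⟨_|_, _|_⟩ <;> simp only [fd, lt, tgt, cc, Bx, min_self, max_self] at * <;> omega

noncomputable def win (h : ℤ) (X : ℤ × ℤ) : Finset (ℤ × ℤ) :=
  Finset.Icc (X.1 / (20 * h) - 2) (X.1 / (20 * h) + 2) ×ˢ Finset.Icc (X.2 / (20 * h) - 2) (X.2 / (20 * h) + 2)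

lemma win_card (h : ℤ) (X : ℤ × ℤ) : (win h X).card = 25 := by
  unfold win
  rw [Finset.card_product, Int.card_Icc, Int.card_Icc]
  have : ∀ a : ℤ, (a + 2 + 1 - (a - 2)).toNat = 5 := by intro a; omega
  rw [this, this]

lemma win_aux {h a x : ℤ} (hh : 0 < h) (h1 : 20 * h * a - 26 * h ≤ x) (h2 : x ≤ 20 * h * a + 26 * h) :
    x / (20 * h) - 2 ≤ a ∧ a ≤ x / (20 * h) + 2 := by
  have e1 := Int.mul_ediv_add_emod x (20 * h)
  have e2 := Int.emod_nonneg x (show 20 * h ≠ 0 by omega)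
  have e3 := Int.emod_lt_of_pos x (show 0 < 20 * h by omega)
  constructor <;> by_contra hc <;> push Not at hc
  · have : a + 1 ≤ x / (20 * h) - 2 := by omega
    nlinarith
  · have : x / (20 * h) + 2 + 1 ≤ a := by omega
    nlinarith

lemma win_mem {h : ℤ} (hh : 0 < h) {v w X : ℤ × ℤ} (e : Ed v w) (hX : Bx h v w X) : w ∈ win h X := by
  obtain ⟨⟨a1, a2⟩, a3, a4⟩ := hX
  have k1 : w.1 - 1 ≤ min v.1 w.1 := by simp only [Ed, nb, Prod.ext_iff] at e; omega
  have k2 : max v.1 w.1 ≤ w.1 + 1 := by simp only [Ed, nb, Prod.ext_iff] at e; omega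
  have k3 : w.2 - 1 ≤ min v.2 w.2 := by simp only [Ed, nb, Prod.ext_iff] at e; omega
  have k4 : max v.2 w.2 ≤ w.2 + 1 := by simp only [Ed, nb, Prod.ext_iff] at e; omega
  unfold win
  rw [Finset.mem_product, Finset.mem_Icc, Finset.mem_Icc]
  exact ⟨win_aux hh (by nlinarith) (by nlinarith), win_aux hh (by nlinarith) (by nlinarith)⟩

/-- planar shadow of the zone -/
def PZ (m n : ℤ) (Z : ℤ × ℤ) (f : Dr) (σ : Bool) (X : ℤ × ℤ) : Prop :=
  (fd f Z + n + 1 ≤ fd f X ∧ fd f X ≤ fd f Z + n + 2 * m + 1) ∧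
  (σ = true → lt f Z ≤ lt f X ∧ lt f X ≤ lt f Z + n) ∧ (σ = false → lt f Z - n ≤ lt f X ∧ lt f X ≤ lt f Z)
def PD (m n : ℤ) (Z : ℤ × ℤ) (f : Dr) (σ : Bool) (X : ℤ × ℤ) : Prop :=
  ((Z.1 - n ≤ X.1 ∧ X.1 ≤ Z.1 + n) ∧ (Z.2 - n ≤ X.2 ∧ X.2 ≤ Z.2 + n)) ∨ PZ m n Z f σ X
def PS (m n : ℤ) (Z : ℤ × ℤ) (f : Dr) (σ : Bool) (X : ℤ × ℤ) : Prop :=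
  (fd f X = fd f Z + n + m + 1) ∧
  (σ = true → lt f Z ≤ lt f X ∧ lt f X ≤ lt f Z + n) ∧ (σ = false → lt f Z - n ≤ lt f X ∧ lt f X ≤ lt f Z)

/-- region that has to be fresh for a port -/
def Fr (n h : ℤ) (v : ℤ × ℤ) (f : Dr) (Q : ℤ × ℤ) (lo hi : ℤ) (X : ℤ × ℤ) : Prop :=
  fd f Q + n + 1 ≤ fd f X ∧ fd f X ≤ fd f (cc h v) + 23 * h ∧ lo ≤ lt f X ∧ lt f X ≤ hi
/-- region that may be explored from a port -/
def Te (m n h : ℤ) (v : ℤ × ℤ) (f : Dr) (Q : ℤ × ℤ) (lo hi : ℤ) (X : ℤ × ℤ) : Prop :=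
  fd f (cc h v) + 10 * h ≤ fd f X ∨
    (fd f Q - n ≤ fd f X ∧ lo - n ≤ lt f X ∧ lt f X ≤ hi + n ∧
      (fd f X ≤ fd f Q + m → lt f Q - n ≤ lt f X ∧ lt f X ≤ lt f Q + n))
/-- shape of the explored region behind a seed -/
def Tl (m n : ℤ) (f : Dr) (Q X : ℤ × ℤ) : Prop :=
  fd f X ≤ fd f Q + m ∧ (fd f Q - m ≤ fd f X → lt f Q - n ≤ lt f X ∧ lt f X ≤ lt f Q + n) ∧
    (fd f Q - n ≤ fd f X → lt f Q - 2 * n ≤ lt f X ∧ lt f X ≤ lt f Q + 2 * n)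

/-- planar constraints on a port seed -/
def Pq (n h : ℤ) (v : ℤ × ℤ) (f : Dr) (Q : ℤ × ℤ) (lo hi : ℤ) : Prop :=
  (lo ≤ lt f Q ∧ lt f Q ≤ hi) ∧ (lo + 2 * n ≤ hi) ∧ (lt f (cc h v) - (h + n) ≤ lo ∧ hi ≤ lt f (cc h v) + (h + n)) ∧
  (fd f (cc h v) - h ≤ fd f Q ∧ fd f Q ≤ fd f (cc h v) + 3 * h)

lemma PD_fl {m n : ℤ} {Z : ℤ × ℤ} {f : Dr} {σ : Bool} {X : ℤ × ℤ} : PD m n Z f σ X ↔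
    ((fd f Z - n ≤ fd f X ∧ fd f X ≤ fd f Z + n) ∧ (lt f Z - n ≤ lt f X ∧ lt f X ≤ lt f Z + n)) ∨ PZ m n Z f σ X := by
  unfold PD
  refine or_congr_left ?_
  rcases f with ⟨_|_, _|_⟩ <;> simp only [fd, lt] <;> omega

lemma Fr_Bx {n h : ℤ} (hn : 0 ≤ n) (hnh : n ≤ h) (hh : 0 < h) {v : ℤ × ℤ} {f : Dr} {Q : ℤ × ℤ} {lo hi : ℤ} (hq : Pq n h v f Q lo hi)
    {X : ℤ × ℤ} (hX : Fr n h v f Q lo hi X) : Bx h v (tgt v f) X := by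
  unfold Pq at hq
  unfold Fr at hX
  exact Bx_of hh (by omega) (by omega) (by omega) (by omega)

lemma Tl_step {m n : ℤ} (hm : 1 ≤ m) (hmn : 2 * m ≤ n) {f : Dr} {σ : Bool} {Q Q' X : ℤ × ℤ} (hs : PS m n Q f σ Q')
    (hX : PD m n Q f σ X ∨ Tl m n f Q X) : Tl m n f Q' X := by
  rw [PD_fl] at hX
  unfold PS at hs
  unfold PZ Tl at *
  rcases σ with _ | _ <;> simp only [true_implies, reduceCtorEq, false_implies, and_true, true_and] at * <;> omega

lemma Fr_step {m n h : ℤ} (hm : 1 ≤ m) (hmn : 2 * m ≤ n) {v : ℤ × ℤ} {f : Dr} {σ : Bool} {Q Q' X : ℤ × ℤ} {lo hi : ℤ}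
    (hs : PS m n Q f σ Q') (hX : PD m n Q f σ X ∨ ¬ Fr n h v f Q lo hi X) : ¬ Fr n h v f Q' lo hi X := by
  rw [PD_fl] at hX
  unfold PS at hs
  unfold PZ Fr at *
  rcases σ with _ | _ <;> simp only [true_implies, reduceCtorEq, false_implies, and_true, true_and] at * <;> omega

end P6a

section P6b

def gL (f : Dr) : Dr := (!f.1, true)
def gR (f : Dr) : Dr := (!f.1, false)
def sel {α : Type*} (f : Dr) (a b c : α) (f' : Dr) : α := if f' = f then a else if f'.2 then b else c
lemma dr_cases (f f' : Dr) : f' = f ∨ f' = gL f ∨ f' = gR f ∨ f' = opp f := by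
  rcases f with ⟨_|_, _|_⟩ <;> rcases f' with ⟨_|_, _|_⟩ <;> simp [gL, gR, opp]
lemma sel_f {α : Type*} (f : Dr) (a b c : α) : sel f a b c f = a := by simp [sel]
lemma sel_L {α : Type*} (f : Dr) (a b c : α) : sel f a b c (gL f) = b := by
  rcases f with ⟨_|_, _|_⟩ <;> simp [sel, gL]
lemma sel_R {α : Type*} (f : Dr) (a b c : α) : sel f a b c (gR f) = c := by
  rcases f with ⟨_|_, _|_⟩ <;> simp [sel, gR]

/-- seed position at a new vertex -/
def Zc (n h : ℤ) (w : ℤ × ℤ) (f : Dr) (Z : ℤ × ℤ) : Prop :=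
  (fd f (cc h w) ≤ fd f Z ∧ fd f Z ≤ fd f (cc h w) + h) ∧
  (lt f (cc h w) - (h + n) ≤ lt f Z ∧ lt f Z ≤ lt f (cc h w) + (h + n))

noncomputable def sL (n h : ℤ) (w : ℤ × ℤ) (f : Dr) (Z : ℤ × ℤ) (f' : Dr) : ℤ :=
  if f' = f then lt f (cc h w) - (h + n) else lt f' Z - n
noncomputable def sH (n h : ℤ) (w : ℤ × ℤ) (f : Dr) (Z : ℤ × ℤ) (f' : Dr) : ℤ :=
  if f' = f then lt f (cc h w) + (h + n) else lt f' Z + n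
noncomputable def sg (h : ℤ) (w : ℤ × ℤ) (f : Dr) (Z : ℤ × ℤ) : Bool := decide (lt f Z ≤ lt f (cc h w))

structure Star (m n h : ℤ) (w : ℤ × ℤ) (f : Dr) (Z Qf Qg Qh : ℤ × ℤ) : Prop where
  hm : 1 ≤ m
  hmn : 2 * m ≤ n
  hh : h = n + m + 1
  z : Zc n h w f Z
  a : PS m n Z f (sg h w f Z) Qf
  b : PS m n Z (gL f) f.2 Qg
  c : PS m n Z (gR f) f.2 Qh

variable {m n h : ℤ} {w Z Qf Qg Qh : ℤ × ℤ} {f : Dr}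

lemma sg_spec (hmn : 0 ≤ n) (hh : 0 ≤ h) (z : Zc n h w f Z) (a : PS m n Z f (sg h w f Z) Qf) :
    (fd f Qf = fd f Z + n + m + 1) ∧ (lt f Z - n ≤ lt f Qf ∧ lt f Qf ≤ lt f Z + n) ∧
    (lt f (cc h w) - (h + n) ≤ lt f Qf ∧ lt f Qf ≤ lt f (cc h w) + (h + n)) := by
  obtain ⟨a1, a2, a3⟩ := a
  unfold Zc at z
  by_cases hc : lt f Z ≤ lt f (cc h w)
  · have := a2 (by simp [sg, hc])
    omega
  · have := a3 (by simpa [sg] using hc)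
    omega

lemma Star.port (s : Star m n h w f Z Qf Qg Qh) {f' : Dr} (hf : f' ≠ opp f) :
    Pq n h w f' (sel f Qf Qg Qh f') (sL n h w f Z f') (sH n h w f Z f') := by
  obtain ⟨hm, hmn, hh, z, a, b, c⟩ := s
  have a := sg_spec (by omega) (by omega) z a
  rcases f with ⟨_|_, _|_⟩ <;> rcases f' with ⟨_|_, _|_⟩ <;>
  simp only [Pq, sel, sL, sH, sg, Zc, PS, gL, gR, opp, lt, fd, Bool.not_true, Bool.not_false, Prod.mk.injEq,
    ne_eq, not_true_eq_false, and_true, true_and, and_false, false_and, not_false_eq_true, reduceCtorEq, if_true, if_false, true_implies, false_implies] at * <;> omega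

lemma Star.fresh (s : Star m n h w f Z Qf Qg Qh) {f' : Dr} (hf : f' ≠ opp f) {X : ℤ × ℤ}
    (hX : Tl m n f Z X ∨ PD m n Z f (sg h w f Z) X ∨ PD m n Z (gL f) f.2 X ∨ PD m n Z (gR f) f.2 X) :
    ¬ Fr n h w f' (sel f Qf Qg Qh f') (sL n h w f Z f') (sH n h w f Z f') X := by
  obtain ⟨hm, hmn, hh, z, a, b, c⟩ := s
  have a := sg_spec (by omega) (by omega) z a
  generalize sg h w f Z = σ at hX
  rcases f with ⟨_|_, _|_⟩ <;> rcases f' with ⟨_|_, _|_⟩ <;> rcases σ with _ | _ <;>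
  simp only [Fr, Tl, PD, PZ, sel, sL, sH, sg, Zc, PS, gL, gR, opp, lt, fd, Bool.not_true, Bool.not_false, Prod.mk.injEq,
    ne_eq, not_true_eq_false, and_true, true_and, and_false, false_and, not_false_eq_true, reduceCtorEq, if_true, if_false, true_implies, false_implies] at * <;> omega

lemma Star.compat (s : Star m n h w f Z Qf Qg Qh) {f' f'' : Dr} (hf : f' ≠ opp f) (hf' : f'' ≠ opp f) (hne : f' ≠ f'') {X : ℤ × ℤ}
    (hX : Te m n h w f' (sel f Qf Qg Qh f') (sL n h w f Z f') (sH n h w f Z f') X) :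
    ¬ Fr n h w f'' (sel f Qf Qg Qh f'') (sL n h w f Z f'') (sH n h w f Z f'') X := by
  obtain ⟨hm, hmn, hh, z, a, b, c⟩ := s
  have a := sg_spec (by omega) (by omega) z a
  rcases f with ⟨_|_, _|_⟩ <;> rcases f' with ⟨_|_, _|_⟩ <;> rcases f'' with ⟨_|_, _|_⟩ <;>
  simp only [Fr, Te, PD, PZ, sel, sL, sH, sg, Zc, PS, gL, gR, opp, lt, fd, Bool.not_true, Bool.not_false, Prod.mk.injEq,
    ne_eq, not_true_eq_false, and_true, true_and, and_false, false_and, not_false_eq_true, reduceCtorEq, if_true, if_false, true_implies, false_implies] at * <;> omega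

lemma star_z1 {σ : Bool} (hm : 1 ≤ m) (hmn : 2 * m ≤ n) {X : ℤ × ℤ} (hX : PZ m n Z f σ X) : ¬ Tl m n f Z X := by
  unfold PZ Tl at *; omega
lemma star_z2 {σ : Bool} (hm : 1 ≤ m) (hmn : 2 * m ≤ n) {X : ℤ × ℤ} (hX : PZ m n Z (gL f) f.2 X) :
    ¬ (Tl m n f Z X ∨ PD m n Z f σ X) := by
  rcases f with ⟨_|_, _|_⟩ <;> rcases σ with _ | _ <;>
  simp only [PD, PZ, Tl, gL, gR, lt, fd, Bool.not_true, Bool.not_false, and_true, true_and, reduceCtorEq, true_implies, false_implies] at * <;> omega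
lemma star_z3 {σ : Bool} (hm : 1 ≤ m) (hmn : 2 * m ≤ n) {X : ℤ × ℤ} (hX : PZ m n Z (gR f) f.2 X) :
    ¬ (Tl m n f Z X ∨ PD m n Z f σ X ∨ PD m n Z (gL f) f.2 X) := by
  rcases f with ⟨_|_, _|_⟩ <;> rcases σ with _ | _ <;>
  simp only [PD, PZ, Tl, gL, gR, lt, fd, Bool.not_true, Bool.not_false, and_true, true_and, reduceCtorEq, true_implies, false_implies] at * <;> omega

lemma star_near {σ : Bool} {f' : Dr} (hm : 1 ≤ m) (hmn : 2 * m ≤ n) (hh : h = n + m + 1) {X : ℤ × ℤ} (hX : PD m n Z f' σ X) :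
    (fd f Z - 2 * h ≤ fd f X ∧ fd f X ≤ fd f Z + 2 * h) ∧ (lt f Z - 2 * h ≤ lt f X ∧ lt f X ≤ lt f Z + 2 * h) := by
  rcases f with ⟨_|_, _|_⟩ <;> rcases f' with ⟨_|_, _|_⟩ <;> rcases σ with _ | _ <;>
  simp only [PD, PZ, lt, fd, Bool.not_true, Bool.not_false, and_true, true_and, reduceCtorEq, true_implies, false_implies] at * <;> omega
lemma star_near' {σ : Bool} (hm : 1 ≤ m) (hmn : 2 * m ≤ n) (hh : h = n + m + 1) {X : ℤ × ℤ} (hX : PD m n Z f σ X) :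
    (fd f Z - n ≤ fd f X ∧ fd f X ≤ fd f Z + 2 * h) ∧ (lt f Z - n ≤ lt f X ∧ lt f X ≤ lt f Z + n) := by
  rw [PD_fl] at hX
  rcases σ with _ | _ <;>
  simp only [PZ, and_true, true_and, reduceCtorEq, true_implies, false_implies] at * <;> omega

end P6b

section P6c
variable {d : ℕ}

def pj (i0 i1 : Fin d) (x : Site d) : ℤ × ℤ := (x i0, x i1)
def Tk (i0 i1 : Fin d) (r : ℤ) (x : Site d) : Prop := ∀ j, j ≠ i0 → j ≠ i1 → -r ≤ x j ∧ x j ≤ r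
def sgn : Bool → ℤˣ | true => 1 | false => -1
def axf (i0 i1 : Fin d) (f : Dr) : Fin d := if f.1 then i1 else i0
def axl (i0 i1 : Fin d) (f : Dr) : Fin d := if f.1 then i0 else i1
def tau (i0 i1 : Fin d) (f : Dr) (σ : Bool) (z : Site d) (j : Fin d) : ℤˣ :=
  if j = axf i0 i1 f then sgn f.2 else if j = axl i0 i1 f then sgn σ else if z j ≤ 0 then 1 else -1

variable {i0 i1 : Fin d} {m n : ℕ} {z x : Site d} {f : Dr} {σ : Bool}

lemma zone_PZ (h01 : i0 ≠ i1) (hx : x ∈ zone m n z (axf i0 i1 f) (tau i0 i1 f σ z)) :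
    PZ m n (pj i0 i1 z) f σ (pj i0 i1 x) := by
  obtain ⟨h1, h2⟩ := hx
  have h3 := h2 (axl i0 i1 f) (by rcases f with ⟨_|_, _⟩ <;> simp [axf, axl, h01, h01.symm])
  rcases f with ⟨_|_, _|_⟩ <;> rcases σ with _|_ <;>
    simp [tau, axf, axl, h01, h01.symm, sgn, PZ, fd, lt, pj] at h1 h3 ⊢ <;> omega

lemma zone_Tk (hz : Tk i0 i1 n z) (hx : x ∈ zone m n z (axf i0 i1 f) (tau i0 i1 f σ z)) : Tk i0 i1 n x := by
  intro j hj0 hj1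
  have hz := hz j hj0 hj1
  have e1 : j ≠ axf i0 i1 f := by unfold axf; split_ifs <;> assumption
  have e2 : j ≠ axl i0 i1 f := by unfold axl; split_ifs <;> assumption
  have h2 := hx.2 j e1
  rw [show tau i0 i1 f σ z j = if z j ≤ 0 then 1 else -1 by unfold tau; rw [if_neg e1, if_neg e2]] at h2
  split_ifs at h2 with h <;> simp at h2 <;> omega

lemma DD_PD (h01 : i0 ≠ i1) (hx : x ∈ DD m n z (axf i0 i1 f) (tau i0 i1 f σ z)) :
    PD m n (pj i0 i1 z) f σ (pj i0 i1 x) := by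
  rcases hx with hx | hx
  · left
    rw [mem_ball (Int.natCast_nonneg n)] at hx
    have h0 := hx i0
    have h1 := hx i1
    simp only [pj]; omega
  · exact Or.inr (zone_PZ h01 hx)

lemma DD_Tk (hz : Tk i0 i1 n z) (hx : x ∈ DD m n z (axf i0 i1 f) (tau i0 i1 f σ z)) : Tk i0 i1 (2 * n) x := by
  intro j hj0 hj1
  rcases hx with hx | hx
  · rw [mem_ball (Int.natCast_nonneg n)] at hx
    have h0 := hx j
    have h1 := hz j hj0 hj1
    omega
  · have := zone_Tk hz hx j hj0 hj1
    omega

lemma seed_fd {i : Fin d} {τ : Fin d → ℤˣ} {z' : Site d} (h : IsSeed m n z i τ z') : (τ i : ℤ) * (z' i - z i) = n + m + 1 := by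
  have hm : ∀ s : ℤ, -m ≤ s → s ≤ m → Function.update z' i (z' i + s) ∈ ball z' (m:ℤ) := by
    intro s h1 h2
    rw [mem_ball (Int.natCast_nonneg m)]
    intro j
    by_cases hj : j = i
    · subst hj; simp; omega
    · simp [Function.update_of_ne hj]
  have a := (h (hm m (by omega) le_rfl)).1
  have b := (h (hm (-m) le_rfl (by omega))).1
  simp only [Function.update_self] at a b
  rcases unit_cases (τ i) with hh | hh <;> simp only [hh] at a b ⊢ <;> omega

lemma seed_PS (h01 : i0 ≠ i1) {z' : Site d} (h : IsSeed m n z (axf i0 i1 f) (tau i0 i1 f σ z) z') :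
    PS m n (pj i0 i1 z) f σ (pj i0 i1 z') := by
  have h1 := seed_fd h
  have h2 := zone_PZ h01 (h (self_mem_ball (Int.natCast_nonneg m)))
  refine ⟨?_, h2.2⟩
  rcases f with ⟨_|_, _|_⟩ <;> simp [tau, axf, axl, h01, h01.symm, sgn, fd, lt, pj] at h1 ⊢ <;> omega

/-- planar form of the step -/
theorem step2 (h01 : i0 ≠ i1) {p0 δ ε : ℝ} (hc : GMc d p0 δ ε m n) {J : ℕ} {Λ Y C E : Set (Site d)} {k : Site d → ℕ}
    (hΛ : Λ.Finite) (hCf : C.Finite) (hCE : C ⊆ E) (hz : Tk i0 i1 n z) (hzC : ball z (m:ℤ) ⊆ C) (σ : Bool)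
    (hDΛ : ∀ x, Tk i0 i1 (2 * n) x → PD m n (pj i0 i1 z) f σ (pj i0 i1 x) → x ∈ Λ)
    (hk : ∀ x, k x + 1 ≤ J)
    (hzone : ∀ x ∈ E, ¬ PZ m n (pj i0 i1 z) f σ (pj i0 i1 x))
    {a b : ℝ} (hba : b ≤ a)
    (ha : ∀ D C' z', (∀ x ∈ D, PD m n (pj i0 i1 z) f σ (pj i0 i1 x)) → D.Finite → C ⊆ C' → C' ⊆ C ∪ D → Tk i0 i1 n z' →
      PS m n (pj i0 i1 z) f σ (pj i0 i1 z') → ball z' (m:ℤ) ⊆ C' → a ≤ Sv adj p0 δ J Λ Y C' (E ∪ D) (kS D k))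
    (hb : ∀ D C', (∀ x ∈ D, PD m n (pj i0 i1 z) f σ (pj i0 i1 x)) → D.Finite → C ⊆ C' → C' ⊆ C ∪ D →
      b ≤ Sv adj p0 δ J Λ Y C' (E ∪ D) (kS D k)) :
    a - ε * (a - b) ≤ Sv adj p0 δ J Λ Y C E k := by
  refine step hc (z := z) (i := axf i0 i1 f) (τ := tau i0 i1 f σ z) hΛ (fun x hx => hDΛ x (DD_Tk hz hx) (DD_PD h01 hx)) hCf (fun x _ => hk x) hzC ?_ hba ?_ ?_
  · rw [Set.disjoint_left]
    intro x hx hx'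
    have : x ∈ E := hx'.elim id fun h => hCE h
    exact hzone x this (zone_PZ h01 hx)
  · intro C' z' h1 h2 h3 h4
    exact ha _ C' z' (fun x hx => DD_PD h01 hx) (DD_finite _ _ _ _ _) h1 h2 (zone_Tk hz (h3 (self_mem_ball (Int.natCast_nonneg m)))) (seed_PS h01 h3) h4
  · intro C' h1 h2
    exact hb _ C' (fun x hx => DD_PD h01 hx) (DD_finite _ _ _ _ _) h1 h2

end P6c

section P6d
variable {d : ℕ}

structure Port (i0 i1 : Fin d) (m n : ℕ) (h : ℤ) (C E : Set (Site d)) (v : ℤ × ℤ) (f : Dr) (q : Site d) (lo hi : ℤ) : Prop where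
  bl : ball q (m:ℤ) ⊆ C
  tk : Tk i0 i1 n q
  pq : Pq n h v f (pj i0 i1 q) lo hi
  fr : ∀ x ∈ E, ¬ Fr n h v f (pj i0 i1 q) lo hi (pj i0 i1 x)

structure Ports (i0 i1 : Fin d) (m n : ℕ) (h : ℤ) (Gr U : Set (ℤ × ℤ)) (C E : Set (Site d)) (v : ℤ × ℤ)
    (P : Dr → Site d) (lo hi : Dr → ℤ) : Prop where
  pt : ∀ f, tgt v f ∈ Gr → tgt v f ∉ U → Port i0 i1 m n h C E v f (P f) (lo f) (hi f)
  cp : ∀ f f', f ≠ f' → tgt v f ∈ Gr → tgt v f ∉ U → tgt v f' ∈ Gr → tgt v f' ∉ U → ∀ X,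
    Te m n h v f (pj i0 i1 (P f)) (lo f) (hi f) X → ¬ Fr n h v f' (pj i0 i1 (P f')) (lo f') (hi f') X

open Classical in
noncomputable def cn (h : ℤ) (U : Set (ℤ × ℤ)) (X : ℤ × ℤ) : ℕ := ((win h X).filter (· ∈ U)).card

lemma cn_le (h : ℤ) (U : Set (ℤ × ℤ)) (X : ℤ × ℤ) : cn h U X ≤ 25 := by
  classical
  unfold cn
  rw [← win_card h X]; exact Finset.card_filter_le _ _
lemma cn_mono (h : ℤ) (U : Set (ℤ × ℤ)) (w X : ℤ × ℤ) : cn h U X ≤ cn h (insert w U) X := by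
  classical
  unfold cn
  refine Finset.card_le_card fun v hv => ?_
  simp only [Finset.mem_filter] at hv ⊢
  exact ⟨hv.1, Or.inr hv.2⟩
lemma cn_insert {h : ℤ} {U : Set (ℤ × ℤ)} {w X : ℤ × ℤ} (hw : w ∉ U) (hX : w ∈ win h X) : cn h U X + 1 ≤ cn h (insert w U) X := by
  classical
  unfold cn
  rw [← Finset.card_insert_of_notMem (a := w) (by simp [hw])]
  refine Finset.card_le_card fun v hv => ?_
  simp only [Finset.mem_insert, Finset.mem_filter] at hv ⊢
  rcases hv with rfl | hv
  · exact ⟨hX, Or.inl rfl⟩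
  · exact ⟨hv.1, Or.inr hv.2⟩

structure Inv (i0 i1 : Fin d) (m n : ℕ) (h : ℤ) (Gr A U : Set (ℤ × ℤ)) (C E : Set (Site d)) (k : Site d → ℕ) : Prop where
  fin : C.Finite
  CE : C ⊆ E
  AG : A ⊆ Gr
  AU : A ⊆ U
  seed : ∀ v ∈ A, ∃ z, ball z (m:ℤ) ⊆ C ∧ Tk i0 i1 n z ∧ ∃ f, Zc n h v f (pj i0 i1 z)
  ports : ∀ v ∈ A, ∃ P lo hi, Ports i0 i1 m n h Gr U C E v P lo hi
  far : ∀ x ∈ E, ∀ w w2, w ∉ U → w2 ∉ U → Ed w w2 → ¬ Bx h w w2 (pj i0 i1 x)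
  cnt : ∀ x, k x ≤ 24 * cn h U (pj i0 i1 x)

structure Base (i0 i1 : Fin d) (m n : ℕ) (h : ℤ) (Gr : Set (ℤ × ℤ)) (T0 : ℤ × ℤ → Prop) (A U : Set (ℤ × ℤ)) (w : ℤ × ℤ) (t : ℕ)
    (C E : Set (Site d)) (k : Site d → ℕ) : Prop where
  fin : C.Finite
  CE : C ⊆ E
  AG : A ⊆ Gr
  AU : A ⊆ U
  seed : ∀ v ∈ A, ∃ z, ball z (m:ℤ) ⊆ C ∧ Tk i0 i1 n z ∧ ∃ f, Zc n h v f (pj i0 i1 z)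
  ports : ∀ v ∈ A, ∃ P lo hi, Ports i0 i1 m n h Gr (insert w U) C E v P lo hi ∧
    ∀ f, tgt v f ∈ Gr → tgt v f ∉ insert w U → ∀ X, T0 X → ¬ Fr n h v f (pj i0 i1 (P f)) (lo f) (hi f) X
  far : ∀ x ∈ E, ∀ w1 w2, w1 ∉ insert w U → w2 ∉ insert w U → Ed w1 w2 → ¬ Bx h w1 w2 (pj i0 i1 x)
  tfar : ∀ X, T0 X → ∀ w1 w2, w1 ∉ insert w U → w2 ∉ insert w U → Ed w1 w2 → ¬ Bx h w1 w2 X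
  twin : ∀ X, T0 X → w ∈ win h X
  wU : w ∉ U
  wG : w ∈ Gr
  cnt : ∀ x, k x ≤ 24 * cn h U (pj i0 i1 x) + t
  cnt' : ∀ x, w ∉ win h (pj i0 i1 x) → k x ≤ 24 * cn h U (pj i0 i1 x)

variable {i0 i1 : Fin d} {m n : ℕ} {h : ℤ} {Gr A U : Set (ℤ × ℤ)} {T0 : ℤ × ℤ → Prop} {w : ℤ × ℤ} {t : ℕ}
  {C C' E D : Set (Site d)} {k : Site d → ℕ}

lemma Base.inv (b : Base i0 i1 m n h Gr T0 A U w t C E k) (ht : t ≤ 24) : Inv i0 i1 m n h Gr A (insert w U) C E k where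
  fin := b.fin
  CE := b.CE
  AG := b.AG
  AU := b.AU.trans (Set.subset_insert _ _)
  seed := b.seed
  ports := fun v hv => by
    obtain ⟨P, lo, hi, h1, -⟩ := b.ports v hv
    exact ⟨P, lo, hi, h1⟩
  far := b.far
  cnt := fun x => by
    by_cases hw : w ∈ win h (pj i0 i1 x)
    · have := cn_insert b.wU hw
      have := b.cnt x
      omega
    · have := cn_mono h U w (pj i0 i1 x)
      have := b.cnt' x hw
      omega

lemma Base.add (b : Base i0 i1 m n h Gr T0 A U w t C E k) (hD : ∀ x ∈ D, T0 (pj i0 i1 x)) (hDf : D.Finite) (h1 : C ⊆ C') (h2 : C' ⊆ C ∪ D) :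
    Base i0 i1 m n h Gr T0 A U w (t+1) C' (E ∪ D) (kS D k) where
  fin := (b.fin.union hDf).subset h2
  CE := h2.trans (Set.union_subset_union_left _ b.CE)
  AG := b.AG
  AU := b.AU
  seed := fun v hv => by
    obtain ⟨z, hz, hz'⟩ := b.seed v hv
    exact ⟨z, hz.trans h1, hz'⟩
  ports := fun v hv => by
    obtain ⟨P, lo, hi, hp, hT⟩ := b.ports v hv
    refine ⟨P, lo, hi, ⟨fun f hf hf' => ?_, hp.cp⟩, hT⟩
    have := hp.pt f hf hf'
    refine ⟨this.bl.trans h1, this.tk, this.pq, ?_⟩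
    rintro x (hx | hx)
    · exact this.fr x hx
    · exact hT f hf hf' _ (hD x hx)
  far := by
    rintro x (hx | hx)
    · exact b.far x hx
    · exact b.tfar _ (hD x hx)
  tfar := b.tfar
  twin := b.twin
  wU := b.wU
  wG := b.wG
  cnt := fun x => by
    have := b.cnt x
    unfold kS; split_ifs <;> omega
  cnt' := fun x hx => by
    have := b.cnt' x hx
    unfold kS
    rw [if_neg]
    · exact this
    · exact fun h => hx (b.twin _ (hD x h))

/-- one step within a unit -/
lemma Base.step (h01 : i0 ≠ i1) {p0 δ ε : ℝ} (hc : GMc d p0 δ ε m n) {Λ Y : Set (Site d)} (hΛ : Λ.Finite)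
    (hTΛ : ∀ x, Tk i0 i1 (2 * n) x → T0 (pj i0 i1 x) → x ∈ Λ) {va vb : ℝ} (hba : vb ≤ va)
    (hB : ∀ C E k, Inv i0 i1 m n h Gr A (insert w U) C E k → vb ≤ Sv adj p0 δ 700 Λ Y C E k)
    (b : Base i0 i1 m n h Gr T0 A U w t C E k) (ht : t + 1 ≤ 24) {z : Site d} (hz : Tk i0 i1 n z) (hzC : ball z (m:ℤ) ⊆ C)
    (f : Dr) (σ : Bool) (hPD : ∀ X, PD m n (pj i0 i1 z) f σ X → T0 X)
    (hzone : ∀ x ∈ E, ¬ PZ m n (pj i0 i1 z) f σ (pj i0 i1 x))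
    (ha : ∀ C' E' k' z', Base i0 i1 m n h Gr T0 A U w (t+1) C' E' k' → C ⊆ C' →
      (∀ x ∈ E', x ∈ E ∨ PD m n (pj i0 i1 z) f σ (pj i0 i1 x)) → Tk i0 i1 n z' →
      PS m n (pj i0 i1 z) f σ (pj i0 i1 z') → ball z' (m:ℤ) ⊆ C' → va ≤ Sv adj p0 δ 700 Λ Y C' E' k') :
    va - ε * (va - vb) ≤ Sv adj p0 δ 700 Λ Y C E k := by
  refine step2 h01 hc hΛ b.fin b.CE hz hzC σ (fun x h1 h2 => hTΛ x h1 (hPD _ h2)) ?_ hzone hba ?_ ?_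
  · intro x
    have := b.cnt x
    have := cn_le h U (pj i0 i1 x)
    omega
  · intro D C' z' hD hDf h1 h2 h3 h4 h5
    exact ha _ _ _ z' (b.add (fun x hx => hPD _ (hD x hx)) hDf h1 h2) h1 (fun x hx => hx.imp id (hD x)) h3 h4 h5
  · intro D C' hD hDf h1 h2
    exact hB _ _ _ ((b.add (fun x hx => hPD _ (hD x hx)) hDf h1 h2).inv ht)

end P6d

section P6e
variable {d : ℕ} {i0 i1 : Fin d} {m n : ℕ} {h : ℤ} {Gr A U : Set (ℤ × ℤ)} {T0 : ℤ × ℤ → Prop} {w : ℤ × ℤ} {t : ℕ}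
  {C C' E D : Set (Site d)} {k : Site d → ℕ}

lemma val_le {ε va vb : ℝ} {s : ℕ} (he : 0 ≤ ε) (hba : vb ≤ va) (hs : s * ε ≤ 1) : vb ≤ va - s * ε * (va - vb) := by
  nlinarith
lemma val_step {ε va vb S : ℝ} {s : ℕ} (he : 0 ≤ ε) (hba : vb ≤ va)
    (H : (va - s * ε * (va - vb)) - ε * ((va - s * ε * (va - vb)) - vb) ≤ S) : va - (s + 1 : ℕ) * ε * (va - vb) ≤ S := by
  have h2 : 0 ≤ s * ε * (va - vb) * ε := by have := sub_nonneg.2 hba; positivity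
  push_cast
  nlinarith

/-- occupation of a new vertex by three steps -/
lemma Base.star (h01 : i0 ≠ i1) {p0 δ ε : ℝ} (hc : GMc d p0 δ ε m n) (hh : h = n + m + 1) (hε : 24 * ε ≤ 1) {Λ Y : Set (Site d)} (hΛ : Λ.Finite)
    (hTΛ : ∀ x, Tk i0 i1 (2 * n) x → T0 (pj i0 i1 x) → x ∈ Λ) {va vb : ℝ} (hba : vb ≤ va)
    (hA : ∀ C E k, Inv i0 i1 m n h Gr (insert w A) (insert w U) C E k → va ≤ Sv adj p0 δ 700 Λ Y C E k)
    (hB : ∀ C E k, Inv i0 i1 m n h Gr A (insert w U) C E k → vb ≤ Sv adj p0 δ 700 Λ Y C E k)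
    (b : Base i0 i1 m n h Gr T0 A U w t C E k) (ht : t + 3 ≤ 24) {z : Site d} (hz : Tk i0 i1 n z) (hzC : ball z (m:ℤ) ⊆ C)
    {f : Dr} (hzc : Zc n h w f (pj i0 i1 z))
    (hT0 : ∀ X, (fd f (pj i0 i1 z) - 2 * h ≤ fd f X ∧ fd f X ≤ fd f (pj i0 i1 z) + 2 * h) →
      (lt f (pj i0 i1 z) - 2 * h ≤ lt f X ∧ lt f X ≤ lt f (pj i0 i1 z) + 2 * h) → T0 X)
    (hT : ∀ x ∈ E, ∀ w2, w2 = w ∨ (nb w w2 ∧ w2 ∉ insert w U) → Bx h w w2 (pj i0 i1 x) → Tl m n f (pj i0 i1 z) (pj i0 i1 x))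
    (hopp : tgt w (opp f) ∈ Gr → tgt w (opp f) ∈ insert w U) :
    va - (3 : ℕ) * ε * (va - vb) ≤ Sv adj p0 δ 700 Λ Y C E k := by
  have hm : (1:ℤ) ≤ m := by exact_mod_cast hc.m1
  have hmn : (2:ℤ) * m ≤ n := by exact_mod_cast hc.mn
  have he := hc.e0
  have hPT : ∀ (f' : Dr) (σ : Bool) X, PD m n (pj i0 i1 z) f' σ X → T0 X := by
    intro f' σ X hX
    have := star_near (f := f) hm hmn hh hX
    exact hT0 X this.1 this.2
  have hPB : ∀ (f' : Dr) (σ : Bool) X, PD m n (pj i0 i1 z) f' σ X → Bx h w w X := by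
    intro f' σ X hX
    have := star_near (f := f) hm hmn hh hX
    unfold Zc at hzc
    exact Bx_self (f := f) (by omega) (by omega) (by omega) (by omega)
  have hEZ : ∀ (f' : Dr) (σ : Bool), ∀ x ∈ E, PZ m n (pj i0 i1 z) f' σ (pj i0 i1 x) → Tl m n f (pj i0 i1 z) (pj i0 i1 x) :=
    fun f' σ x hx hX => hT x hx w (Or.inl rfl) (hPB f' σ _ (Or.inr hX))
  refine val_step he hba (Base.step h01 hc hΛ hTΛ (val_le he hba (by push_cast; linarith)) hB b (by omega) hz hzC f (sg h w f (pj i0 i1 z)) (hPT _ _) ?_ ?_)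
  · intro x hx hX
    exact star_z1 hm hmn hX (hEZ _ _ x hx hX)
  intro C1 E1 k1 q1 b1 hC1 hE1 tk1 ps1 bl1
  refine val_step he hba (Base.step h01 hc hΛ hTΛ (val_le he hba (by push_cast; linarith)) hB b1 (by omega) hz (hzC.trans hC1) (gL f) f.2 (hPT _ _) ?_ ?_)
  · intro x hx hX
    refine star_z2 (σ := sg h w f (pj i0 i1 z)) hm hmn hX ?_
    rcases hE1 x hx with hx | hx
    · exact Or.inl (hEZ _ _ x hx hX)
    · exact Or.inr hx
  intro C2 E2 k2 q2 b2 hC2 hE2 tk2 ps2 bl2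
  have := val_step (s := 0) (S := Sv adj p0 δ 700 Λ Y C2 E2 k2) (va := va) (vb := vb) he hba ?_
  · exact this
  rw [Nat.cast_zero, zero_mul, zero_mul, sub_zero]
  refine Base.step h01 hc hΛ hTΛ hba hB b2 (by omega) hz (hzC.trans (hC1.trans hC2)) (gR f) f.2 (hPT _ _) ?_ ?_
  · intro x hx hX
    refine star_z3 (σ := sg h w f (pj i0 i1 z)) hm hmn hX ?_
    rcases hE2 x hx with hx | hx
    · rcases hE1 x hx with hx | hx
      · exact Or.inl (hEZ _ _ x hx hX)
      · exact Or.inr (Or.inl hx)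
    · exact Or.inr (Or.inr hx)
  intro C3 E3 k3 q3 b3 hC3 hE3 tk3 ps3 bl3
  refine hA _ _ _ ?_
  have I := b3.inv (by omega)
  have S : Star m n h w f (pj i0 i1 z) (pj i0 i1 q1) (pj i0 i1 q2) (pj i0 i1 q3) := ⟨hm, hmn, hh, hzc, ps1, ps2, ps3⟩
  have hsel : ∀ f', pj i0 i1 (sel f q1 q2 q3 f') = sel f (pj i0 i1 q1) (pj i0 i1 q2) (pj i0 i1 q3) f' := by
    intro f'; unfold sel; split_ifs <;> rfl
  have hno : ∀ f', tgt w f' ∈ Gr → tgt w f' ∉ insert w U → f' ≠ opp f := by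
    rintro f' h1 h2 rfl
    exact h2 (hopp h1)
  refine ⟨I.fin, I.CE, Set.insert_subset b.wG b.AG, Set.insert_subset_insert b.AU, ?_, ?_, I.far, I.cnt⟩
  · rintro v (rfl | hv)
    · exact ⟨z, hzC.trans (hC1.trans (hC2.trans hC3)), hz, f, hzc⟩
    · exact I.seed v hv
  · rintro v (rfl | hv)
    · refine ⟨sel f q1 q2 q3, sL n h v f (pj i0 i1 z), sH n h v f (pj i0 i1 z), ?_, ?_⟩
      · intro f' h1 h2
        have hne := hno f' h1 h2
        refine ⟨?_, ?_, ?_, ?_⟩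
        · unfold sel; split_ifs
          · exact bl1.trans (hC2.trans hC3)
          · exact bl2.trans hC3
          · exact bl3
        · unfold sel; split_ifs
          · exact tk1
          · exact tk2
          · exact tk3
        · rw [hsel]; exact S.port hne
        · intro x hx hF
          rw [hsel] at hF
          refine S.fresh hne ?_ hF
          rcases hE3 x hx with hx | hx
          · rcases hE2 x hx with hx | hx
            · rcases hE1 x hx with hx | hx
              · exact Or.inl (hT x hx _ (Or.inr ⟨nb_tgt v f', h2⟩) (Fr_Bx (by omega) (by omega) (by omega) (S.port hne) hF))
              · exact Or.inr (Or.inl hx)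
            · exact Or.inr (Or.inr (Or.inl hx))
          · exact Or.inr (Or.inr (Or.inr hx))
      · intro f' f'' hne h1 h2 h3 h4 X hX
        rw [hsel] at hX ⊢
        exact S.compat (hno f' h1 h2) (hno f'' h3 h4) hne hX
    · exact I.ports v hv

/-- following a tube from a port and occupying the target -/
lemma Base.tube (h01 : i0 ≠ i1) {p0 δ ε : ℝ} (hc : GMc d p0 δ ε m n) (hh : h = n + m + 1) (hε : 24 * ε ≤ 1) {Λ Y : Set (Site d)} (hΛ : Λ.Finite)
    {va vb : ℝ} (hba : vb ≤ va) {v : ℤ × ℤ} {f : Dr} (hw : w = tgt v f) {q1 : Site d} {lo hi : ℤ} (hq1 : Pq n h v f (pj i0 i1 q1) lo hi)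
    (hT0e : T0 = fun X => Bx h v w X ∧ Te m n h v f (pj i0 i1 q1) lo hi X)
    (hTΛ : ∀ x, Tk i0 i1 (2 * n) x → T0 (pj i0 i1 x) → x ∈ Λ)
    (hA : ∀ C E k, Inv i0 i1 m n h Gr (insert w A) (insert w U) C E k → va ≤ Sv adj p0 δ 700 Λ Y C E k)
    (hB : ∀ C E k, Inv i0 i1 m n h Gr A (insert w U) C E k → vb ≤ Sv adj p0 δ 700 Λ Y C E k)
    (hvU : v ∈ U) (s : ℕ) :
    ∀ (t : ℕ) (C E : Set (Site d)) (k : Site d → ℕ) (q : Site d), Base i0 i1 m n h Gr T0 A U w t C E k → t + s + 3 ≤ 24 →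
      Tk i0 i1 n q → ball q (m:ℤ) ⊆ C →
      (pj i0 i1 q = pj i0 i1 q1 ∨ fd f (pj i0 i1 q1) + h ≤ fd f (pj i0 i1 q)) →
      fd f (cc h w) - fd f (pj i0 i1 q) ≤ s * h → fd f (pj i0 i1 q) ≤ fd f (cc h w) + h →
      (lo ≤ lt f (pj i0 i1 q) ∧ lt f (pj i0 i1 q) ≤ hi) →
      (∀ x ∈ E, ¬ Fr n h v f (pj i0 i1 q) lo hi (pj i0 i1 x)) →
      (∀ x ∈ E, ∀ w2, w2 = w ∨ (nb w w2 ∧ w2 ∉ insert w U) → Bx h w w2 (pj i0 i1 x) → Tl m n f (pj i0 i1 q) (pj i0 i1 x)) →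
      va - (s + 3 : ℕ) * ε * (va - vb) ≤ Sv adj p0 δ 700 Λ Y C E k := by
  have hm : (1:ℤ) ≤ m := by exact_mod_cast hc.m1
  have hmn : (2:ℤ) * m ≤ n := by exact_mod_cast hc.mn
  have he := hc.e0
  have hcc := cc_tgt h v f
  rw [← hw] at hcc
  have fin : ∀ (t : ℕ) (C E : Set (Site d)) (k : Site d → ℕ) (q : Site d), Base i0 i1 m n h Gr T0 A U w t C E k → t + 3 ≤ 24 →
      Tk i0 i1 n q → ball q (m:ℤ) ⊆ C → fd f (cc h w) ≤ fd f (pj i0 i1 q) → fd f (pj i0 i1 q) ≤ fd f (cc h w) + h →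
      (lo ≤ lt f (pj i0 i1 q) ∧ lt f (pj i0 i1 q) ≤ hi) →
      (∀ x ∈ E, ∀ w2, w2 = w ∨ (nb w w2 ∧ w2 ∉ insert w U) → Bx h w w2 (pj i0 i1 x) → Tl m n f (pj i0 i1 q) (pj i0 i1 x)) →
      va - (3 : ℕ) * ε * (va - vb) ≤ Sv adj p0 δ 700 Λ Y C E k := by
    intro t C E k q b ht tk bl h3 h4 h5 hT
    have hq := hq1
    unfold Pq at hq
    refine b.star h01 hc hh hε hΛ hTΛ hba hA hB ht tk bl (f := f) ?_ ?_ hT ?_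
    · unfold Zc; omega
    · intro X hX1 hX2
      rw [hT0e]
      refine ⟨?_, Or.inl (by omega)⟩
      rw [hw]
      exact Bx_of (by omega) (by omega) (by omega) (by omega) (by omega)
    · intro _
      rw [hw, tgt_opp]
      exact Or.inr hvU
  induction s with
  | zero =>
    intro t C E k q b ht tk bl h1 h2 h3 h4 h5 h6
    exact fin t C E k q b (by omega) tk bl (by push_cast at h2; omega) h3 h4 h6
  | succ s ih =>
    intro t C E k q b ht tk bl h1 h2 h3 h4 h5 h6
    have hs24 : ((s + 3 : ℕ) : ℝ) * ε ≤ 1 := by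
      have : ((s + 3 : ℕ) : ℝ) ≤ 24 := by exact_mod_cast (show s + 3 ≤ 24 by omega)
      nlinarith
    by_cases hge : fd f (cc h w) ≤ fd f (pj i0 i1 q)
    · refine le_trans ?_ (fin t C E k q b (by omega) tk bl hge h3 h4 h6)
      have : (3:ℝ) ≤ (s + 1 + 3 : ℕ) := by push_cast; linarith [(Nat.cast_nonneg s : (0:ℝ) ≤ s)]
      have h7 : 0 ≤ ε * (va - vb) := mul_nonneg he (sub_nonneg.2 hba)
      push_cast at this ⊢
      nlinarith
    · push Not at hge
      have hq := hq1
      unfold Pq at hq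
      have hfq : fd f (pj i0 i1 q1) ≤ fd f (pj i0 i1 q) := by
        rcases h1 with h1 | h1
        · rw [h1]
        · omega
      have main : ∀ σ : Bool, (σ = true → lt f (pj i0 i1 q) + n ≤ hi) → (σ = false → lo ≤ lt f (pj i0 i1 q) - n) →
          va - (s + 1 + 3 : ℕ) * ε * (va - vb) ≤ Sv adj p0 δ 700 Λ Y C E k := by
        intro σ hσ1 hσ2
        rw [show s + 1 + 3 = (s + 3) + 1 by omega]
        have hbd : ∀ X, PZ m n (pj i0 i1 q) f σ X → lo ≤ lt f X ∧ lt f X ≤ hi := by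
          intro X hX
          rcases σ with _ | _
          · have := hX.2.2 rfl; have := hσ2 rfl; omega
          · have := hX.2.1 rfl; have := hσ1 rfl; omega
        refine val_step he hba (Base.step h01 hc hΛ hTΛ (val_le he hba hs24) hB b (by omega) tk bl f σ ?_ ?_ ?_)
        · intro X hX
          have hX1 := star_near' hm hmn hh hX
          rw [hT0e]
          refine ⟨?_, Or.inr ⟨by omega, by omega, by omega, ?_⟩⟩
          · rw [hw]
            exact Bx_of (by omega) (by omega) (by omega) (by omega) (by omega)
          · intro h9
            rcases h1 with h1 | h1
            · rw [← h1]; exact hX1.2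
            · omega
        · intro x hx hX
          have := hbd _ hX
          refine h5 x hx ⟨?_, ?_, this⟩
          · exact hX.1.1
          · have := hX.1.2; omega
        · intro C' E' k' z' b' hC' hE' tk' ps' bl'
          have hps := ps'
          unfold PS at hps
          refine ih (t+1) C' E' k' z' b' (by omega) tk' bl' (Or.inr (by omega)) ?_ (by omega) ?_ ?_ ?_
          · push_cast at h2
            have : ((s:ℤ) + 1) * h = s * h + h := by ring
            rw [this] at h2; omega
          · rcases σ with _ | _
            · have := hps.2.2 rfl; have := hσ2 rfl; omega
            · have := hps.2.1 rfl; have := hσ1 rfl; omega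
          · intro x hx
            refine Fr_step hm hmn ps' ?_
            rcases hE' x hx with hx | hx
            · exact Or.inr (h5 x hx)
            · exact Or.inl hx
          · intro x hx w2 hw2 hB2
            refine Tl_step hm hmn ps' ?_
            rcases hE' x hx with hx | hx
            · exact Or.inr (h6 x hx w2 hw2 hB2)
            · exact Or.inl hx
      by_cases hlr : lt f (pj i0 i1 q) + n ≤ hi
      · exact main true (fun _ => hlr) (fun h => by cases h)
      · exact main false (fun h => by cases h) (fun _ => by omega)

end P6e

section P6f
variable {d : ℕ} {i0 i1 : Fin d} {m n : ℕ} {h : ℤ} {Gr A U : Set (ℤ × ℤ)} {C E : Set (Site d)} {k : Site d → ℕ}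

lemma Inv.base (hh : h = n + m + 1) (iv : Inv i0 i1 m n h Gr A U C E k) {v : ℤ × ℤ} (hv : v ∈ A) {f : Dr} (hw : tgt v f ∈ Gr) (hwU : tgt v f ∉ U)
    {P : Dr → Site d} {lo hi : Dr → ℤ} (hP : Ports i0 i1 m n h Gr U C E v P lo hi) :
    Base i0 i1 m n h Gr (fun X => Bx h v (tgt v f) X ∧ Te m n h v f (pj i0 i1 (P f)) (lo f) (hi f) X) A U (tgt v f) 0 C E k where
  fin := iv.fin
  CE := iv.CE
  AG := iv.AG
  AU := iv.AU
  seed := iv.seed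
  ports := by
    intro v' hv'
    by_cases hvv : v' = v
    · subst hvv
      refine ⟨P, lo, hi, ⟨fun f' h1 h2 => hP.pt f' h1 (fun hc => h2 (Or.inr hc)), fun f1 f2 hne h1 h2 h3 h4 => 
        hP.cp f1 f2 hne h1 (fun hc => h2 (Or.inr hc)) h3 (fun hc => h4 (Or.inr hc))⟩, ?_⟩
      intro f' h1 h2 X hX
      refine hP.cp f f' ?_ hw hwU h1 (fun hc => h2 (Or.inr hc)) X hX.2
      rintro rfl
      exact h2 (Or.inl rfl)
    · obtain ⟨P', lo', hi', hP'⟩ := iv.ports v' hv'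
      refine ⟨P', lo', hi', ⟨fun f' h1 h2 => hP'.pt f' h1 (fun hc => h2 (Or.inr hc)), fun f1 f2 hne h1 h2 h3 h4 => 
        hP'.cp f1 f2 hne h1 (fun hc => h2 (Or.inr hc)) h3 (fun hc => h4 (Or.inr hc))⟩, ?_⟩
      intro f' h1 h2 X hX hF
      have hq := (hP'.pt f' h1 (fun hc => h2 (Or.inr hc))).pq
      have hB := Fr_Bx (by omega) (by omega) (by omega) hq hF
      have hU' : tgt v' f' ∉ U := fun hc => h2 (Or.inr hc)
      refine Bx_disj (by omega) (Or.inr (nb_tgt v f)) (Or.inr (nb_tgt v' f')) (Ne.symm hvv) ?_ ?_ ?_ hX.1 hB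
      · rintro hc; rw [← hc] at hU'; exact hU' (iv.AU hv)
      · rintro hc; rw [hc] at hwU; exact hwU (iv.AU hv')
      · intro hc; exact h2 (Or.inl hc.symm)
  far := fun x hx w1 w2 h1 h2 => iv.far x hx w1 w2 (fun hc => h1 (Or.inr hc)) (fun hc => h2 (Or.inr hc))
  tfar := by
    intro X hX w1 w2 h1 h2 he hB
    have hvU := iv.AU hv
    refine Bx_disj (by omega) (Or.inr (nb_tgt v f)) he ?_ ?_ ?_ ?_ hX.1 hB
    · rintro rfl; exact h1 (Or.inr hvU)
    · rintro rfl; exact h2 (Or.inr hvU)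
    · rintro rfl; exact h1 (Or.inl rfl)
    · rintro rfl; exact h2 (Or.inl rfl)
  twin := fun X hX => win_mem (by omega) (Or.inr (nb_tgt v f)) hX.1
  wU := hwU
  wG := hw
  cnt := fun x => by have := iv.cnt x; omega
  cnt' := fun x _ => iv.cnt x

lemma Sv_one {p0 δ : ℝ} {Λ Y : Set (Site d)} {z : Site d} (h1 : z ∈ C) (h2 : z ∈ Y) : Sv adj p0 δ 700 Λ Y C E k = 1 := by
  unfold Sv
  have : hit adj Λ Y C = Set.univ := by
    refine Set.eq_univ_of_forall fun ω => ?_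
    exact ⟨z, subset_Clus h1, h2⟩
  rw [this, Pr_univ]

lemma Sv_nonneg {p0 δ : ℝ} {Λ Y : Set (Site d)} : 0 ≤ Sv adj p0 δ 700 Λ Y C E k := Pr_nonneg _ _

lemma outer (h01 : i0 ≠ i1) {p0 δ ε : ℝ} (hc : GMc d p0 δ ε m n) (hh : h = n + m + 1) (hε : 24 * ε ≤ 1) {Λ Y : Set (Site d)} (hΛ : Λ.Finite)
    (hG : Gr.Finite) (hTΛ : ∀ v ∈ Gr, ∀ w ∈ Gr, ∀ x, Tk i0 i1 (2 * n) x → Bx h v w (pj i0 i1 x) → x ∈ Λ)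
    {u : ℤ × ℤ} (hY : ∀ z f, Tk i0 i1 n z → Zc n h u f (pj i0 i1 z) → z ∈ Y) (N : ℕ) :
    ∀ A U C E k, (Gr \ U).ncard ≤ N → Inv i0 i1 m n h Gr A U C E k → Vp (24 * ε) Gr u A (U \ A) ≤ Sv adj p0 δ 700 Λ Y C E k := by
  have hm : (1:ℤ) ≤ m := by exact_mod_cast hc.m1
  have he := hc.e0
  induction N with
  | zero =>
    intro A U C E k hN iv
    by_cases huA : u ∈ A
    · obtain ⟨z, hz, hz2, f, hz3⟩ := iv.seed u huA
      rw [Sv_one (hz (self_mem_ball (Int.natCast_nonneg m))) (hY z f hz2 hz3)]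
      exact Vp_le_one
    · rw [Vp_zero huA]
      · exact Sv_nonneg
      · intro v hv w hw hwA hwB
        have : Gr \ U = ∅ := by
          rw [← Set.ncard_eq_zero hG.sdiff]; omega
        have : w ∈ Gr \ U := ⟨hw, fun hc => hwB ⟨hc, hwA⟩⟩
        simp_all
  | succ N ih =>
    intro A U C E k hN iv
    by_cases huA : u ∈ A
    · obtain ⟨z, hz, hz2, f, hz3⟩ := iv.seed u huA
      rw [Sv_one (hz (self_mem_ball (Int.natCast_nonneg m))) (hY z f hz2 hz3)]
      exact Vp_le_one
    by_cases hex : ∃ v ∈ A, ∃ w ∈ Gr, w ∉ U ∧ nb v w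
    · obtain ⟨v, hv, w, hw, hwU, hvw⟩ := hex
      obtain ⟨f, rfl⟩ := exists_tgt hvw
      obtain ⟨P, lo, hi, hP⟩ := iv.ports v hv
      have hpt := hP.pt f hw hwU
      have b := iv.base hh hv hw hwU hP
      have hcard : (Gr \ insert (tgt v f) U).ncard ≤ N := by
        have : (Gr \ insert (tgt v f) U).ncard < (Gr \ U).ncard := by
          refine Set.ncard_lt_ncard ⟨fun x hx => ⟨hx.1, fun hc => hx.2 (Or.inr hc)⟩, fun hc => ?_⟩ hG.sdiff
          exact (hc ⟨hw, hwU⟩).2 (Or.inl rfl)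
        omega
      have hwA : tgt v f ∉ A := fun hc => hwU (iv.AU hc)
      have e1 : insert (tgt v f) U \ insert (tgt v f) A = U \ A := by
        ext x; simp only [Set.mem_sdiff, Set.mem_insert_iff]
        constructor
        · tauto
        · rintro ⟨h1, h2⟩
          refine ⟨Or.inr h1, ?_⟩
          rintro (rfl | h3)
          · exact hwU h1
          · exact h2 h3
      have e2 : insert (tgt v f) U \ A = insert (tgt v f) (U \ A) := by
        ext x; simp only [Set.mem_sdiff, Set.mem_insert_iff]
        constructor
        · tauto
        · rintro (rfl | h1)
          · exact ⟨Or.inl rfl, hwA⟩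
          · exact ⟨Or.inr h1.1, h1.2⟩
      rw [Vp_rec (by linarith) hε hG u hw hwA (fun hc => hwU hc.1) hv hvw]
      have := Base.tube (Gr := Gr) (A := A) (U := U) (Y := Y) h01 hc hh hε hΛ (Vp_mono (ε := 24 * ε) (Gr := Gr) (u := u) (w := tgt v f) (A := A) (B := U \ A)) rfl hpt.pq rfl
        (fun x h1 h2 => hTΛ v (iv.AG hv) _ hw x h1 h2.1)
        (fun C E k iv' => by have := ih _ _ C E k hcard iv'; rwa [e1] at this)
        (fun C E k iv' => by have := ih _ _ C E k hcard iv'; rwa [e2] at this) (iv.AU hv) 21 0 C E k (P f) b (by omega) hpt.tk hpt.bl (Or.inl rfl)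
        ?_ ?_ hpt.pq.1 hpt.fr ?_
      · push_cast at this
        linarith
      · have := hpt.pq
        unfold Pq at this
        have := (cc_tgt h v f).1
        push_cast
        omega
      · have := hpt.pq
        unfold Pq at this
        have := (cc_tgt h v f).1
        omega
      · intro x hx w2 hw2 hB
        exfalso
        refine iv.far x hx _ w2 hwU ?_ ?_ hB
        · rcases hw2 with rfl | hw2
          · exact hwU
          · exact fun hc => hw2.2 (Or.inr hc)
        · rcases hw2 with rfl | hw2
          · exact Or.inl rfl
          · exact Or.inr hw2.1
    · rw [Vp_zero huA]
      · exact Sv_nonneg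
      · intro v hv w hw hwA hwB hnb
        exact hex ⟨v, hv, w, hw, fun hc => hwB ⟨hc, hwA⟩, hnb⟩

lemma Bx_zero {X : ℤ × ℤ} : Bx h 0 0 X ↔ (-(6 * h) ≤ X.1 ∧ X.1 ≤ 6 * h) ∧ (-(6 * h) ≤ X.2 ∧ X.2 ≤ 6 * h) := by
  simp [Bx]

lemma start (h01 : i0 ≠ i1) {p0 δ ε : ℝ} (hc : GMc d p0 δ ε m n) (hh : h = n + m + 1) (hε : 2400 * ε ≤ 1) {Λ Y : Set (Site d)} (hΛ : Λ.Finite)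
    (K : ℕ) (hTΛ : ∀ v ∈ Blk K 0, ∀ w ∈ Blk K 0, ∀ x, Tk i0 i1 (2 * n) x → Bx h v w (pj i0 i1 x) → x ∈ Λ)
    {u : ℤ × ℤ} (hu : u ∈ Blk K 0) (hY : ∀ z f, Tk i0 i1 n z → Zc n h u f (pj i0 i1 z) → z ∈ Y) :
    1/4 ≤ Pr (fun _ : Site d => 1 - (1 - p0) * (1 - δ)^700) (hit adj Λ Y (ball 0 (m:ℤ))) := by
  have hm : (1:ℤ) ≤ m := by exact_mod_cast hc.m1
  have hmn : (2:ℤ) * m ≤ n := by exact_mod_cast hc.mn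
  have he := hc.e0
  have h00 : (0 : ℤ × ℤ) ∈ Blk K 0 := by rw [Blk_mem]; simp
  have hE : ∀ x ∈ ball (0 : Site d) (m:ℤ), ∀ j, -(m:ℤ) ≤ x j ∧ x j ≤ m := by
    intro x hx j
    have := (mem_ball (Int.natCast_nonneg m)).1 hx j
    simpa using this
  have b : Base i0 i1 m n h (Blk K 0) (Bx h 0 0) ∅ ∅ 0 0 (ball (0 : Site d) (m:ℤ)) (ball 0 (m:ℤ)) (fun _ => 0) := 
    { fin := ball_finite _ _
      CE := subset_rfl
      AG := Set.empty_subset _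
      AU := Set.empty_subset _
      seed := fun v hv => hv.elim
      ports := fun v hv => hv.elim
      far := by
        intro x hx w1 w2 h1 h2 he hB
        have h3 : Bx h 0 0 (pj i0 i1 x) := by
          rw [Bx_zero]
          have := hE x hx i0
          have := hE x hx i1
          simp only [pj]; omega
        refine Bx_disj (by omega) (Or.inl rfl) he ?_ ?_ ?_ ?_ h3 hB <;> rintro rfl <;> simp at h1 h2
      tfar := by
        intro X h3 w1 w2 h1 h2 he hB
        refine Bx_disj (by omega) (Or.inl rfl) he ?_ ?_ ?_ ?_ h3 hB <;> rintro rfl <;> simp at h1 h2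
      twin := fun X hX => win_mem (by omega) (Or.inl rfl) hX
      wU := fun hc => hc
      wG := h00
      cnt := fun x => Nat.zero_le _
      cnt' := fun x _ => Nat.zero_le _ }
  have hO := outer (Y := Y) h01 hc hh (by linarith) hΛ (Blk_finite K 0) hTΛ hY
  have hpl := planar (ε := 24 * ε) (by linarith) (by linarith) K hu
  have z0 : pj i0 i1 (0 : Site d) = 0 := rfl
  have := b.star (Y := Y) (va := Vp (24*ε) (Blk K 0) u {0} ∅) (vb := 0) h01 hc hh (by linarith) hΛ (hTΛ 0 h00 0 h00) (by linarith)
    (fun C E k iv => by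
      have := hO _ _ _ C E k le_rfl iv
      simpa using this) (fun C E k iv => Sv_nonneg) (by omega) (z := 0) ?_ subset_rfl (f := (false, true)) ?_ ?_ ?_ ?_
  · unfold Sv at this
    rw [Pr_congr (hΛ.sdiff (t := ball (0 : Site d) (m:ℤ))) hit_dep (r' := fun _ : Site d => 1 - (1 - p0) * (1 - δ)^700)] at this
    · refine le_trans ?_ this
      have : Vp (24*ε) (Blk K 0) u {0} ∅ ≤ 1 := Vp_le_one
      push_cast
      nlinarith
    · intro x hx
      unfold rS
      rw [if_neg]
      exact fun hc => hx.2 hc.2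
  · intro j _ _; simp
  · rw [z0]; unfold Zc; simp [fd, lt, cc]; omega
  · rw [z0]; intro X h1 h2
    rw [Bx_zero]
    simp only [fd, lt, Prod.fst_zero, Prod.snd_zero] at h1 h2; omega
  · intro x hx w2 _ _
    rw [z0]
    have := hE x hx i0
    have := hE x hx i1
    simp only [Tl, fd, lt, Prod.fst_zero, Prod.snd_zero, pj]
    omega
  · intro hcc
    exfalso
    rw [Blk_mem] at hcc
    simp [opp, tgt] at hcc
end P6f

section P7a
variable {d : ℕ}

/-- x and y are connected by open sites in S -/
def Cn (S : Set (Site d)) (x y : Site d) : Set (Site d → Bool) := {ω | x ∈ op ω ∩ S ∧ y ∈ Clus adj (op ω ∩ S) {x}}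

lemma Cn_dep {S : Set (Site d)} {x y : Site d} : Dep (Cn S x y) S := by
  intro ω ω' h hw
  have : op ω ∩ S = op ω' ∩ S := by
    ext z; constructor
    · rintro ⟨h1, h2⟩; exact ⟨by rw [mem_op] at *; rw [← h z h2]; exact h1, h2⟩
    · rintro ⟨h1, h2⟩; exact ⟨by rw [mem_op] at *; rw [h z h2]; exact h1, h2⟩
  unfold Cn at *
  have hw' : x ∈ op ω ∩ S ∧ y ∈ Clus adj (op ω ∩ S) {x} := hw
  rw [this] at hw'
  exact hw'

lemma Cn_inc {S : Set (Site d)} {x y : Site d} : Inc (Cn S x y) := by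
  intro ω ω' h hw
  refine ⟨⟨h x hw.1.1, hw.1.2⟩, Clus_mono ?_ subset_rfl hw.2⟩
  rintro z ⟨h1, h2⟩
  exact ⟨h z h1, h2⟩

lemma Cn_mem {S : Set (Site d)} {x y : Site d} {ω : Site d → Bool} (h : ω ∈ Cn S x y) : y ∈ op ω ∩ S := by
  rcases Clus_sub h.2 with h1 | h1
  · obtain rfl : y = x := h1
    exact h.1
  · exact h1

lemma Cn_symm {S : Set (Site d)} {x y : Site d} {ω : Site d → Bool} (h : ω ∈ Cn S x y) : ω ∈ Cn S y x :=
  ⟨Cn_mem h, Clus_symm (fun _ _ => adj_symm) h.1 h.2⟩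

lemma Cn_trans {S : Set (Site d)} {x y z : Site d} {ω : Site d → Bool} (h : ω ∈ Cn S x y) (h' : ω ∈ Cn S y z) : ω ∈ Cn S x z :=
  ⟨h.1, Clus_trans h.2 h'.2⟩

lemma Cn_mono {S T : Set (Site d)} {x y : Site d} {ω : Site d → Bool} (hST : S ⊆ T) (h : ω ∈ Cn S x y) : ω ∈ Cn T x y :=
  ⟨⟨h.1.1, hST h.1.2⟩, Clus_mono (Set.inter_subset_inter_right _ hST) subset_rfl h.2⟩

lemma Pr_Cn_trans {r : Site d → ℝ} {S : Set (Site d)} (hS : S.Finite) {x y z : Site d} {a b : ℝ} (hb : 0 ≤ b) (h1 : a ≤ Pr r (Cn S x y))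
    (h2 : b ≤ Pr r (Cn S y z)) : a * b ≤ Pr r (Cn S x z) := by
  have := Harris (r := r) hS (Cn_dep (x := x) (y := y)) (Cn_dep (x := y) (y := z)) Cn_inc Cn_inc
  refine le_trans (mul_le_mul h1 h2 hb (Pr_nonneg _ _)) (this.trans (Pr_mono _ fun ω hω => Cn_trans hω.1 hω.2))

lemma Pr_Cn_symm {r : Site d → ℝ} {S : Set (Site d)} {x y : Site d} : Pr r (Cn S x y) = Pr r (Cn S y x) :=
  congrArg _ (Set.Subset.antisymm (fun ω h => Cn_symm h) (fun ω h => Cn_symm h))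

lemma fill_sub {S : Set (Site d)} {c : Site d} {r : ℤ} (hb : ball c r ⊆ S) {x y : Site d} (hx : x ∈ ball c r) (hy : y ∈ ball c r)
    {ω : Site d → Bool} (h : ∀ z ∈ ball c r, ω z = true) : ω ∈ Cn S x y := by
  refine ⟨⟨h x hx, hb hx⟩, Clus_mono ?_ subset_rfl (ball_conn hx hy)⟩
  intro z hz
  exact ⟨h z hz, hb hz⟩

/-- probability that a ball is fully open -/
noncomputable def kap (d : ℕ) (p : ℝ) (r : ℤ) : ℝ := p ^ (ball (0 : Site d) r).ncard

lemma kap_pos {p : ℝ} (hp : 0 < p) (r : ℤ) : 0 < kap d p r := pow_pos hp _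

lemma ball_ncard_z (c : Site d) {r : ℤ} (hr : 0 ≤ r) : (ball c r).ncard = (ball (0 : Site d) r).ncard := by
  have : ball c r = (fun x => x + c) '' ball (0 : Site d) r := by
    ext x
    constructor
    · intro hx
      refine ⟨x - c, ?_, by simp⟩
      rw [mem_ball hr] at *
      intro i; have := hx i; simpa using this
    · rintro ⟨y, hy, rfl⟩
      rw [mem_ball hr] at *
      intro i; have := hy i; simpa using this
  rw [this, Set.ncard_image_of_injective _ (add_left_injective c)]

lemma Pr_fill {p : ℝ} (hp : 0 ≤ p) (hp1 : p ≤ 1) (c : Site d) {r : ℤ} (hr : 0 ≤ r) :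
    Pr (fun _ : Site d => p) {ω | ∀ z ∈ ball c r, ω z = true} = kap d p r := by
  have := Pr_all (fun _ : Site d => p) (ball_finite c r).toFinset
  simp only [Set.Finite.mem_toFinset, Finset.prod_const, cl_of_mem hp hp1] at this
  rw [this, kap, ← ball_ncard_z c hr, Set.ncard_eq_toFinset_card _ (ball_finite c r)]

/-- standard region -/
def Lam (i0 i1 : Fin d) (n : ℕ) (h l : ℤ) : Set (Site d) :=
  {x | (-(6*h) ≤ x i0 ∧ x i0 ≤ l + 6*h) ∧ (-(6*h) ≤ x i1 ∧ x i1 ≤ l + 6*h) ∧ ∀ j, j ≠ i0 → j ≠ i1 → -(2*n:ℤ) ≤ x j ∧ x j ≤ 2 * n}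

lemma Lam_finite {i0 i1 : Fin d} {n : ℕ} {h l : ℤ} (hn : (n:ℤ) ≤ h) (hl : 0 ≤ l) : (Lam i0 i1 n h l).Finite := by
  refine (ball_finite (0 : Site d) (l + 6 * h)).subset fun x hx => ?_
  obtain ⟨h1, h2, h3⟩ := hx
  rw [mem_ball (by omega)]
  intro j
  simp only [Pi.zero_apply, sub_zero]
  by_cases e0 : j = i0
  · subst e0; omega
  by_cases e1 : j = i1
  · subst e1; omega
  have := h3 j e0 e1
  omega

lemma move {i0 i1 : Fin d} {m n : ℕ} {h : ℤ} (h01 : i0 ≠ i1) {p0 δ ε p : ℝ} (hc : GMc d p0 δ ε m n) (hh : h = n + m + 1) (hε : 2400 * ε ≤ 1)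
    (hp0 : 0 ≤ p) (hp1 : p ≤ 1) (hp : 1 - (1 - p0) * (1 - δ)^700 ≤ p) (K : ℕ) {l t : ℤ} (hl : l = 20 * h * (3^K - 1)) (ht : 0 ≤ t) (htl : t ≤ l)
    (s : Fin d → ℤˣ) {x x' : Site d} (hx' : x' = Function.update x i0 (x i0 + s i0 * t)) {S : Set (Site d)} (hSf : S.Finite)
    (hS : ∀ y ∈ Lam i0 i1 n h l, (fun j => x j + s j * y j) ∈ S) (hb : ball x (30*h) ⊆ S) (hb' : ball x' (30*h) ⊆ S) :
    1/4 * kap d p (30*h) * kap d p (30 * h) ≤ Pr (fun _ : Site d => p) (Cn S x x') := by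
  have hm : (1:ℤ) ≤ m := by exact_mod_cast hc.m1
  have hmn : (2:ℤ) * m ≤ n := by exact_mod_cast hc.mn
  have h3 : (1:ℤ) ≤ 3^K := one_le_pow₀ (by norm_num)
  have hl0 : 0 ≤ l := le_trans ht htl
  have hh0 : 0 < h := by omega
  have hr : 0 ≤ 30 * h := by omega
  set φ : Site d → Site d := fun y => fun j => x j + s j * y j with hφ
  have hφi : Function.Injective φ := by
    intro y z hyz
    funext j
    have := congrFun hyz j
    simp only [hφ] at this
    rcases unit_cases (s j) with h | h <;> simp only [h] at this <;> omega
  have hφa : ∀ a b, adj a b → adj (φ a) (φ b) := by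
    intro a b hab
    rw [adj] at *
    rw [← hab]
    unfold d1
    refine Finset.sum_congr rfl fun j _ => ?_
    simp only [hφ]
    rcases unit_cases (s j) with h | h <;> simp only [h] <;> omega
  set u : ℤ × ℤ := (t / (20 * h), 0) with hu
  have ed1 := Int.mul_ediv_add_emod t (20 * h)
  have ed2 := Int.emod_nonneg t (show 20 * h ≠ 0 by omega)
  have ed3 := Int.emod_lt_of_pos t (show 0 < 20 * h by omega)
  have hu1 : 0 ≤ t / (20 * h) := Int.ediv_nonneg ht (by omega)
  have hu2 : t / (20*h) < 3^K := by
    by_contra hcon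
    push Not at hcon
    nlinarith
  have huB : u ∈ Blk K 0 := by
    rw [Blk_mem]; simp [hu]; omega
  set Y : Set (Site d) := {z | Tk i0 i1 n z ∧ ∃ f, Zc n h u f (pj i0 i1 z)} with hY
  have hst := start (Λ := Lam i0 i1 n h l) (Y := Y) h01 hc hh hε (Lam_finite (by omega) hl0) K ?_ huB (fun z f h1 h2 => ⟨h1, f, h2⟩)
  swap
  · intro v hv w hw y hy1 hy2
    rw [Blk_mem] at hv hw
    simp at hv hw
    unfold Bx at hy2
    simp only [pj] at hy2
    have k : ∀ a : ℤ, a < 3^K → 20 * h * a ≤ l := by intro a ha; subst hl; nlinarith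
    have k' : ∀ a : ℤ, 0 ≤ a → 0 ≤ 20 * h * a := by intro a ha; positivity
    have := k (max v.1 w.1) (by omega)
    have := k (max v.2 w.2) (by omega)
    have := k' (min v.1 w.1) (by omega)
    have := k' (min v.2 w.2) (by omega)
    refine ⟨by omega, by omega, fun j h1 h2 => ?_⟩
    have := hy1 j h1 h2
    exact this
  have hA : (Lam i0 i1 n h l \ ball (0 : Site d) (m:ℤ)).Finite := (Lam_finite (by omega) hl0).sdiff
  have hst2 := Pr_inc (r' := fun _ : Site d => p) hA hit_dep (hit_inc (R := adj) (Y := Y)) (fun x _ => hp)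
  have hmap := Pr_map (fun _ : Site d => p) φ hφi (hit_dep (R := adj) (Λ := Lam i0 i1 n h l) (Y := Y) (C := ball (0 : Site d) (m:ℤ))) hA
  set E1 : Set (Site d → Bool) := {ω | (fun k => ω (φ k)) ∈ hit adj (Lam i0 i1 n h l) Y (ball (0 : Site d) (m:ℤ))} with hE1
  have dE1 : Dep E1 S := by
    intro ω ω' hw hω
    refine hit_dep _ _ ?_ hω
    intro y hy
    exact hw _ (hS y hy.1)
  have iE1 : Inc E1 := by
    intro ω ω' hw hω
    exact hit_inc _ _ (fun y hy => hw _ hy) hω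
  have dF : ∀ c : Site d, ball c (30*h) ⊆ S → Dep {ω : Site d → Bool | ∀ z ∈ ball c (30*h), ω z = true} S := fun c hcS => (Dep.allTrue _).mono hcS
  have iF : ∀ c : Site d, Inc {ω : Site d → Bool | ∀ z ∈ ball c (30*h), ω z = true} := by
    intro c ω ω' hw hω z hz
    exact hw z (hω z hz)
  have H1 := Harris (r := fun _ => p) hSf dE1 (dF x hb) iE1 (iF x)
  have i12 : Inc (E1 ∩ {ω : Site d → Bool | ∀ z ∈ ball x (30*h), ω z = true}) := fun ω ω' hw hω => ⟨iE1 _ _ hw hω.1, iF x _ _ hw hω.2⟩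
  have H2 := Harris (r := fun _ => p) hSf (dE1.inter (dF x hb) |>.mono (by simp)) (dF x' hb') i12 (iF x')
  rw [Pr_fill hp0 hp1 x hr] at H1
  rw [Pr_fill hp0 hp1 x' hr] at H2
  have hk : 0 ≤ kap d p (30*h) := pow_nonneg hp0 _
  have hE1p : 1/4 ≤ Pr (fun _ => p) E1 := by rw [hmap]; exact hst.trans hst2
  refine le_trans (mul_le_mul_of_nonneg_right ((mul_le_mul_of_nonneg_right hE1p hk).trans H1) hk) (H2.trans (Pr_mono _ ?_))
  rintro ω ⟨⟨h1, h2⟩, h3⟩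
  obtain ⟨z, hz, hzY⟩ := h1
  obtain ⟨a, ha, haz⟩ := Clus_exists hz
  have hza : φ z ∈ Clus adj (op ω ∩ S) {φ a} := by
    refine Clus_map φ hφa ?_ ?_ haz
    · rintro y ⟨hy1, hy2⟩
      exact ⟨hy1, hS y hy2⟩
    · rintro y rfl; rfl
  have hxa : φ a ∈ ball x (30*h) := by
    rw [mem_ball hr]
    intro j
    have := (mem_ball (Int.natCast_nonneg m)).1 ha j
    simp only [hφ, Pi.zero_apply] at this ⊢
    rcases unit_cases (s j) with h | h <;> simp only [h] <;> omega
  have hzx' : φ z ∈ ball x' (30*h) := by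
    rw [mem_ball hr]
    obtain ⟨hz1, f, hz2⟩ := hzY
    have hz3 : (20 * h * (t/(20*h)) - 2 * h ≤ z i0 ∧ z i0 ≤ 20 * h * (t/(20*h)) + 2 * h) ∧ (- 2 * h ≤ z i1 ∧ z i1 ≤ 2 * h) := by
      unfold Zc at hz2
      rcases f with ⟨_|_, _|_⟩ <;> simp only [fd, lt, cc, pj, hu] at hz2 <;> omega
    intro j
    subst hx'
    by_cases e0 : j = i0
    · subst e0
      simp only [hφ, Function.update_self]
      rcases unit_cases (s j) with h | h <;> simp only [h] <;> omega
    · rw [Function.update_of_ne e0]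
      by_cases e1 : j = i1
      · subst e1
        simp only [hφ]
        rcases unit_cases (s j) with h | h <;> simp only [h] <;> omega
      · have := hz1 j e0 e1
        simp only [hφ]
        rcases unit_cases (s j) with h | h <;> simp only [h] <;> omega
  have f1 := fill_sub hb (self_mem_ball hr) hxa h2
  have f2 := fill_sub hb' hzx' (self_mem_ball hr) h3
  exact Cn_trans f1 (Cn_trans ⟨Cn_mem f1, hza⟩ f2)
end P7a

section P7b
variable {d : ℕ}

/-- slab of thickness L in direction i inside B(M) -/
def slab (i : Fin d) (M : ℕ) (a L : ℤ) : Set (Site d) :=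
  {x | (a < x i ∧ x i ≤ a + L) ∧ ∀ j, -(M:ℤ) ≤ x j ∧ x j ≤ M}

lemma slab_finite (i : Fin d) (M : ℕ) (a L : ℤ) : (slab i M a L).Finite := by
  refine (ball_finite (0 : Site d) M).subset fun x hx => ?_
  rw [mem_ball (by omega)]
  intro j
  have := hx.2 j
  simpa using this

def bulk (i : Fin d) (M : ℕ) (a ρ : ℤ) (x : Site d) : Prop := x i = a + 1 + ρ ∧ ∀ j, j ≠ i → -(M - ρ) ≤ x j ∧ x j ≤ M - ρ

lemma bulk_ball {i : Fin d} {M : ℕ} {a ρ : ℤ} (hρ : 0 ≤ ρ) (ha : -(M:ℤ) - 1 ≤ a) (ha' : a + (2 * ρ + 1) ≤ M) {x : Site d} (hx : bulk i M a ρ x) :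
    ball x ρ ⊆ slab i M a (2 * ρ + 1) := by
  intro y hy
  rw [mem_ball hρ] at hy
  have hi := hy i
  have := hx.1
  refine ⟨by omega, fun j => ?_⟩
  by_cases hj : j = i
  · subst hj; omega
  · have := hy j
    have := hx.2 j hj
    omega

lemma exists_sign (z : ℤ) : ∃ σ : ℤˣ, 0 ≤ (σ : ℤ) * z := by
  rcases le_total 0 z with h | h
  · exact ⟨1, by simpa⟩
  · exact ⟨-1, by simpa⟩

variable {i : Fin d} {m n M : ℕ} {h a l : ℤ} {p0 δ ε p : ℝ}

/-- constant of one move -/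
noncomputable def c1 (d : ℕ) (p : ℝ) (h : ℤ) : ℝ := 1/4 * kap d p (30*h) * kap d p (30 * h)

lemma kap_le {r : ℤ} (hp0 : 0 ≤ p) (hp1 : p ≤ 1) : kap d p r ≤ 1 := pow_le_one₀ hp0 hp1

lemma c1_le (hp0 : 0 ≤ p) (hp1 : p ≤ 1) : c1 d p h ≤ 1 := by
  have h1 := kap_le (d := d) (r := 30*h) hp0 hp1
  have h2 : 0 ≤ kap d p (30*h) := pow_nonneg hp0 _
  unfold c1
  nlinarith
lemma c1_nonneg (hp0 : 0 ≤ p) : 0 ≤ c1 d p h := by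
  have h2 : 0 ≤ kap d p (30*h) := pow_nonneg hp0 _
  unfold c1; positivity

structure Setup (d m n : ℕ) (h : ℤ) (p0 δ ε p : ℝ) : Prop where
  hd : 3 ≤ d
  hc : GMc d p0 δ ε m n
  hh : h = n + m + 1
  he : 2400 * ε ≤ 1
  hp0 : 0 ≤ p
  hp1 : p ≤ 1
  hp : 1 - (1 - p0) * (1 - δ)^700 ≤ p

lemma exists_third (hd : 3 ≤ d) (i j : Fin d) : ∃ k, k ≠ i ∧ k ≠ j := by
  have : ({i, j} : Finset (Fin d)).card < (Finset.univ : Finset (Fin d)).card := by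
    rw [Finset.card_univ, Fintype.card_fin]
    exact lt_of_le_of_lt (Finset.card_le_two) (by omega)
  obtain ⟨k, -, hk⟩ := Finset.exists_mem_notMem_of_card_lt_card this
  simp at hk
  exact ⟨k, hk.1, hk.2⟩

lemma move1 (st : Setup d m n h p0 δ ε p) (K : ℕ) (hl : l = 20 * h * (3^K - 1)) (hlM : l ≤ M - 30 * h) 
    (ha : -(M:ℤ) - 1 ≤ a) (ha' : a + (2 * (30*h) + 1) ≤ M) {j : Fin d} (hj : j ≠ i) {x : Site d} (hx : bulk i M a (30*h) x)
    {σ : ℤˣ} {t : ℤ} (ht : 0 ≤ t) (htl : t ≤ l) (hσ : t ≤ σ * x j) :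
    bulk i M a (30*h) (Function.update x j (x j + (-σ : ℤˣ) * t)) ∧ 
    c1 d p h ≤ Pr (fun _ : Site d => p) (Cn (slab i M a (2 * (30*h) + 1)) x (Function.update x j (x j + (-σ : ℤˣ) * t))) := by
  obtain ⟨i1, h1i, h1j⟩ := exists_third st.hd i j
  obtain ⟨τ, hτ⟩ := exists_sign (x i1)
  have hm : (1:ℤ) ≤ m := by exact_mod_cast st.hc.m1
  have hmn : (2:ℤ) * m ≤ n := by exact_mod_cast st.hc.mn
  have hh := st.hh
  have hb : bulk i M a (30*h) (Function.update x j (x j + (-σ : ℤˣ) * t)) := by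
    refine ⟨by rw [Function.update_of_ne hj.symm]; exact hx.1, fun k hk => ?_⟩
    by_cases hkj : k = j
    · subst hkj
      have := hx.2 k hk
      rw [Function.update_self]
      rcases unit_cases σ with h | h <;> simp only [h, Units.val_neg] at hσ ⊢ <;> omega
    · rw [Function.update_of_ne hkj]
      exact hx.2 k hk
  refine ⟨hb, ?_⟩
  refine move (i0 := j) (i1 := i1) h1j.symm st.hc st.hh st.he st.hp0 st.hp1 st.hp K hl ht htl
    (fun k => if k = j then -σ else if k = i1 then -τ else 1) (by simp) (slab_finite _ _ _ _) ?_ 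
    (bulk_ball (by omega) ha ha' hx) (bulk_ball (by omega) ha ha' hb)
  intro y hy
  obtain ⟨y1, y2, y3⟩ := hy
  have hxi := hx.1
  have yi := y3 i hj.symm h1i.symm
  refine ⟨?_, ?_⟩
  · simp only [if_neg hj.symm, if_neg h1i.symm, Units.val_one]
    omega
  · intro k
    by_cases hkj : k = j
    · subst hkj
      have := hx.2 k hj
      simp only [if_true]
      rcases unit_cases σ with h | h <;> simp only [h, Units.val_neg] at hσ ⊢ <;> omega
    by_cases hk1 : k = i1
    · subst hk1
      have := hx.2 k h1i
      simp only [if_neg h1j, if_true]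
      rcases unit_cases τ with h | h <;> simp only [h, Units.val_neg] at hτ ⊢ <;> omega
    · have := y3 k hkj hk1
      simp only [if_neg hkj, if_neg hk1, Units.val_one]
      by_cases hki : k = i
      · subst hki; omega
      · have := hx.2 k hki
        omega

lemma zero1 (st : Setup d m n h p0 δ ε p) (K : ℕ) (hl : l = 20 * h * (3^K - 1)) (hl0 : 0 ≤ l) (hlM : l ≤ M - 30 * h) 
    (ha : -(M:ℤ) - 1 ≤ a) (ha' : a + (2 * (30*h) + 1) ≤ M) {j : Fin d} (hj : j ≠ i) (q : ℕ) : ∀ {x : Site d} (hx : bulk i M a (30*h) x)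
    (σ : ℤˣ) (hσ : 0 ≤ σ * x j) (hσ' : σ * x j ≤ (q+1:ℕ) * l),
    c1 d p h ^ (q + 1) ≤ Pr (fun _ : Site d => p) (Cn (slab i M a (2 * (30*h) + 1)) x (Function.update x j 0)) := by
  induction q with
  | zero =>
    intro x hx σ h1 h2
    have := (move1 st K hl hlM ha ha' hj hx (σ := σ) h1 (by simpa using h2) le_rfl).2
    have e : x j + ((-σ : ℤˣ):ℤ) * (σ * x j) = 0 := by
      rcases unit_cases σ with h | h <;> simp only [h, Units.val_neg] <;> omega
    rw [e] at this
    simpa using this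
  | succ q ih =>
    intro x hx σ h1 h2
    have c0 := c1_nonneg (d := d) (h := h) st.hp0
    have c1' := c1_le (d := d) (h := h) st.hp0 st.hp1
    by_cases hq : σ * x j ≤ (q+1:ℕ) * l
    · refine le_trans ?_ (ih hx σ h1 hq)
      exact pow_le_pow_of_le_one c0 c1' (by omega)
    · push Not at hq
      have hql : l ≤ σ * x j := by
        push_cast at hq
        nlinarith
      have hm := move1 st K hl hlM ha ha' hj hx (σ := σ) hl0 le_rfl hql
      have e : (σ : ℤ) * (x j + ((-σ : ℤˣ):ℤ) * l) = σ * x j - l := by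
        rcases unit_cases σ with h | h <;> simp only [h, Units.val_neg] <;> ring
      have := ih hm.1 σ (by rw [Function.update_self, e]; omega) (by
        rw [Function.update_self, e]
        push_cast at h2 ⊢
        linarith)
      have h3 := Pr_Cn_trans (slab_finite _ _ _ _) (pow_nonneg c0 _) hm.2 this
      rw [Function.update_idem] at h3
      rw [pow_succ']
      exact h3

lemma exists_K {h N : ℤ} (hh : 0 < h) (hN : 40 * h ≤ N) : ∃ K : ℕ, 0 ≤ 20 * h * ((3:ℤ)^K - 1) ∧ 20 * h * (3^K - 1) ≤ N ∧ N ≤ 4 * (20 * h * (3^K - 1)) := by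
  classical
  have hex : ∃ k : ℕ, N < 20 * h * ((3:ℤ)^k - 1) := by
    refine ⟨N.toNat + 1, ?_⟩
    have : (N.toNat + 1 : ℕ) < 3 ^ (N.toNat + 1) := Nat.lt_pow_self (by norm_num)
    have : ((N.toNat + 1 : ℕ) : ℤ) < 3 ^ (N.toNat + 1) := by exact_mod_cast this
    push_cast at this
    have h2 : (N.toNat : ℤ) = N := Int.toNat_of_nonneg (by omega)
    rw [h2] at this
    nlinarith
  have hs := Nat.find_spec hex
  have h2 : 2 ≤ Nat.find hex := by
    by_contra hc
    have : Nat.find hex = 0 ∨ Nat.find hex = 1 := by omega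
    rcases this with h | h <;> rw [h] at hs <;> norm_num at hs <;> omega
  obtain ⟨K, hK⟩ : ∃ K, Nat.find hex = K + 2 := ⟨_, (Nat.sub_add_cancel h2).symm⟩
  have hmin := Nat.find_min hex (m := K + 1) (by omega)
  rw [hK] at hs
  push Not at hmin
  have h3 : (1:ℤ) ≤ 3^K := one_le_pow₀ (by norm_num)
  refine ⟨K+1, ?_, hmin, ?_⟩
  · rw [pow_succ]
    have : 0 ≤ (3:ℤ)^K * 3 - 1 := by omega
    positivity
  · rw [pow_succ, pow_succ] at hs
    rw [pow_succ]
    nlinarith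

noncomputable def c3 (d : ℕ) (p : ℝ) (h : ℤ) : ℝ := (kap d p (30*h) * (kap d p (30 * h) * (c1 d p h ^ 4)^(d-1)))^2

lemma c3_pos (hp : 0 < p) : 0 < c3 d p h := by
  have := kap_pos (d := d) hp (30 * h)
  unfold c3 c1
  positivity

lemma slab_conn (st : Setup d m n h p0 δ ε p) (hM : 70 * h ≤ M) (ha : -(M:ℤ) - 1 ≤ a) (ha' : a + (2 * (30*h) + 1) ≤ M)
    {x y : Site d} (hx : x ∈ slab i M a (2 * (30*h) + 1)) (hy : y ∈ slab i M a (2 * (30*h) + 1)) :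
    c3 d p h ≤ Pr (fun _ : Site d => p) (Cn (slab i M a (2 * (30*h) + 1)) x y) := by
  have hm : (1:ℤ) ≤ m := by exact_mod_cast st.hc.m1
  have hmn : (2:ℤ) * m ≤ n := by exact_mod_cast st.hc.mn
  have hh := st.hh
  have hfin := slab_finite i M a (2 * (30*h) + 1)
  obtain ⟨K, hl0, hlM, hl4⟩ := exists_K (h := h) (N := M - 30 * h) (by omega) (by omega)
  have hk0 : 0 ≤ kap d p (30*h) := pow_nonneg st.hp0 _
  have c0 := c1_nonneg (d := d) (h := h) st.hp0
  have all : ∀ x : Site d, bulk i M a (30*h) x → ∀ s : Finset (Fin d), i ∉ s →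
      kap d p (30*h) * (c1 d p h ^ 4)^s.card ≤ Pr (fun _ : Site d => p) (Cn (slab i M a (2 * (30*h) + 1)) x (fun j => if j ∈ s then 0 else x j)) := by
    intro x hx s
    induction s using Finset.induction_on with
    | empty =>
      intro _
      simp only [Finset.notMem_empty, if_false, Finset.card_empty, pow_zero, mul_one]
      rw [← Pr_fill st.hp0 st.hp1 x (by omega : 0 ≤ 30 * h)]
      refine Pr_mono _ fun ω hω => ?_
      exact fill_sub (bulk_ball (by omega) ha ha' hx) (self_mem_ball (by omega)) (self_mem_ball (by omega)) hω
    | insert j s hjs ih =>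
      intro his
      simp only [Finset.mem_insert, not_or] at his
      have h1 := ih his.2
      have hb : bulk i M a (30*h) (fun j => if j ∈ s then 0 else x j) := by
        refine ⟨by simp only [if_neg his.2]; exact hx.1, fun k hk => ?_⟩
        have := hx.2 k hk
        by_cases hks : k ∈ s
        · simp only [if_pos hks]; omega
        · simp only [if_neg hks]; exact this
      obtain ⟨σ, hσ⟩ := exists_sign (x j)
      have h2 := zero1 st K rfl hl0 hlM ha ha' (Ne.symm his.1) 3 hb σ (by simp only [if_neg hjs]; exact hσ) (by
        have := hx.2 j (Ne.symm his.1)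
        simp only [if_neg hjs]
        push_cast
        rcases unit_cases σ with h | h <;> simp only [h] <;> omega)
      have h3 := Pr_Cn_trans hfin (pow_nonneg c0 _) h1 h2
      rw [Finset.card_insert_of_notMem hjs, pow_succ, ← mul_assoc]
      convert h3 using 3
      funext k
      by_cases hk : k = j
      · subst hk; simp
      · rw [Function.update_of_ne hk]
        simp [hk]
  have key : ∀ x ∈ slab i M a (2 * (30*h) + 1), kap d p (30*h) * (kap d p (30 * h) * (c1 d p h ^ 4)^(d-1)) ≤
      Pr (fun _ : Site d => p) (Cn (slab i M a (2 * (30*h) + 1)) x (fun j => if j = i then a + 1 + 30 * h else 0)) := by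
    intro x hx
    set x' : Site d := fun j => if j = i then a + 1 + 30 * h else max (-(M - 30 * h)) (min (M - 30*h) (x j)) with hx'
    have hb : bulk i M a (30*h) x' := by
      refine ⟨by simp [hx'], fun j hj => ?_⟩
      simp only [hx', if_neg hj]; omega
    have hxb : x ∈ ball x' (30*h) := by
      rw [mem_ball (by omega)]
      intro j
      by_cases hj : j = i
      · have := hx.1
        subst hj
        simp only [hx', if_true]; omega
      · have := hx.2 j
        simp only [hx', if_neg hj]; omega
    have h1 : kap d p (30*h) ≤ Pr (fun _ : Site d => p) (Cn (slab i M a (2 * (30*h) + 1)) x x') := by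
      rw [← Pr_fill st.hp0 st.hp1 x' (by omega : 0 ≤ 30 * h)]
      refine Pr_mono _ fun ω hω => ?_
      exact fill_sub (bulk_ball (by omega) ha ha' hb) hxb (self_mem_ball (by omega)) hω
    have h2 := all x' hb (Finset.univ.erase i) (by simp)
    have h3 := Pr_Cn_trans hfin (mul_nonneg hk0 (pow_nonneg (pow_nonneg c0 _) _)) h1 h2
    rw [Finset.card_erase_of_mem (Finset.mem_univ _), Finset.card_univ, Fintype.card_fin] at h3
    convert h3 using 3
    funext j
    by_cases hj : j = i
    · simp [hj, hx']
    · simp [hj]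
  have kx := key x hx
  have ky := key y hy
  rw [Pr_Cn_symm] at ky
  rw [c3, sq]
  exact Pr_Cn_trans hfin (mul_nonneg hk0 (mul_nonneg hk0 (pow_nonneg (pow_nonneg c0 _) _))) kx ky
end P7b

section P8a
variable {d : ℕ}

/-- part of B(M) below level a -/
def low (i : Fin d) (M : ℕ) (a : ℤ) : Set (Site d) := {x | x i ≤ a} ∩ ball 0 (M:ℤ)

lemma mem_B {M : ℕ} {x : Site d} : x ∈ ball (0 : Site d) (M:ℤ) ↔ ∀ j, -(M:ℤ) ≤ x j ∧ x j ≤ M := by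
  rw [mem_ball (Int.natCast_nonneg M)]
  simp

lemma slab_sub {i : Fin d} {M : ℕ} {a L : ℤ} : slab i M a L ⊆ ball (0 : Site d) (M:ℤ) := fun x hx => mem_B.2 hx.2

lemma low_finite (i : Fin d) (M : ℕ) (a : ℤ) : (low i M a).Finite := (ball_finite _ _).subset Set.inter_subset_right

/-- bad event of one slab -/
def Nk (S : Set (Site d)) (X : (Site d → Bool) → Site d × Site d) : Set (Site d → Bool) :=
  {ω | ((X ω).1 ∈ S ∧ (X ω).2 ∈ S) ∧ ω ∉ Cn S (X ω).1 (X ω).2}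

lemma Nk_dep {S D : Set (Site d)} {X : (Site d → Bool) → Site d × Site d} (hX : ∀ z, Dep {ω | X ω = z} D) : Dep (Nk S X) (D ∪ S) := by
  intro ω ω' hw hω
  have e : X ω' = X ω := hX (X ω) ω ω' (fun x hx => hw x (Or.inl hx)) rfl
  refine ⟨by rw [e]; exact hω.1, fun hc => hω.2 ?_⟩
  rw [e] at hc
  exact Cn_dep _ _ (fun x hx => (hw x (Or.inr hx)).symm) hc

lemma iter {r : Site d → ℝ} {i : Fin d} {M : ℕ} {a0 L : ℤ} (hL : 0 ≤ L) {c : ℝ} (hc1 : c ≤ 1) (s : Finset (Site d × Site d))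
    (X : ℕ → (Site d → Bool) → Site d × Site d) (hX : ∀ k z, Dep {ω | X k ω = z} (low i M (a0 + k * L)))
    (K : ℕ) (hXs : ∀ k < K, ∀ ω, X k ω ∈ s) (hc : ∀ k < K, ∀ x ∈ slab i M (a0 + k * L) L, ∀ y ∈ slab i M (a0 + k * L) L, c ≤ Pr r (Cn (slab i M (a0 + k * L) L) x y)) :
    Pr r {ω | ∀ k < K, ω ∈ Nk (slab i M (a0 + k * L) L) (X k)} ≤ (1 - c)^K ∧
      Dep {ω | ∀ k < K, ω ∈ Nk (slab i M (a0 + k * L) L) (X k)} (low i M (a0 + K * L)) := by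
  classical
  induction K with
  | zero =>
    refine ⟨by simpa using Pr_le_one _ _, ?_⟩
    intro ω ω' _ _ k hk
    omega
  | succ K ih =>
    obtain ⟨ih1, ih2⟩ := ih (fun k hk => hXs k (by omega)) (fun k hk => hc k (by omega))
    have e : {ω | ∀ k < K + 1, ω ∈ Nk (slab i M (a0 + k * L) L) (X k)} = 
      {ω | ∀ k < K, ω ∈ Nk (slab i M (a0 + k * L) L) (X k)} ∩ Nk (slab i M (a0 + K * L) L) (X K) := by
      ext ω
      constructor
      · intro h
        exact ⟨fun k hk => h k (by omega), h K (by omega)⟩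
      · rintro ⟨h1, h2⟩ k hk
        rcases Nat.lt_succ_iff_lt_or_eq.1 hk with h | rfl
        · exact h1 k h
        · exact h2
    rw [e]
    have sub1 : low i M (a0 + K * L) ⊆ low i M (a0 + (K+1:ℕ) * L) := by
      rintro x ⟨h1, h2⟩
      refine ⟨?_, h2⟩
      have h1' : x i ≤ a0 + K * L := h1
      show x i ≤ a0 + (K+1:ℕ) * L
      push_cast; nlinarith
    have sub2 : slab i M (a0 + K * L) L ⊆ low i M (a0 + (K+1:ℕ) * L) := by
      intro x hx
      refine ⟨?_, slab_sub hx⟩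
      have h1' := hx.1.2
      show x i ≤ a0 + (K+1:ℕ) * L
      push_cast; nlinarith
    refine ⟨?_, (ih2.mono sub1).inter ((Nk_dep (hX K)).mono (Set.union_subset sub1 sub2)) |>.mono (by simp)⟩
    set Past : Set (Site d → Bool) := {ω | ∀ k < K, ω ∈ Nk (slab i M (a0 + k * L) L) (X k)} with hP
    set S := slab i M (a0 + K * L) L with hS
    have hdis : Disjoint (low i M (a0 + K * L)) S := by
      rw [Set.disjoint_left]
      rintro x ⟨h1, -⟩ h2
      have h1' : x i ≤ a0 + K * L := h1
      have := h2.1.1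
      omega
    have key := explore_le (Finset.univ ×ˢ s : Finset (Prop × (Site d × Site d))) r (low_finite i M (a0 + K * L))
      (fun ω => (ω ∈ Past, X K ω)) (fun _ => low i M (a0 + K * L)) ?_ (fun _ _ => subset_rfl) (fun ω => Finset.mem_product.2 ⟨Finset.mem_univ _, hXs K (by omega) ω⟩)
      (fun z => z.1 ∧ z.2.1 ∈ S ∧ z.2.2 ∈ S) (fun z => (Cn S z.2.1 z.2.2)ᶜ) (fun _ => S) (fun z _ _ => Cn_dep.compl)
      (fun _ _ _ => slab_finite _ _ _ _) (fun _ _ _ => hdis) (c := 1 - c) ?_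
    · have e2 : Past ∩ Nk S (X K) = {ω | (ω ∈ Past ∧ (X K ω).1 ∈ S ∧ (X K ω).2 ∈ S) ∧ ω ∈ (Cn S (X K ω).1 (X K ω).2)ᶜ} := by
        ext ω
        simp only [Nk, Set.mem_inter_iff, Set.mem_ofPred_eq, Set.mem_compl_iff]
        tauto
      rw [e2]
      refine key.trans ?_
      rw [pow_succ]
      refine mul_le_mul_of_nonneg_right (le_trans (Pr_mono _ ?_) ih1) (by linarith)
      intro ω hω
      exact hω.1
    · rintro ⟨P, z⟩ _ ω ω' hw hω
      have hω' : (ω ∈ Past, X K ω) = (P, z) := hω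
      rw [Prod.mk.injEq] at hω'
      have h1 : (ω ∈ Past) = (ω' ∈ Past) := propext (ih2.iff hw)
      have h2 : X K ω' = z := hX K z ω ω' hw hω'.2
      show (ω' ∈ Past, X K ω') = (P, z)
      rw [← h1, h2, hω'.1]
    · rintro ⟨P, z⟩ _ ⟨-, h1, h2⟩
      show Pr r (Cn S z.1 z.2)ᶜ ≤ 1 - c
      rw [Pr_compl r Cn_dep (slab_finite _ _ _ _)]
      have := hc K (by omega) z.1 h1 z.2 h2
      linarith

open Classical in
/-- selector: a site right above the level a next to T -/
noncomputable def nx (i : Fin d) (M : ℕ) (a : ℤ) (u : Site d) (T : Set (Site d)) : Site d :=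
  if h : (T ∩ {x | x i = a ∧ x ∈ ball 0 (M:ℤ)}).Nonempty then Function.update h.some i (a + 1) else u

lemma nx_ball {i : Fin d} {M : ℕ} {a : ℤ} {u : Site d} {T : Set (Site d)} (hu : u ∈ ball 0 (M:ℤ)) (h1 : -(M:ℤ) ≤ a + 1) (h2 : a + 1 ≤ M) :
    nx i M a u T ∈ ball 0 (M:ℤ) := by
  unfold nx
  split_ifs with h
  · have := h.some_mem.2.2
    rw [mem_B] at *
    intro j
    by_cases hj : j = i
    · subst hj; rw [Function.update_self]; omega
    · rw [Function.update_of_ne hj]; exact this j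
  · exact hu

lemma nx_slab {i : Fin d} {M : ℕ} {a L : ℤ} {u : Site d} {T : Set (Site d)} (h : (T ∩ {x | x i = a ∧ x ∈ ball 0 (M:ℤ)}).Nonempty) (h1 : -(M:ℤ) ≤ a + 1) (h2 : a + 1 ≤ M)
    (hu : u ∈ ball 0 (M:ℤ)) (hL : 1 ≤ L) :
    nx i M a u T ∈ slab i M a L := by
  refine ⟨?_, mem_B.1 (nx_ball hu h1 h2)⟩
  unfold nx
  rw [dif_pos h, Function.update_self]
  omega

lemma nx_conn {i : Fin d} {M : ℕ} {a L : ℤ} {u : Site d} {ω : Site d → Bool} (hui : u i ≤ a)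
    (hs : nx i M a u (Clus adj (op ω ∩ low i M a) {u}) ∈ slab i M a L) (ho : nx i M a u (Clus adj (op ω ∩ low i M a) {u}) ∈ op ω) :
    nx i M a u (Clus adj (op ω ∩ low i M a) {u}) ∈ Clus adj (op ω ∩ ball 0 (M:ℤ)) {u} := by
  have hs' := slab_sub hs
  unfold nx at *
  split_ifs at * with h
  · have h1 := h.some_mem
    refine Clus_step (x := h.some) (Clus_mono (Set.inter_subset_inter_right _ Set.inter_subset_right) subset_rfl h1.1) ?_ ⟨ho, hs'⟩
    have := adj_update h.some i 1 rfl
    rwa [h1.2.1] at this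
  · have := hs.1.1
    omega

lemma reach {i : Fin d} {M : ℕ} {a : ℤ} {u v : Site d} {ω : Site d → Bool} (hu : u ∈ ball 0 (M:ℤ)) (hui : u i ≤ a) (hv : a < v i)
    (h : v ∈ Clus adj (op ω ∩ ball 0 (M:ℤ)) {u}) : (Clus adj (op ω ∩ low i M a) {u} ∩ {x | x i = a ∧ x ∈ ball 0 (M:ℤ)}).Nonempty := by
  obtain ⟨x, y, h1, h2, h3, h4, h5⟩ := Clus_exit {x | x i ≤ a} (by rintro x rfl; exact hui) h (by show ¬ (v i ≤ a); omega)
  have h2' : x i ≤ a := h2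
  have h5' : ¬ (y i ≤ a) := h5
  have hx : x i = a := by
    have := adj_coord h3 i
    omega
  refine ⟨x, ?_, hx, ?_⟩
  · refine Clus_mono ?_ subset_rfl h1
    rintro z ⟨⟨z1, z2⟩, z3⟩
    exact ⟨z1, z3, z2⟩
  · rcases Clus_sub h1 with h | h
    · obtain rfl : x = u := h
      exact hu
    · exact h.1.2

end P8a

section P8b
variable {d m n : ℕ} {h : ℤ} {p0 δ ε p : ℝ}

lemma bad_le (st : Setup d m n h p0 δ ε p) {i : Fin d} {M K : ℕ} {a0 L : ℤ} (hL : L = 2 * (30*h) + 1) (hM : 70 * h ≤ M)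
    (ha : -(M:ℤ) - 1 ≤ a0) (ha' : a0 + K * L ≤ M) (hc1 : c3 d p h ≤ 1)
    (X : ℕ → (Site d → Bool) → Site d × Site d) (hX : ∀ k z, Dep {ω | X k ω = z} (low i M (a0 + k * L)))
    (hXs : ∀ k < K, ∀ ω, (X k ω).1 ∈ ball 0 (M:ℤ) ∧ (X k ω).2 ∈ ball 0 (M:ℤ)) :
    Pr (fun _ : Site d => p) {ω | ∀ k < K, ω ∈ Nk (slab i M (a0 + k * L) L) (X k)} ≤ (1 - c3 d p h)^K := by
  have hL0 : 0 ≤ L := by rw [hL]; have := st.hh; omega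
  refine (iter hL0 hc1 ((ball_finite 0 (M:ℤ)).toFinset ×ˢ (ball_finite 0 (M:ℤ)).toFinset) X hX K ?_ ?_).1
  · intro k hk ω
    simpa using hXs k hk ω
  · intro k hk x hx y hy
    have h1 : (k:ℤ) + 1 ≤ K := by exact_mod_cast hk
    subst hL
    refine slab_conn st hM ?_ ?_ hx hy
    · have : 0 ≤ (k:ℤ) * (2 * (30*h) + 1) := mul_nonneg (by omega) hL0
      omega
    · nlinarith

/-- the explored site above level a -/
noncomputable def Fx (i : Fin d) (M : ℕ) (a : ℤ) (u : Site d) (ω : Site d → Bool) : Site d :=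
  nx i M a u (Clus adj (op ω ∩ low i M a) {u})

lemma Fx_dep {i : Fin d} {M : ℕ} {a : ℤ} {u : Site d} (Q : Site d → Prop) : Dep {ω | Q (Fx i M a u ω)} (low i M a) :=
  Dep_Clus (fun S => Q (nx i M a u S))

lemma Fx_conn {i : Fin d} {M : ℕ} {a L : ℤ} {u v : Site d} {ω : Site d → Bool} (hL : 1 ≤ L) (ha : -(M:ℤ) ≤ a) (ha' : a + L ≤ M) (hui : u i ≤ a)
    (hv : a < v i) (huv : ω ∈ Cn (ball 0 (M:ℤ)) u v) :
    Fx i M a u ω ∈ slab i M a L ∧ (Fx i M a u ω ∈ op ω → ω ∈ Cn (ball 0 (M:ℤ)) u (Fx i M a u ω)) := by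
  have hu := huv.1.2
  have hs : Fx i M a u ω ∈ slab i M a L := nx_slab (reach hu hui hv huv.2) (by omega) (by omega) hu hL
  exact ⟨hs, fun ho => ⟨huv.1, nx_conn hui hs ho⟩⟩

def BA (i j : Fin d) (M K : ℕ) (L t : ℤ) (u : Site d) : Set (Site d → Bool) :=
  {ω | u i ≤ 0 ∧ ω ∈ {ω | ∀ k < K, ω ∈ Nk (slab i M (u i + (k:ℕ) * L) L) (fun ω => (Fx i M (u i + (k:ℕ) * L) u ω, Function.update (Fx i M (u i + (k:ℕ) * L) u ω) j t))}}

lemma kL {K k : ℕ} {L M : ℤ} (hL : 1 ≤ L) (hK : K * L ≤ M) (hk : k < K) : 0 ≤ (k:ℤ) * L ∧ k * L + L ≤ M := by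
  have h1 : (k:ℤ) + 1 ≤ K := by exact_mod_cast hk
  exact ⟨mul_nonneg (by omega) (by omega), by nlinarith⟩

lemma upd_ball {M : ℕ} {x : Site d} {j : Fin d} {t : ℤ} (ht : -(M:ℤ) ≤ t ∧ t ≤ M) (hx : x ∈ ball 0 (M:ℤ)) : Function.update x j t ∈ ball 0 (M:ℤ) := by
  rw [mem_B] at *
  intro l
  by_cases hl : l = j
  · subst hl; rw [Function.update_self]; exact ht
  · rw [Function.update_of_ne hl]; exact hx l

lemma BA_le (st : Setup d m n h p0 δ ε p) {i j : Fin d} {M K : ℕ} {L t : ℤ} (hL : L = 2 * (30*h) + 1) (hM : 70 * h ≤ M)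
    (hK : K * L ≤ M) (hc1 : c3 d p h ≤ 1) (ht : -(M:ℤ) ≤ t ∧ t ≤ M) {u : Site d} (hu : u ∈ ball 0 (M:ℤ)) :
    Pr (fun _ : Site d => p) (BA i j M K L t u) ≤ (1 - c3 d p h)^K := by
  have hL1 : 1 ≤ L := by rw [hL]; have := st.hh; omega
  have hu' := mem_B.1 hu i
  by_cases h0 : u i ≤ 0
  · refine (Pr_mono _ (fun ω hω => hω.2)).trans (bad_le st hL hM (by omega) (by omega) hc1 _ ?_ ?_)
    · intro k z
      exact Fx_dep (fun F => (F, Function.update F j t) = z)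
    · intro k hk ω
      have := kL hL1 hK hk
      have hb : Fx i M (u i + k * L) u ω ∈ ball 0 (M:ℤ) := nx_ball hu (by omega) (by omega)
      exact ⟨hb, upd_ball ht hb⟩
  · have : BA i j M K L t u = ∅ := by
      ext ω
      simp only [Set.mem_empty_iff_false, iff_false]
      exact fun hω => h0 hω.1
    rw [this, Pr_empty]
    exact pow_nonneg (by linarith) _

lemma BA_touch {i j : Fin d} (hij : j ≠ i) {M K : ℕ} {L t : ℤ} (hL : 1 ≤ L) (hK : K * L ≤ M) (ht : -(M:ℤ) ≤ t ∧ t ≤ M) {u v : Site d} {ω : Site d → Bool}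
    (hω : ω ∉ BA i j M K L t u) (huv : ω ∈ Cn (ball 0 (M:ℤ)) u v) (he : u i + M ≤ v i) :
    ∃ y, ω ∈ Cn (ball 0 (M:ℤ)) u y ∧ y j = t := by
  have hu := mem_B.1 huv.1.2 i
  have hv := mem_B.1 (Cn_mem huv).2 i
  by_contra hcon
  push Not at hcon
  refine hω ⟨by omega, fun k hk => ?_⟩
  have := kL hL hK hk
  obtain ⟨h1, h2⟩ := Fx_conn (i := i) (a := u i + k * L) hL (by omega) (by omega) (by omega) (by omega) huv
  refine ⟨⟨h1, ?_⟩, fun hc => ?_⟩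
  · refine ⟨?_, mem_B.1 (upd_ball ht (slab_sub h1))⟩
    have := h1.1
    simpa [Function.update_of_ne hij.symm] using this
  · exact hcon _ (Cn_trans (h2 hc.1.1) (Cn_mono slab_sub hc)) (Function.update_self _ _ _)

def BB (i : Fin d) (M K : ℕ) (L : ℤ) (u u' : Site d) : Set (Site d → Bool) :=
  {ω | ∀ k < K, ω ∈ Nk (slab i M (-(M:ℤ) + (k:ℕ) * L) L) (fun ω => (Fx i M (-(M:ℤ) + (k:ℕ) * L) u ω, Fx i M (-(M:ℤ) + (k:ℕ) * L) u' ω))}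

lemma BB_le (st : Setup d m n h p0 δ ε p) {i : Fin d} {M K : ℕ} {L : ℤ} (hL : L = 2 * (30*h) + 1) (hM : 70 * h ≤ M)
    (hK : K * L ≤ M) (hc1 : c3 d p h ≤ 1) {u u' : Site d} (hu : u ∈ ball 0 (M:ℤ)) (hu' : u' ∈ ball 0 (M:ℤ)) :
    Pr (fun _ : Site d => p) (BB i M K L u u') ≤ (1 - c3 d p h)^K := by
  have hL1 : 1 ≤ L := by rw [hL]; have := st.hh; omega
  refine bad_le st hL hM (by omega) (by omega) hc1 _ ?_ ?_
  · rintro k ⟨z, z'⟩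
    have := (Fx_dep (i := i) (M := M) (a := -(M:ℤ) + k * L) (u := u) (fun F => F = z)).inter (Fx_dep (u := u') (fun F => F = z'))
    convert this using 1
    ext ω
    exact Prod.mk_inj
  · intro k hk ω
    have := kL hL1 hK hk
    exact ⟨nx_ball hu (by omega) (by omega), nx_ball hu' (by omega) (by omega)⟩

lemma BB_join {i : Fin d} {M K : ℕ} {L : ℤ} (hL : 1 ≤ L) (hK : K * L ≤ M) {u v u' v' : Site d} {ω : Site d → Bool}
    (hω : ω ∉ BB i M K L u u') (huv : ω ∈ Cn (ball 0 (M:ℤ)) u v) (huv' : ω ∈ Cn (ball 0 (M:ℤ)) u' v')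
    (hu : u i = -(M:ℤ)) (hv : v i = M) (hu' : u' i = -(M:ℤ)) (hv' : v' i = M) : ω ∈ Cn (ball 0 (M:ℤ)) u u' := by
  by_contra hcon
  refine hω (fun k hk => ?_)
  have := kL hL hK hk
  obtain ⟨h1, h2⟩ := Fx_conn (i := i) (a := -(M:ℤ) + k * L) hL (by omega) (by omega) (by omega) (by omega) huv
  obtain ⟨h1', h2'⟩ := Fx_conn (i := i) (a := -(M:ℤ) + k * L) hL (by omega) (by omega) (by omega) (by omega) huv'
  refine ⟨⟨h1, h1'⟩, fun hc => ?_⟩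
  exact hcon (Cn_trans (h2 hc.1.1) (Cn_trans (Cn_mono slab_sub hc) (Cn_symm (h2' (Cn_mem hc).1))))

def pt (i j : Fin d) (a t : ℤ) : Site d := fun l => if l = i then a else if l = j then t else 0

lemma pt_ball {i j : Fin d} {M : ℕ} {a t : ℤ} (ha : -(M:ℤ) ≤ a ∧ a ≤ M) (ht : -(M:ℤ) ≤ t ∧ t ≤ M) : pt i j a t ∈ ball 0 (M:ℤ) := by
  rw [mem_B]
  intro l
  unfold pt
  split_ifs
  · exact ha
  · exact ht
  · omega

def BE (i j : Fin d) (M K : ℕ) (L : ℤ) : Set (Site d → Bool) :=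
  {ω | ∀ k < K, ω ∈ Nk (slab i M (-(M:ℤ) + (k:ℕ) * L) L) (fun _ => (pt i j (-(M:ℤ) + (k:ℕ) * L + 1) (-M), pt i j (-(M:ℤ) + (k:ℕ) * L + 1) M))}

lemma BE_le (st : Setup d m n h p0 δ ε p) {i j : Fin d} {M K : ℕ} {L : ℤ} (hL : L = 2 * (30*h) + 1) (hM : 70 * h ≤ M)
    (hK : K * L ≤ M) (hc1 : c3 d p h ≤ 1) :
    Pr (fun _ : Site d => p) (BE i j M K L) ≤ (1 - c3 d p h)^K := by
  have hL1 : 1 ≤ L := by rw [hL]; have := st.hh; omega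
  refine bad_le st hL hM (by omega) (by omega) hc1 _ ?_ ?_
  · intro k z ω ω' _ hz
    exact hz
  · intro k hk ω
    have := kL hL1 hK hk
    exact ⟨pt_ball (by omega) (by omega), pt_ball (by omega) (by omega)⟩

lemma BE_ex {i j : Fin d} (hij : j ≠ i) {M K : ℕ} {L : ℤ} (hL : 1 ≤ L) (hK : K * L ≤ M) {ω : Site d → Bool}
    (hω : ω ∉ BE i j M K L) : ∃ u v, ω ∈ Cn (ball 0 (M:ℤ)) u v ∧ u j = -(M:ℤ) ∧ v j = M := by
  by_contra hcon
  push Not at hcon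
  refine hω (fun k hk => ?_)
  have := kL hL hK hk
  have hb : ∀ t : ℤ, -(M:ℤ) ≤ t ∧ t ≤ M → pt i j (-(M:ℤ) + k * L + 1) t ∈ slab i M (-(M:ℤ) + (k:ℕ) * L) L := by
    intro t ht
    refine ⟨?_, mem_B.1 (pt_ball (by omega) ht)⟩
    simp only [pt, if_true]
    omega
  refine ⟨⟨hb _ (by omega), hb _ (by omega)⟩, fun hc => ?_⟩
  refine hcon _ _ (Cn_mono slab_sub hc) ?_ ?_ <;> simp [pt, hij]

end P8b

section P8c
variable {d m n : ℕ} {h : ℤ} {p0 δ ε p : ℝ}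

lemma ConnIn_iff {ξ : Config d} {S : Set (Site d)} {x y : Site d} : ConnIn ξ S x y ↔ ξ ∈ Cn S x y := by
  constructor
  · rintro ⟨n, γ, h0, hn, h1, h2⟩
    subst h0
    refine ⟨⟨(h1 0 (by omega)).2, (h1 0 (by omega)).1⟩, ?_⟩
    have : ∀ k ≤ n, γ k ∈ Clus adj (op ξ ∩ S) {γ 0} := by
      intro k
      induction k with
      | zero => intro _; exact subset_Clus rfl
      | succ k ih =>
        intro hk
        exact Clus_step (ih (by omega)) (h2 k (by omega)) ⟨(h1 _ hk).2, (h1 _ hk).1⟩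
    rw [← hn]; exact this n le_rfl
  · rintro ⟨hx, hy⟩
    refine Clus_min (S := {y | ConnIn ξ S x y}) ?_ ?_ hy
    · rintro z rfl
      exact ⟨0, fun _ => z, rfl, rfl, fun _ _ => ⟨hx.2, hx.1⟩, fun i hi => by omega⟩
    · rintro z ⟨n, γ, h0, hn, h1, h2⟩ w hzw hw
      refine ⟨n+1, fun k => if k ≤ n then γ k else w, by simp [h0], by simp, ?_, ?_⟩
      · intro i hi
        by_cases hin : i ≤ n
        · simp only [hin, if_true]; exact h1 i hin
        · simp only [hin, if_false]; exact ⟨hw.2, hw.1⟩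
      · intro i hi
        have hin : i ≤ n := by omega
        by_cases hin' : i + 1 ≤ n
        · simp only [hin, hin', if_true]; exact h2 i (by omega)
        · obtain rfl : i = n := by omega
          simp only [hin, hin', if_true, if_false, hn]; exact hzw

lemma Big_ext (hd : 0 < d) {M : ℕ} {ξ : Config d} {x : Site d} (hb : BigCluster d M ξ x) :
    ∃ i u v, ξ ∈ Cn (ball 0 (M:ℤ)) x u ∧ ξ ∈ Cn (ball 0 (M:ℤ)) u v ∧ u i + M ≤ v i := by
  obtain ⟨u, hu, v, hv, huv⟩ := hb
  have hu' := ConnIn_iff.1 hu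
  have hv' := ConnIn_iff.1 hv
  haveI : Nonempty (Fin d) := ⟨⟨0, hd⟩⟩
  obtain ⟨i, -, hi⟩ := Finset.exists_mem_eq_sup (Finset.univ : Finset (Fin d)) Finset.univ_nonempty (fun i => (u i - v i).natAbs)
  have hi' : M ≤ (u i - v i).natAbs := by rw [← hi]; exact huv
  rcases le_total (u i) (v i) with h1 | h1
  · exact ⟨i, u, v, hu', Cn_trans (Cn_symm hu') hv', by omega⟩
  · exact ⟨i, v, u, hv', Cn_trans (Cn_symm hv') hu', by omega⟩

lemma ext_Big {M : ℕ} {ξ : Config d} {u v : Site d} {i : Fin d} (huv : ξ ∈ Cn (ball 0 (M:ℤ)) u v) (he : u i + M ≤ v i) : BigCluster d M ξ u := by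
  refine ⟨u, ConnIn_iff.2 ⟨huv.1, subset_Clus rfl⟩, v, ConnIn_iff.2 huv, ?_⟩
  have : (u i - v i).natAbs ≤ dinf u v := Finset.le_sup (f := fun i => (u i - v i).natAbs) (Finset.mem_univ i)
  omega

/-- the sign of a face -/
def fsg (M : ℕ) (b : Bool) : ℤ := if b then M else -M

lemma fsg_le (M : ℕ) (b : Bool) : -(M:ℤ) ≤ fsg M b ∧ fsg M b ≤ M := by
  cases b <;> simp [fsg]

lemma EM_of_good (hd : 3 ≤ d) {M K : ℕ} {L : ℤ} (hL : 1 ≤ L) (hK : K * L ≤ M) {ω : Config d} {i0 j0 : Fin d} (hij : j0 ≠ i0)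
    (hA : ∀ i j b, ∀ u ∈ ball 0 (M:ℤ), ω ∉ BA i j M K L (fsg M b) u)
    (hB : ∀ u ∈ ball 0 (M:ℤ), ∀ u' ∈ ball 0 (M:ℤ), ω ∉ BB i0 M K L u u') (hE : ω ∉ BE i0 j0 M K L) : ω ∈ EM d M := by
  have touch : ∀ x, BigCluster d M ω x → ∀ j b, ∃ y, ω ∈ Cn (ball 0 (M:ℤ)) x y ∧ y j = fsg M b := by
    intro x hx j b
    obtain ⟨i, u, v, h1, h2, h3⟩ := Big_ext (by omega) hx
    have t1 : ∀ j b, j ≠ i → ∃ y, ω ∈ Cn (ball 0 (M:ℤ)) u y ∧ y j = fsg M b := fun j b hj =>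
      BA_touch hj hL hK (fsg_le M b) (hA i j b u h2.1.2) h2 h3
    by_cases hj : j = i
    · subst hj
      obtain ⟨k, hk, -⟩ := exists_third hd j j
      obtain ⟨y, hy, hy'⟩ := t1 k false hk
      obtain ⟨z, hz, hz'⟩ := t1 k true hk
      obtain ⟨w, hw, hw'⟩ := BA_touch (i := k) (j := j) hk.symm hL hK (fsg_le M b) (hA k j b y (Cn_mem hy).2) (Cn_trans (Cn_symm hy) hz)
        (by rw [hy', hz']; simp [fsg])
      exact ⟨w, Cn_trans h1 (Cn_trans hy hw), hw'⟩
    · obtain ⟨y, hy, hy'⟩ := t1 j b hj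
      exact ⟨y, Cn_trans h1 hy, hy'⟩
  refine ⟨?_, ?_, ?_⟩
  · obtain ⟨u, v, h1, h2, h3⟩ := BE_ex hij hL hK hE
    exact ⟨u, ext_Big (i := j0) h1 (by omega)⟩
  · intro x y hx hy
    obtain ⟨u, hu, hu'⟩ := touch x hx i0 false
    obtain ⟨v, hv, hv'⟩ := touch x hx i0 true
    obtain ⟨w, hw, hw'⟩ := touch y hy i0 false
    obtain ⟨z, hz, hz'⟩ := touch y hy i0 true
    have := BB_join hL hK (hB u (Cn_mem hu).2 w (Cn_mem hw).2) (Cn_trans (Cn_symm hu) hv) (Cn_trans (Cn_symm hw) hz)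
      (by simpa [fsg] using hu') (by simpa [fsg] using hv') (by simpa [fsg] using hw') (by simpa [fsg] using hz')
    exact ConnIn_iff.2 (Cn_trans hu (Cn_trans this (Cn_symm hw)))
  · intro x hx i
    obtain ⟨y, hy, hy'⟩ := touch x hx i true
    obtain ⟨z, hz, hz'⟩ := touch x hx i false
    exact ⟨⟨y, ConnIn_iff.2 hy, by simpa [fsg] using hy'⟩, ⟨z, ConnIn_iff.2 hz, by simpa [fsg] using hz'⟩⟩

lemma ball_card (M : ℕ) : ((ball_finite (0 : Site d) (M:ℤ)).toFinset.card : ℝ) ≤ (2*M+1)^d := by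
  classical
  have : (ball_finite (0 : Site d) (M:ℤ)).toFinset ⊆ Fintype.piFinset (fun _ : Fin d => Finset.Icc (-(M:ℤ)) M) := by
    intro x hx
    rw [Set.Finite.mem_toFinset, mem_B] at hx
    rw [Fintype.mem_piFinset]
    intro j
    rw [Finset.mem_Icc]
    exact hx j
  have h2 := Finset.card_le_card this
  rw [Fintype.card_piFinset_const, Int.card_Icc] at h2
  have e : ((M:ℤ) + 1 - -(M:ℤ)).toNat = 2*M+1 := by omega
  rw [e] at h2
  exact_mod_cast h2

lemma EMc_le (st : Setup d m n h p0 δ ε p) {M K : ℕ} {L : ℤ} (hL : L = 2 * (30*h) + 1) (hM : 70 * h ≤ M)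
    (hK : K * L ≤ M) (hc1 : c3 d p h ≤ 1) :
    Pr (fun _ : Site d => p) (EM d M)ᶜ ≤ (2*d^2+2) * (2*M+1)^(2*d) * (1 - c3 d p h)^K := by
  have hL1 : 1 ≤ L := by rw [hL]; have := st.hh; omega
  have hd := st.hd
  obtain ⟨i0, -⟩ : ∃ i : Fin d, True := ⟨⟨0, by omega⟩, trivial⟩
  obtain ⟨j0, hij, -⟩ := exists_third hd i0 i0
  set Bf := (ball_finite (0 : Site d) (M:ℤ)).toFinset with hBf
  have mB : ∀ u, u ∈ Bf ↔ u ∈ ball (0 : Site d) (M:ℤ) := fun u => Set.Finite.mem_toFinset _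
  set q := 1 - c3 d p h with hq
  have hq0 : 0 ≤ q := by rw [hq]; linarith
  have hqK : 0 ≤ q^K := pow_nonneg hq0 K
  set N : ℝ := (2*M+1)^d with hN
  have hN1 : 1 ≤ N := one_le_pow₀ (by have : (0:ℝ) ≤ M := Nat.cast_nonneg M; linarith)
  have hcard : (Bf.card : ℝ) ≤ N := ball_card M
  have sub : (EM d M)ᶜ ⊆ ((⋃ u ∈ Bf, ⋃ t : Fin d × Fin d × Bool, BA t.1 t.2.1 M K L (fsg M t.2.2) u) ∪
      (⋃ uu ∈ Bf ×ˢ Bf, BB i0 M K L uu.1 uu.2)) ∪ BE i0 j0 M K L := by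
    intro ω hω
    by_contra hcon
    rw [Set.mem_union, Set.mem_union, not_or, not_or] at hcon
    obtain ⟨⟨hA, hB⟩, hE⟩ := hcon
    refine hω (EM_of_good hd hL1 hK hij ?_ ?_ hE)
    · intro i j b u hu hbad
      exact hA (Set.mem_biUnion ((mB u).2 hu) (Set.mem_iUnion.2 ⟨(i, j, b), hbad⟩))
    · intro u hu u' hu' hbad
      exact hB (Set.mem_biUnion (x := (u, u')) (Finset.mem_product.2 ⟨(mB u).2 hu, (mB u').2 hu'⟩) hbad)
  have hA : Pr (fun _ : Site d => p) (⋃ u ∈ Bf, ⋃ t : Fin d × Fin d × Bool, BA t.1 t.2.1 M K L (fsg M t.2.2) u) ≤ Bf.card * ((d*(d*2)) * q^K) := by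
    refine (Pr_biUnion_le _ _ _).trans ?_
    rw [← nsmul_eq_mul]
    refine Finset.sum_le_card_nsmul _ _ _ fun u hu => ?_
    refine (Pr_iUnion_le _ _).trans ((Finset.sum_le_card_nsmul _ _ (q^K) fun t _ => BA_le st hL hM hK hc1 (fsg_le M _) ((mB u).1 hu)).trans (le_of_eq ?_))
    rw [nsmul_eq_mul]
    simp
  have hB : Pr (fun _ : Site d => p) (⋃ uu ∈ Bf ×ˢ Bf, BB i0 M K L uu.1 uu.2) ≤ (Bf.card * Bf.card) * q^K := by
    refine (Pr_biUnion_le _ _ _).trans ?_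
    refine (Finset.sum_le_card_nsmul _ _ (q^K) fun u hu => ?_).trans (le_of_eq ?_)
    · rw [Finset.mem_product, mB, mB] at hu
      exact BB_le st hL hM hK hc1 hu.1 hu.2
    · rw [nsmul_eq_mul, Finset.card_product]; push_cast; rfl
  have hE := BE_le (i := i0) (j := j0) st hL hM hK hc1
  have tot := (Pr_mono (fun _ : Site d => p) sub).trans ((Pr_union_le _ _ _).trans (add_le_add ((Pr_union_le _ _ _).trans (add_le_add hA hB)) hE))
  refine tot.trans ?_
  have e : ((2*M+1:ℝ))^(2*d) = N * N := by rw [hN, ← pow_add, two_mul d]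
  rw [e]
  have c0 : (0:ℝ) ≤ Bf.card := Nat.cast_nonneg _
  have hNN : N ≤ N * N := by nlinarith
  have h1 : (Bf.card:ℝ) * ((d*(d*2)) * q^K) ≤ (N*N) * ((d*(d*2)) * q^K) :=
    mul_le_mul_of_nonneg_right (hcard.trans hNN) (mul_nonneg (by positivity) hqK)
  have h2 : ((Bf.card:ℝ) * Bf.card) * q^K ≤ (N*N) * q^K :=
    mul_le_mul_of_nonneg_right (mul_le_mul hcard hcard c0 (by linarith)) hqK
  have h3 : q^K ≤ (N*N) * q^K := le_mul_of_one_le_left hqK (by linarith)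
  nlinarith

end P8c

section P8d

lemma final_const {c L : ℝ} (hc : 0 < c) (hL : 0 < L) (A M0 : ℝ) (hA : 0 ≤ A) (N : ℕ) (f : ℕ → ℝ) (hf1 : ∀ M, f M ≤ 1)
    (hf : ∀ M : ℕ, M0 ≤ M → ∃ K : ℕ, (M:ℝ) / L - 1 ≤ K ∧ f M ≤ A * (2*M+1)^N * (1 - c)^K) (hc1 : c ≤ 1) :
    ∃ a b : ℝ, 0 < a ∧ 0 < b ∧ ∀ M : ℕ, f M ≤ a * Real.exp (-b * M) := by
  have hβ : 0 < c / L := div_pos hc hL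
  set β := c / L with hβd
  set A1 : ℝ := A * (N.factorial * (4/β)^N * Real.exp (β/4)) * Real.exp c with hA1
  have hA10 : 0 ≤ A1 := by positivity
  refine ⟨A1 + Real.exp (β/2 * M0), β/2, by positivity, by positivity, fun M => ?_⟩
  rcases le_or_gt M0 (M:ℝ) with h | h
  · obtain ⟨K, hK, hfM⟩ := hf M h
    have h1 : (1 - c)^K ≤ Real.exp c * Real.exp (-β * M) := by
      have e1 : 1 - c ≤ Real.exp (-c) := by linarith [Real.add_one_le_exp (-c)]
      refine (pow_le_pow_left₀ (by linarith) e1 K).trans ?_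
      rw [← Real.exp_nat_mul, ← Real.exp_add]
      refine Real.exp_le_exp.2 ?_
      have : β * M = c * (M / L) := by rw [hβd]; ring
      nlinarith
    have h2 : ((2*M+1:ℝ))^N ≤ N.factorial * (4/β)^N * Real.exp (β/4) * Real.exp (β/2 * M) := by
      have hx : (0:ℝ) ≤ β/4 * (2*M+1) := by positivity
      have := Real.pow_div_factorial_le_exp _ hx N
      rw [div_le_iff₀ (by positivity)] at this
      have e : ((2*M+1:ℝ))^N = (4/β)^N * (β/4 * (2*M+1))^N := by
        rw [← mul_pow]; congr 1; field_simp
      have e3 : Real.exp (β/4 * (2*M+1)) = Real.exp (β/4) * Real.exp (β/2 * M) := by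
        rw [← Real.exp_add]; congr 1; ring
      rw [e3] at this
      rw [e]
      have h4 : (0:ℝ) ≤ (4/β)^N := by positivity
      nlinarith [mul_le_mul_of_nonneg_left this h4]
    have e5 : Real.exp (β/2 * M) * Real.exp (-β * M) = Real.exp (-(β/2) * M) := by
      rw [← Real.exp_add]; congr 1; ring
    have h6 : A * (2*M+1)^N * (1 - c)^K ≤ A * (N.factorial * (4/β)^N * Real.exp (β/4) * Real.exp (β/2 * M)) * (Real.exp c * Real.exp (-β * M)) :=
      mul_le_mul (mul_le_mul_of_nonneg_left h2 hA) h1 (pow_nonneg (by linarith) _) (by positivity)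
    have e7 : A * (N.factorial * (4/β)^N * Real.exp (β/4) * Real.exp (β/2 * M)) * (Real.exp c * Real.exp (-β * M)) = A1 * Real.exp (-(β/2) * M) := by
      rw [← e5, hA1]; ring
    have h8 : 0 ≤ Real.exp (β/2 * M0) * Real.exp (-(β/2) * M) := by positivity
    rw [add_mul]
    linarith
  · refine (hf1 M).trans ?_
    rw [add_mul, ← Real.exp_add]
    have h1 : (1:ℝ) ≤ Real.exp (β/2 * M0 + -(β/2) * M) := Real.one_le_exp (by nlinarith)
    have h2 : 0 ≤ A1 * Real.exp (-(β/2) * M) := by positivity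
    linarith

lemma c3_le_one {d m n : ℕ} {h : ℤ} {p0 δ ε p : ℝ} (st : Setup d m n h p0 δ ε p) : c3 d p h ≤ 1 := by
  have hd := st.hd
  have hh := st.hh
  have h0 : 0 < h := by omega
  have key := slab_conn (i := ⟨0, by omega⟩) (M := (70*h).toNat) (a := -1) st (by omega) (by omega) (by omega) (x := 0) (y := 0)
    ⟨⟨by simp, by simp; omega⟩, fun j => by simp⟩ ⟨⟨by simp, by simp; omega⟩, fun j => by simp⟩
  exact key.trans (Pr_le_one _ _)

lemma bern_pow (N : ℕ) {p p0 δ : ℝ} (h0 : 0 ≤ p0) (h2 : p0 ≤ 1) (h1 : p0 ≤ p) (hδ : δ ≤ 1) (hN : N * δ ≤ p - p0) :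
    1 - (1 - p0) * (1 - δ)^N ≤ p := by
  have := one_add_mul_le_pow (a := -δ) (by linarith) N
  rw [← sub_eq_add_neg] at this
  have h3 : 0 ≤ p0 * (p - p0) := mul_nonneg h0 (by linarith)
  have h4 : (1 - p0) * (1 - (p - p0)) ≤ (1 - p0) * (1-δ)^N := mul_le_mul_of_nonneg_left (by linarith) (by linarith)
  nlinarith

end P8d

/-- Let `π_p`, `p ∈ [0,1]`, be the Bernoulli site-percolation measures
on `{0,1}^{ℤ^d}`, `d ≥ 3`, and `p_c = sup{p ∈ [0,1] : π_p(Perc) = 0}`. For `p > p_c`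
there are constants `a, b > 0` with `π_p(E_Mᶜ) ≤ a·exp(−b·M)` for every `M ∈ ℕ`. -/
theorem EM_complement_exponential_decay (d : ℕ) (hd : 3 ≤ d)
    (π : ℝ → Measure (Config d))
    (hπ : ∀ p ∈ Set.Icc (0 : ℝ) 1, IsBernoulliProduct d p (π p))
    (p : ℝ) (hp : p ∈ Set.Icc (0 : ℝ) 1)
    (hppc : sSup {q : ℝ | q ∈ Set.Icc (0 : ℝ) 1 ∧ π q (Perc d) = 0} < p) :
    ∃ a b : ℝ, 0 < a ∧ 0 < b ∧ ∀ M : ℕ,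
      π p ((EM d M)ᶜ) ≤ ENNReal.ofReal (a * Real.exp (-b * M)) := by
  set S := {q : ℝ | q ∈ Set.Icc (0 : ℝ) 1 ∧ π q (Perc d) = 0} with hS
  have hS0 : 0 ≤ sSup S := Real.sSup_nonneg fun q hq => hq.1.1
  have hp1 := hp.2
  set p0 := (sSup S + p)/2 with hp0
  have h0 : 0 < p0 := by rw [hp0]; linarith
  have h1 : p0 < p := by rw [hp0]; linarith
  have h2 : p0 < 1 := by linarith
  have hI : p0 ∈ Set.Icc (0:ℝ) 1 := ⟨h0.le, h2.le⟩
  have hne : mu (fun _ : Site d => p0) (Perc d) ≠ 0 := by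
    rw [← eq_mu hI (hπ p0 hI)]
    intro hz
    have : p0 ≤ sSup S := le_csSup ⟨1, fun q hq => hq.1.2⟩ ⟨hI, hz⟩
    rw [hp0] at this
    linarith
  set δ := (p - p0)/700 with hδ
  have hδ0 : 0 < δ := by rw [hδ]; linarith
  have hδ1 : δ ≤ 1 := by rw [hδ]; linarith
  obtain ⟨m, n, hc⟩ := GMc_exists (d := d) (by omega) h0 h2 hne (ε := 1/2400) (by norm_num) hδ0 hδ1
  have st : Setup d m n ((n:ℤ) + m + 1) p0 δ (1/2400) p :=
    ⟨hd, hc, rfl, by norm_num, hp.1, hp.2, bern_pow 700 h0.le h2.le h1.le hδ1 (by rw [hδ]; push_cast; linarith)⟩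
  set h : ℤ := (n:ℤ) + m + 1 with hh
  have hpp : 0 < p := by linarith
  have hc1 := c3_le_one st
  set L : ℕ := 60 * (n + m + 1) + 1 with hL
  have hLz : (L:ℤ) = 2 * (30*h) + 1 := by rw [hL, hh]; push_cast; ring
  obtain ⟨a, b, ha, hb, hab⟩ := final_const (c := c3 d p h) (L := (L:ℝ)) (c3_pos hpp) (by positivity) (2*d^2+2) (70 * (n+m+1)) (by positivity) (2*d)
    (fun M => Pr (fun _ : Site d => p) (EM d M)ᶜ) (fun M => Pr_le_one _ _) (fun M hM => by
      refine ⟨M / L, ?_, EMc_le st hLz ?_ ?_ hc1⟩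
      · have h3 : M < L * (M / L) + L := by
          have := Nat.div_add_mod M L
          have := Nat.mod_lt M (show 0 < L by omega)
          omega
        have h4 : (M:ℝ) < L * (M / L : ℕ) + L := by exact_mod_cast h3
        have hLp : (0:ℝ) < L := by positivity
        rw [sub_le_iff_le_add, div_le_iff₀ hLp]
        nlinarith
      · rw [hh]
        exact_mod_cast hM
      · exact_mod_cast Nat.div_mul_le_self M L) hc1
  refine ⟨a, b, ha, hb, fun M => ?_⟩
  rw [eq_mu hp (hπ p hp), ← ofReal_measureReal]
  exact ENNReal.ofReal_le_ofReal (hab M)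


end VoterPerc
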